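/- Fix integers k ≥ 3 and 1 ≤ d < k/2, and let g(k,d) := 1 − (1 − (k−d)(k−2d−1)/(k−1)²)·(1 − 1/k)^{k−d}. Then for every ε > 0 there exists n₀ such that for all n ≥ n₀ with k dividing n, every k-uniform hypergraph H on n vertices with δ_d(H) ≥ max{δ(n,k,d) + 1, (g(k,d) + ε)·C(n−d, k−d)} contains a perfect matching. -/

import Mathlib

/-- The minimum `d`-degree of a `k`-graph `H` on `Fin n`: the minimum over all `d`-sets `S` of
the number of edges of `H` containing `S`. -/
noncomputable def minDeg {n : ℕ} (H : Finset (Finset (Fin n))) (d : ℕ) : ℕ :=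
  sInf { m | ∃ S : Finset (Fin n), S.card = d ∧ (H.filter fun e => S ⊆ e).card = m }

/-- The extremal family `H_ext(n,k)`: all `k`-graphs `B̄(A,B)` (edges meeting `A` in an even
number of vertices) with `A, B = Aᶜ` a partition into nonempty sets and `|A|` odd, together with
all `k`-graphs `B(A,B)` (edges meeting `A` in an odd number of vertices) with `|A| - n/k` odd. -/
def Hext (n k : ℕ) : Set (Finset (Finset (Fin n))) :=
  { H | ∃ A : Finset (Fin n), A.Nonempty ∧ Aᶜ.Nonempty ∧
      ((Odd A.card ∧
          H = (Finset.univ.powersetCard k).filter fun e => Even (e ∩ A).card) ∨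
       (Odd ((A.card : ℤ) - (n / k : ℕ)) ∧
          H = (Finset.univ.powersetCard k).filter fun e => Odd (e ∩ A).card)) }

/-- `δ(n,k,d)`: the maximum of the minimum `d`-degrees among the hypergraphs in `H_ext(n,k)`. -/
noncomputable def deltaExt (n k d : ℕ) : ℕ :=
  sSup { m | ∃ H ∈ Hext n k, minDeg H d = m }

/-- `H` has a perfect matching: a set of pairwise disjoint edges covering all vertices. -/
def HasPerfectMatching {n : ℕ} (H : Finset (Finset (Fin n))) : Prop :=
  ∃ M ⊆ H, (M : Set (Finset (Fin n))).PairwiseDisjoint id ∧ M.biUnion id = Finset.univ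



namespace PMH
open Finset
open scoped Classical

/-- average of a real function over a finite type -/
noncomputable def av {Ω : Type*} [Fintype Ω] (f : Ω → ℝ) : ℝ :=
  (∑ ω, f ω) / (Fintype.card Ω : ℝ)

/-- probability of an event under the uniform distribution on a finite type -/
noncomputable def pr {Ω : Type*} [Fintype Ω] (P : Ω → Prop) : ℝ :=
  av (fun ω => if P ω then (1 : ℝ) else 0)

section basics
variable {Ω Ω' : Type*} [Fintype Ω] [Fintype Ω']

lemma av_add (f g : Ω → ℝ) : av (fun ω => f ω + g ω) = av f + av g := by
  simp only [av, Finset.sum_add_distrib, add_div]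

lemma av_sub (f g : Ω → ℝ) : av (fun ω => f ω - g ω) = av f - av g := by
  simp only [av, Finset.sum_sub_distrib, sub_div]

lemma av_mul_left (c : ℝ) (f : Ω → ℝ) : av (fun ω => c * f ω) = c * av f := by
  simp only [av, ← Finset.mul_sum, mul_div_assoc]

lemma av_mul_right (c : ℝ) (f : Ω → ℝ) : av (fun ω => f ω * c) = av f * c := by
  simp only [av, ← Finset.sum_mul]; ring

lemma av_mono {f g : Ω → ℝ} (h : ∀ ω, f ω ≤ g ω) : av f ≤ av g := by
  unfold av; gcongr; exact h _

lemma av_nonneg {f : Ω → ℝ} (h : ∀ ω, 0 ≤ f ω) : 0 ≤ av f := by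
  unfold av; exact div_nonneg (Finset.sum_nonneg fun i _ => h i) (by positivity)

lemma av_const [Nonempty Ω] (c : ℝ) : av (fun _ : Ω => c) = c := by
  have : (Fintype.card Ω : ℝ) ≠ 0 := by exact_mod_cast Fintype.card_ne_zero
  simp only [av, Finset.sum_const, Finset.card_univ, nsmul_eq_mul]; field_simp

lemma av_sum {ι : Type*} (s : Finset ι) (f : ι → Ω → ℝ) :
    av (fun ω => ∑ i ∈ s, f i ω) = ∑ i ∈ s, av (f i) := by
  simp only [av]; rw [Finset.sum_comm, Finset.sum_div]

lemma av_equiv (e : Ω ≃ Ω') (f : Ω' → ℝ) : av (fun ω => f (e ω)) = av f := by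
  unfold av; rw [Fintype.card_congr e, Equiv.sum_comp e f]

lemma av_prod (f : Ω × Ω' → ℝ) : av f = av (fun a => av (fun b => f (a, b))) := by
  simp only [av, Fintype.sum_prod_type, Fintype.card_prod, Nat.cast_mul, ← Finset.sum_div]
  rw [div_div, mul_comm (Fintype.card Ω' : ℝ)]

lemma av_comm (f : Ω → Ω' → ℝ) : av (fun a => av (fun b => f a b)) = av (fun b => av (fun a => f a b)) := by
  simp only [av, ← Finset.sum_div]
  rw [div_div, div_div, Finset.sum_comm, mul_comm (Fintype.card Ω' : ℝ)]

lemma exists_le_av [Nonempty Ω] (f : Ω → ℝ) : ∃ ω, f ω ≤ av f := by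
  by_contra h
  push Not at h
  have hc : (0 : ℝ) < Fintype.card Ω := by exact_mod_cast Fintype.card_pos
  have : av f * Fintype.card Ω < ∑ ω, f ω := by
    calc av f * Fintype.card Ω = ∑ _ω : Ω, av f := by simp [mul_comm]
      _ < _ := Finset.sum_lt_sum_of_nonempty Finset.univ_nonempty (fun i _ => h i)
  unfold av at this
  rw [div_mul_cancel₀ _ hc.ne'] at this
  exact lt_irrefl _ this

lemma exists_av_le [Nonempty Ω] (f : Ω → ℝ) : ∃ ω, av f ≤ f ω := by
  obtain ⟨ω, h⟩ := exists_le_av (fun ω => - f ω)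
  refine ⟨ω, ?_⟩
  have : av (fun ω => - f ω) = - av f := by simp [av, neg_div]
  rw [this] at h; linarith

lemma pr_eq (P : Ω → Prop) [DecidablePred P] :
    pr P = ((univ.filter P).card : ℝ) / Fintype.card Ω := by
  rw [pr, av, Finset.card_filter]
  push_cast
  congr 1
  apply Finset.sum_congr rfl
  intro x _
  by_cases h : P x <;> simp [h]

lemma card_filter_eq [Nonempty Ω] (P : Ω → Prop) [DecidablePred P] : ((univ.filter P).card : ℝ) = pr P * Fintype.card Ω := by
  have : (Fintype.card Ω : ℝ) ≠ 0 := by exact_mod_cast Fintype.card_ne_zero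
  rw [pr_eq]; field_simp

lemma pr_nonneg (P : Ω → Prop) : 0 ≤ pr P := av_nonneg (fun ω => by split_ifs <;> norm_num)

lemma pr_le_one (P : Ω → Prop) : pr P ≤ 1 := by
  rw [pr_eq]
  apply div_le_one_of_le₀ _ (by positivity)
  exact_mod_cast Finset.card_le_univ _

lemma pr_mono {P Q : Ω → Prop} (h : ∀ ω, P ω → Q ω) : pr P ≤ pr Q := by
  apply av_mono; intro ω
  by_cases hP : P ω
  · simp [hP, h ω hP]
  · simp only [hP, if_false]; split_ifs <;> norm_num

lemma pr_congr {P Q : Ω → Prop} (h : ∀ ω, P ω ↔ Q ω) : pr P = pr Q := by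
  have : P = Q := by ext ω; exact h ω
  rw [this]

lemma pr_or_le (P Q : Ω → Prop) : pr (fun ω => P ω ∨ Q ω) ≤ pr P + pr Q := by
  unfold pr; rw [← av_add]; apply av_mono; intro ω
  by_cases h1 : P ω <;> by_cases h2 : Q ω <;> simp [h1, h2]

lemma pr_true [Nonempty Ω] : pr (fun _ : Ω => True) = 1 := by simp [pr, av_const]

lemma pr_false : pr (fun _ : Ω => False) = 0 := by simp [pr, av]

lemma pr_not [Nonempty Ω] (P : Ω → Prop) : pr (fun ω => ¬ P ω) = 1 - pr P := by
  have : pr P + pr (fun ω => ¬ P ω) = 1 := by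
    unfold pr; rw [← av_add]
    refine Eq.trans ?_ (av_const (Ω := Ω) 1); congr 1; ext ω
    by_cases h : P ω <;> simp [h]
  linarith

lemma pr_and_not (P Q : Ω → Prop) : pr P = pr (fun ω => P ω ∧ Q ω) + pr (fun ω => P ω ∧ ¬ Q ω) := by
  unfold pr; rw [← av_add]; congr 1; ext ω
  by_cases h : P ω <;> by_cases h' : Q ω <;> simp [h, h']

lemma pr_exists_le {ι : Type*} [Fintype ι] (P : ι → Ω → Prop) :
    pr (fun ω => ∃ i, P i ω) ≤ ∑ i, pr (P i) := by
  unfold pr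
  rw [← av_sum]
  apply av_mono
  intro ω
  split_ifs with h
  · obtain ⟨i, hi⟩ := h
    calc (1 : ℝ) = (if P i ω then (1 : ℝ) else 0) := by simp [hi]
      _ ≤ _ := Finset.single_le_sum (f := fun i => if P i ω then (1 : ℝ) else 0)
          (fun i _ => by split_ifs <;> norm_num) (mem_univ i)
  · exact Finset.sum_nonneg (fun i _ => by split_ifs <;> norm_num)

lemma pr_equiv (e : Ω ≃ Ω') (P : Ω' → Prop) : pr (fun ω => P (e ω)) = pr P :=
  av_equiv e (fun ω => if P ω then (1 : ℝ) else 0)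

lemma exists_of_pr_pos {P : Ω → Prop} (h : 0 < pr P) : ∃ ω, P ω := by
  by_contra hn
  push Not at hn
  have : pr P = 0 := by
    rw [← pr_false (Ω := Ω)]; apply pr_congr; simpa using hn
  linarith

lemma pr_prod (P : Ω → Ω' → Prop) : pr (fun x : Ω × Ω' => P x.1 x.2) = av (fun a => pr (P a)) := by
  unfold pr; rw [av_prod]

lemma pr_prod_ge {P : Ω → Prop} {Q : Ω → Ω' → Prop} {p q : ℝ} (hq : 0 ≤ q) (hP : p ≤ pr P)
    (hQ : ∀ a, P a → q ≤ pr (Q a)) : p * q ≤ pr (fun x : Ω × Ω' => P x.1 ∧ Q x.1 x.2) := by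
  rw [pr_prod (fun a b => P a ∧ Q a b)]
  calc p * q ≤ pr P * q := by gcongr
    _ = av (fun a => (if P a then (1:ℝ) else 0) * q) := by rw [av_mul_right]; rfl
    _ ≤ _ := by
      apply av_mono; intro a
      by_cases h : P a
      · simpa [h] using hQ a h
      · simp [h, pr_nonneg]

lemma pr_prod_indep (P : Ω → Prop) (Q : Ω' → Prop) :
    pr (fun x : Ω × Ω' => P x.1 ∧ Q x.2) = pr P * pr Q := by
  rw [pr_prod (fun a b => P a ∧ Q b)]
  unfold pr
  rw [← av_mul_right]
  congr 1; ext a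
  by_cases h : P a
  · simp [h]
  · simp [h, av]

/-- Markov -/
lemma pr_markov {f : Ω → ℝ} (hf : ∀ ω, 0 ≤ f ω) {c : ℝ} (hc : 0 < c) :
    pr (fun ω => c ≤ f ω) ≤ av f / c := by
  rw [le_div_iff₀ hc]
  unfold pr
  rw [← av_mul_right]
  apply av_mono
  intro ω
  split_ifs with h
  · simpa using h
  · simpa using hf ω

end basics

section tuples
variable {κ κ' V : Type*} [Fintype κ] [Fintype κ'] [Fintype V]
variable [DecidableEq κ] [DecidableEq κ']

lemma av_comp_inj [Nonempty V] (σ : κ → κ') (hσ : Function.Injective σ) (f : (κ → V) → ℝ) :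
    av (fun x : κ' → V => f (fun i => x (σ i))) = av f := by
  let e1 : (κ' → V) ≃ ({i // i ∈ Set.range σ} → V) × ({i // ¬ i ∈ Set.range σ} → V) :=
    Equiv.piEquivPiSubtypeProd (fun i => i ∈ Set.range σ) (fun _ => V)
  let e2 : (κ → V) ≃ ({i // i ∈ Set.range σ} → V) :=
    Equiv.arrowCongr (Equiv.ofInjective σ hσ) (Equiv.refl V)
  have h1 : av (fun x : κ' → V => f (fun i => x (σ i))) =
      av (fun x : κ' → V => (fun y : ({i // i ∈ Set.range σ} → V) × ({i // ¬ i ∈ Set.range σ} → V) =>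
        f (e2.symm y.1)) (e1 x)) := by
    congr 1
  rw [h1]
  refine (av_equiv e1 (fun y => f (e2.symm y.1))).trans ?_
  rw [av_prod]
  simp only [av_const]
  rw [av_equiv e2.symm f]

lemma pr_comp_inj [Nonempty V] (σ : κ → κ') (hσ : Function.Injective σ) (P : (κ → V) → Prop) :
    pr (fun x : κ' → V => P (fun i => x (σ i))) = pr P :=
  av_comp_inj σ hσ (fun x => if P x then (1 : ℝ) else 0)

lemma av_pi_prod {Ω : κ → Type*} [∀ i, Fintype (Ω i)] (f : ∀ i, Ω i → ℝ) :
    av (fun x : ∀ i, Ω i => ∏ i, f i (x i)) = ∏ i, av (f i) := by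
  unfold av
  rw [Finset.prod_div_distrib, Fintype.card_pi, Nat.cast_prod, ← Fintype.piFinset_univ,
    ← Finset.prod_univ_sum]

lemma pr_pi {Ω : κ → Type*} [∀ i, Fintype (Ω i)] (P : ∀ i, Ω i → Prop) :
    pr (fun x : ∀ i, Ω i => ∀ i, P i (x i)) = ∏ i, pr (P i) := by
  unfold pr
  rw [← av_pi_prod]
  congr 1; ext x
  by_cases h : ∀ i, P i (x i)
  · simp [h]
  · rw [if_neg h]
    push Not at h
    obtain ⟨i, hi⟩ := h
    symm
    apply Finset.prod_eq_zero (mem_univ i)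
    simp [hi]

lemma pr_apply_mem [Nonempty V] (i : κ) (s : Finset V) :
    pr (fun x : κ → V => x i ∈ s) = (s.card : ℝ) / Fintype.card V := by
  have h := pr_comp_inj (V := V) (fun _ : Unit => i) (fun _ _ _ => rfl) (fun x => x () ∈ s)
  rw [show pr (fun x : κ → V => x i ∈ s) = pr (fun x : Unit → V => x () ∈ s) from h]
  refine (pr_equiv (Equiv.funUnique Unit V) (fun v => v ∈ s)).trans ?_
  rw [pr_eq]
  simp

lemma pr_apply_eq [Nonempty V] [DecidableEq V] {i j : κ} (hij : i ≠ j) :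
    pr (fun x : κ → V => x i = x j) = 1 / Fintype.card V := by
  have h := pr_comp_inj (V := V) (fun b : Bool => if b then i else j)
    (by intro a b; cases a <;> cases b <;> simp [hij, hij.symm]) (fun x => x true = x false)
  simp only [if_true, Bool.false_eq_true, if_false] at h
  rw [h]
  refine (pr_equiv (Equiv.boolArrowEquivProd V) (fun p => p.2 = p.1)).trans ?_
  rw [pr_prod (fun a b : V => b = a)]
  have : ∀ a : V, pr (fun b => b = a) = 1 / Fintype.card V := by
    intro a; rw [pr_eq]
    have h2 : (univ.filter (fun b : V => b = a)) = {a} := by ext b; simp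
    rw [h2]; simp
  simp only [this, av_const]

lemma pr_not_inj_le [Nonempty V] [DecidableEq V] :
    pr (fun x : κ → V => ¬ Function.Injective x) ≤ (Fintype.card κ : ℝ)^2 / Fintype.card V := by
  calc pr (fun x : κ → V => ¬ Function.Injective x)
      ≤ pr (fun x : κ → V => ∃ p : κ × κ, p.1 ≠ p.2 ∧ x p.1 = x p.2) := by
        apply pr_mono
        intro x hx
        unfold Function.Injective at hx
        push Not at hx
        obtain ⟨a, b, h1, h2⟩ := hx
        exact ⟨(a, b), h2, h1⟩
    _ ≤ ∑ p : κ × κ, pr (fun x : κ → V => p.1 ≠ p.2 ∧ x p.1 = x p.2) := pr_exists_le _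
    _ ≤ ∑ p : κ × κ, 1 / (Fintype.card V : ℝ) := by
        apply Finset.sum_le_sum
        intro p _
        by_cases h : p.1 = p.2
        · simp [h, pr_false]
        · simp only [ne_eq, h, not_false_eq_true, true_and]
          exact (pr_apply_eq h).le
    _ = _ := by simp [Fintype.card_prod]; ring

lemma pr_meets_le [Nonempty V] [DecidableEq V] (s : Finset V) :
    pr (fun x : κ → V => ∃ i, x i ∈ s) ≤ (Fintype.card κ : ℝ) * s.card / Fintype.card V := by
  refine (pr_exists_le _).trans ?_
  simp only [pr_apply_mem]
  simp [mul_div_assoc]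

end tuples
end PMH


namespace PMH
open Finset
open scoped Classical

lemma exists_top_set {V : Type*} [Fintype V] [DecidableEq V] (w : V → ℝ) (s : ℕ) (hs : 1 ≤ s)
    (hsV : s ≤ Fintype.card V) :
    ∃ (S : Finset V) (θ : ℝ), S.card = s ∧ (∀ x ∈ S, θ ≤ w x) ∧ (∀ x, x ∉ S → w x ≤ θ) ∧
      ∃ x ∈ S, w x = θ := by
  have hne : (univ.powersetCard s : Finset (Finset V)).Nonempty := by
    apply Finset.powersetCard_nonempty.2; simpa using hsV
  obtain ⟨S, hS, hmax⟩ := Finset.exists_max_image _ (fun S : Finset V => ∑ x ∈ S, w x) hne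
  have hcard : S.card = s := (Finset.mem_powersetCard.1 hS).2
  have hSne : S.Nonempty := by rw [← Finset.card_pos]; omega
  obtain ⟨x0, hx0, hmin⟩ := Finset.exists_min_image S w hSne
  refine ⟨S, w x0, hcard, hmin, ?_, x0, hx0, rfl⟩
  intro y hy
  by_contra hlt
  push Not at hlt
  have hy' : y ∉ S.erase x0 := fun h => hy (Finset.mem_of_mem_erase h)
  have := hmax (insert y (S.erase x0)) (by
    rw [Finset.mem_powersetCard]
    refine ⟨Finset.subset_univ _, ?_⟩
    rw [Finset.card_insert_of_notMem hy', Finset.card_erase_of_mem hx0]; omega)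
  rw [Finset.sum_insert hy'] at this
  have h2 := Finset.add_sum_erase S w hx0
  linarith

lemma av_single_marginal {V : Type*} [Fintype V] (q : ℕ) (Y w : V → ℝ) :
    av (fun z : Fin q → V => (∏ j, Y (z j)) * ∑ i, w (z i)) =
      q * (av (fun v => Y v * w v) * (av Y)^(q-1)) := by
  simp only [Finset.mul_sum]
  rw [av_sum]
  have : ∀ i : Fin q, av (fun z : Fin q → V => (∏ j, Y (z j)) * w (z i)) =
      av (fun v => Y v * w v) * (av Y)^(q-1) := by
    intro i
    have h1 : (fun z : Fin q → V => (∏ j, Y (z j)) * w (z i)) =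
      fun z : Fin q → V => ∏ j, (fun v => if j = i then Y v * w v else Y v) (z j) := by
      ext z
      rw [← Finset.mul_prod_erase univ _ (mem_univ i),
        ← Finset.mul_prod_erase univ (fun j => (fun v => if j = i then Y v * w v else Y v) (z j)) (mem_univ i)]
      simp only [if_true]
      have : ∏ x ∈ univ.erase i, (if x = i then Y (z x) * w (z x) else Y (z x)) =
        ∏ x ∈ univ.erase i, Y (z x) := by
        apply Finset.prod_congr rfl
        intro x hx
        simp [Finset.ne_of_mem_erase hx]
      rw [this]; ring
    rw [h1, av_pi_prod (κ := Fin q) (Ω := fun _ => V) (fun j v => if j = i then Y v * w v else Y v)]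
    rw [← Finset.mul_prod_erase univ _ (mem_univ i)]
    simp only [if_true]
    congr 1
    rw [Finset.prod_congr rfl (g := fun _ => av Y)]
    · simp
    · intro x hx
      simp [Finset.ne_of_mem_erase hx]
  rw [Finset.sum_congr rfl (fun i _ => this i)]
  simp

lemma av_insertNth {V : Type*} [Fintype V] (q : ℕ) (i : Fin (q+1)) (f : V → (Fin q → V) → ℝ) :
    av (fun x : Fin (q+1) → V => f (x i) (fun j => x (i.succAbove j))) =
      av (fun v => av (fun z => f v z)) := by
  rw [← av_prod (fun p : V × (Fin q → V) => f p.1 p.2)]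
  exact av_equiv (Fin.insertNthEquiv (fun _ => V) i).symm (fun p : V × (Fin q → V) => f p.1 p.2)

lemma sum_succAbove' {V : Type*} (q : ℕ) (i : Fin (q+1)) (w : V → ℝ) (x : Fin (q+1) → V) :
    ∑ j, w (x j) = w (x i) + ∑ j, w (x (i.succAbove j)) :=
  Fin.sum_univ_succAbove _ i

lemma weight_algebra (k q a b m τ bS bY X1 X2 Q P B1 : ℝ) (hk : 2 ≤ k) (hq : 1 ≤ q)
    (hkq : k ≤ 2 * q + 1) (ha : a = 1 / k) (hb : b = 1 - 1 / k) (hm : m = 1 - k * bS)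
    (hbY0 : 0 ≤ bY) (hbY : bY ≤ m / k) (hτ : 0 < τ) (hτ1 : τ ≤ 1) (hmτ : m ≤ τ)
    (hB1 : 0 < B1) -- b^(q-1)
    (hX1 : X1 ≤ (q + 1) * (bY * Q)) (hQ : Q ≤ q * (bY * B1) / τ)
    (hP : P ≤ a * (b * B1) * (1 - 1/τ) + bS * (b * B1) / τ + a * (q * (bY * B1)) / τ)
    (hX2 : X2 = (q + 1) * P) :
    1 - b * (b * B1) + X1 - (q + 1) * (a * (b * B1)) + X2
      ≤ 1 - (1 - (q + 1) * (2 * q + 1 - k) / (k - 1)^2) * (b * (b * B1)) := by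
  have hk0 : 0 < k := by linarith
  have hk1 : 0 < k - 1 := by linarith
  have hbk : b = (k - 1) / k := by rw [hb]; field_simp
  have hm0 : 0 ≤ m := by
    have : 0 ≤ m / k := hbY0.trans hbY
    rw [le_div_iff₀ hk0] at this; linarith
  -- u = m / τ
  obtain ⟨u, hu⟩ : ∃ u, u = m / τ := ⟨_, rfl⟩
  have hmu : m = u * τ := by rw [hu]; field_simp
  have hu0 : 0 ≤ u := by rw [hu]; positivity
  have hu1 : u ≤ 1 := by rw [hu]; exact div_le_one_of_le₀ hmτ hτ.le
  have hmu' : m ≤ u := by rw [hmu]; nlinarith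
  have hQ' : Q ≤ q * B1 * u / k := by
    calc Q ≤ q * (bY * B1) / τ := hQ
      _ ≤ q * (m / k * B1) / τ := by gcongr
      _ = q * B1 * u / k := by rw [hu]; field_simp
  have h1 : X1 ≤ (q + 1) * (u * q * B1 * u / k^2) := by
    have hQ0' : 0 ≤ q * B1 * u / k := by positivity
    calc X1 ≤ (q + 1) * (bY * Q) := hX1
      _ ≤ (q + 1) * (bY * (q * B1 * u / k)) := by gcongr
      _ ≤ (q + 1) * ((u / k) * (q * B1 * u / k)) := by
          gcongr
          exact hbY.trans (by gcongr)
      _ = _ := by field_simp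
  have hbS : bS = (1 - m) / k := by rw [hm]; field_simp; ring
  have h2 : P ≤ (1/k) * (b * B1) * (1 - u) + q * B1 * u / k^2 := by
    calc P ≤ a * (b * B1) * (1 - 1/τ) + bS * (b * B1) / τ + a * (q * (bY * B1)) / τ := hP
      _ ≤ a * (b * B1) * (1 - 1/τ) + bS * (b * B1) / τ + a * (q * (m/k * B1)) / τ := by
        have : 0 ≤ a := by rw [ha]; positivity
        gcongr
      _ = _ := by rw [ha, hbS, hu]; field_simp; ring
  have hb2 : b * (b * B1) = (k-1)^2 / k^2 * B1 := by rw [hbk]; field_simp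
  have hab : a * (b * B1) = (k - 1) / k^2 * B1 := by rw [ha, hbk]; field_simp
  have hab' : (1/k) * (b * B1) = (k - 1) / k^2 * B1 := by rw [hbk]; field_simp
  rw [hX2]
  have hfin : (q + 1) * (u * q * B1 * u / k^2) - (q + 1) * ((k - 1) / k^2 * B1) +
      (q + 1) * ((k - 1) / k^2 * B1 * (1 - u) + q * B1 * u / k^2) ≤
      (q + 1) * (2 * q + 1 - k) / k^2 * B1 := by
    have : (q + 1) * (2 * q + 1 - k) / k^2 * B1 - ((q + 1) * (u * q * B1 * u / k^2) - (q + 1) * ((k - 1) / k^2 * B1) +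
      (q + 1) * ((k - 1) / k^2 * B1 * (1 - u) + q * B1 * u / k^2)) =
      (q + 1) * B1 / k^2 * ((1 - u) * (q * (2 + u) - (k - 1))) := by
      field_simp; ring
    have h0 : 0 ≤ (q + 1) * B1 / k^2 * ((1 - u) * (q * (2 + u) - (k - 1))) := by
      have h3 : 0 ≤ 1 - u := by linarith
      have h4 : 0 ≤ q * (2 + u) - (k - 1) := by nlinarith
      positivity
    linarith
  have hR : (1 - (q + 1) * (2 * q + 1 - k) / (k - 1)^2) * (b * (b * B1)) =
      b * (b * B1) - (q + 1) * (2 * q + 1 - k) / k^2 * B1 := by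
    rw [hb2]; field_simp
  rw [hR]
  rw [hab'] at h2
  rw [hab]
  have hq1 : 0 ≤ q + 1 := by linarith
  have h5 := mul_le_mul_of_nonneg_left h2 hq1
  linarith

lemma weight_core {V : Type*} [Fintype V] [DecidableEq V] (w : V → ℝ) (hw0 : ∀ v, 0 ≤ w v)
    (hw1 : ∀ v, w v ≤ 1) (q k s : ℕ) (hk : 2 ≤ k) (hq : 1 ≤ q) (hkq : k ≤ 2 * q + 1)
    (hs : 1 ≤ s) (hV : Fintype.card V = k * s) (hsum : ∑ v, w v ≤ s) :
    pr (fun x : Fin (q+1) → V => 1 ≤ ∑ i, w (x i)) ≤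
      1 - (1 - ((q:ℝ) + 1) * (2 * q + 1 - k) / ((k:ℝ) - 1)^2) * (1 - 1/(k:ℝ))^(q+1) := by
  have hVne : Nonempty V := by
    rw [← Fintype.card_pos_iff, hV]; positivity
  have hkR : (2:ℝ) ≤ k := by exact_mod_cast hk
  have hsR : (1:ℝ) ≤ s := by exact_mod_cast hs
  have hqR : (1:ℝ) ≤ q := by exact_mod_cast hq
  have hkqR : (k:ℝ) ≤ 2 * q + 1 := by exact_mod_cast hkq
  obtain ⟨S, θ, hScard, hSθ, hYθ, x0, hx0, hx0θ⟩ := exists_top_set w s hs (by rw [hV]; nlinarith)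
  set F : (Fin (q+1) → V) → Prop := fun x => 1 ≤ ∑ i, w (x i) with hF
  set Y : V → ℝ := fun v => if v ∈ S then 0 else 1 with hY
  set Z : V → ℝ := fun v => if v ∈ S then 1 else 0 with hZ
  have hY0 : ∀ v, 0 ≤ Y v := fun v => by simp only [hY]; split_ifs <;> norm_num
  have hY1 : ∀ v, Y v ≤ 1 := fun v => by simp only [hY]; split_ifs <;> norm_num
  have hZ0 : ∀ v, 0 ≤ Z v := fun v => by simp only [hZ]; split_ifs <;> norm_num
  have hZ1 : ∀ v, Z v ≤ 1 := fun v => by simp only [hZ]; split_ifs <;> norm_num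
  have hP0 : ∀ (m : ℕ) (z : Fin m → V), 0 ≤ ∏ j, Y (z j) := fun m z =>
    Finset.prod_nonneg (fun j _ => hY0 _)
  have hP1 : ∀ (m : ℕ) (z : Fin m → V), ∏ j, Y (z j) ≤ 1 := fun m z =>
    Finset.prod_le_one (fun j _ => hY0 _) (fun j _ => hY1 _)
  have hθ0 : 0 ≤ θ := hx0θ ▸ hw0 x0
  have hθ1 : θ ≤ 1 := hx0θ ▸ hw1 x0
  have ha : av Z = 1 / k := by
    simp only [av, hZ, Finset.sum_ite_mem, Finset.univ_inter, Finset.sum_const, hScard, hV]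
    push_cast; field_simp
    simp
  have hb : av Y = 1 - 1 / k := by
    have : av Y = av (fun v => 1 - Z v) := by
      congr 1; ext v; simp only [hY, hZ]; split_ifs <;> norm_num
    rw [this, av_sub, av_const, ha]
  set bS := av (fun v => Z v * w v) with hbS
  set bY := av (fun v => Y v * w v) with hbY
  have hbY0 : 0 ≤ bY := av_nonneg fun v => mul_nonneg (hY0 v) (hw0 v)
  have hbYS : bY + bS ≤ 1 / k := by
    rw [hbY, hbS, ← av_add]
    have : (fun v => Y v * w v + Z v * w v) = w := by
      ext v; simp only [hY, hZ]; split_ifs <;> ring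
    rw [this, av, hV]
    push_cast
    rw [div_le_div_iff₀ (by positivity) (by positivity)]
    nlinarith
  set Q := av (fun z : Fin q → V => (∏ j, Y (z j)) * (if 1 ≤ θ + ∑ i, w (z i) then (1:ℝ) else 0)) with hQ
  set P := av (fun v : V => av (fun z : Fin q → V =>
    Z v * (∏ j, Y (z j)) * (if 1 ≤ w v + ∑ i, w (z i) then (1:ℝ) else 0))) with hP
  set X1 := av (fun x : Fin (q+1) → V => (∏ j, Y (x j)) * (if F x then (1:ℝ) else 0)) with hX1
  have hYpow : ∀ m : ℕ, av (fun z : Fin m → V => ∏ j, Y (z j)) = (av Y)^m := by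
    intro m
    rw [av_pi_prod (κ := Fin m) (Ω := fun _ => V) (fun _ => Y)]; simp
  -- main pointwise inequality
  have hmain : pr F ≤ 1 - (av Y)^(q+1) + X1 - (q+1) * (av Z * (av Y)^q) + (q+1) * P := by
    have hpt : ∀ x : Fin (q+1) → V, (if F x then (1:ℝ) else 0) ≤
        1 - ((∏ j, Y (x j)) - (∏ j, Y (x j)) * (if F x then (1:ℝ) else 0))
          - ∑ i, (Z (x i) * (∏ j, Y (x (i.succAbove j)))
            - Z (x i) * (∏ j, Y (x (i.succAbove j))) *
              (if 1 ≤ w (x i) + ∑ j, w (x (i.succAbove j)) then (1:ℝ) else 0)) := by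
      intro x
      have hFi : ∀ i, (if 1 ≤ w (x i) + ∑ j, w (x (i.succAbove j)) then (1:ℝ) else 0) =
          (if F x then (1:ℝ) else 0) := by
        intro i; rw [← sum_succAbove' q i w x]
      simp only [hFi]
      by_cases hx : F x
      · simp [hx]
      · simp only [hx, if_false, mul_zero, sub_zero]
        have : ∏ j, Y (x j) + ∑ i, (Z (x i) * (∏ j, Y (x (i.succAbove j)))) ≤ 1 := by
          by_cases hall : ∀ j, x j ∉ S
          · have : ∀ i, Z (x i) = 0 := fun i => by simp [hZ, hall i]
            simp only [this, zero_mul, Finset.sum_const_zero, add_zero]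
            exact hP1 _ _
          · push Not at hall
            obtain ⟨i0, hi0⟩ := hall
            have h1 : ∏ j, Y (x j) = 0 := Finset.prod_eq_zero (mem_univ i0) (by simp [hY, hi0])
            rw [h1, zero_add, Finset.sum_eq_single i0]
            · exact mul_le_one₀ (hZ1 _) (hP0 _ _) (hP1 q (fun j => x (i0.succAbove j)))
            · intro i _ hi
              obtain ⟨j, hj⟩ := Fin.exists_succAbove_eq (Ne.symm hi)
              rw [Finset.prod_eq_zero (mem_univ j) (by simp [hY, hj, hi0]), mul_zero]
            · simp
        linarith
    have h1 := av_mono hpt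
    rw [av_sub, av_sub, av_sub, av_const, hYpow, av_sum] at h1
    have h2 : ∀ i : Fin (q+1), av (fun x : Fin (q+1) → V => Z (x i) * (∏ j, Y (x (i.succAbove j)))
            - Z (x i) * (∏ j, Y (x (i.succAbove j))) *
              (if 1 ≤ w (x i) + ∑ j, w (x (i.succAbove j)) then (1:ℝ) else 0)) =
        av Z * (av Y)^q - P := by
      intro i
      rw [av_insertNth q i (fun v z => Z v * (∏ j, Y (z j))
            - Z v * (∏ j, Y (z j)) *
              (if 1 ≤ w v + ∑ j, w (z j) then (1:ℝ) else 0))]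
      simp only [av_sub]
      rw [hP]
      congr 1
      simp only [av_mul_left, hYpow, av_mul_right]
    rw [Finset.sum_congr rfl (fun i _ => h2 i)] at h1
    simp only [Finset.sum_const, Finset.card_univ, Fintype.card_fin, nsmul_eq_mul] at h1
    push_cast at h1
    have h3 : pr F = av (fun x => if F x then (1:ℝ) else 0) := rfl
    rw [h3]; linarith
  have hX1le : X1 ≤ (q+1) * (bY * Q) := by
    have hpt : ∀ x : Fin (q+1) → V, (∏ j, Y (x j)) * (if F x then (1:ℝ) else 0) ≤
        ∑ i, (Y (x i) * w (x i)) * ((∏ j, Y (x (i.succAbove j))) *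
          (if 1 ≤ θ + ∑ j, w (x (i.succAbove j)) then (1:ℝ) else 0)) := by
      intro x
      have hnn : ∀ i : Fin (q+1), 0 ≤ (Y (x i) * w (x i)) * ((∏ j, Y (x (i.succAbove j))) *
          (if 1 ≤ θ + ∑ j, w (x (i.succAbove j)) then (1:ℝ) else 0)) := by
        intro i
        refine mul_nonneg (mul_nonneg (hY0 _) (hw0 _)) (mul_nonneg (hP0 q (fun j => x (i.succAbove j))) ?_)
        split_ifs <;> norm_num
      by_cases hx : F x
      · by_cases hall : ∀ j, x j ∉ S
        · have h1 : ∀ j, Y (x j) = 1 := fun j => by simp [hY, hall j]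
          have h2 : ∀ i : Fin (q+1), (if 1 ≤ θ + ∑ j, w (x (i.succAbove j)) then (1:ℝ) else 0) = 1 := by
            intro i
            rw [if_pos]
            have h3 : 1 ≤ ∑ i, w (x i) := hx
            rw [sum_succAbove' q i w x] at h3
            have := hYθ (x i) (hall i)
            linarith
          simp only [h1, h2, hx, if_true, Finset.prod_const_one, one_mul, mul_one]
          exact hx
        · push Not at hall
          obtain ⟨i0, hi0⟩ := hall
          rw [Finset.prod_eq_zero (mem_univ i0) (by simp [hY, hi0]), zero_mul]
          exact Finset.sum_nonneg fun i _ => hnn i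
      · simp only [hx, if_false, mul_zero]
        exact Finset.sum_nonneg fun i _ => hnn i
    refine (av_mono hpt).trans ?_
    rw [av_sum]
    have h2 : ∀ i : Fin (q+1), av (fun x : Fin (q+1) → V => (Y (x i) * w (x i)) * ((∏ j, Y (x (i.succAbove j))) *
          (if 1 ≤ θ + ∑ j, w (x (i.succAbove j)) then (1:ℝ) else 0))) = bY * Q := by
      intro i
      rw [av_insertNth q i (fun v z => (Y v * w v) * ((∏ j, Y (z j)) *
          (if 1 ≤ θ + ∑ j, w (z j) then (1:ℝ) else 0)))]
      simp only [av_mul_left]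
      rw [← hQ, av_mul_right]
    rw [Finset.sum_congr rfl (fun i _ => h2 i)]
    simp
  have hsplit : (av Y)^(q+1) = av Y * (av Y * (av Y)^(q-1)) := by
    rw [← pow_succ', ← pow_succ']; congr 1; omega
  have hsplit' : (av Y)^q = av Y * (av Y)^(q-1) := by
    rw [← pow_succ']; congr 1; omega
  have hbpos : 0 < av Y := by
    rw [hb]
    have : 1 / (k:ℝ) ≤ 1/2 := by gcongr
    linarith
  have hmθ : 1 - k * bS ≤ 1 - θ := by
    have : θ * (1 / k) ≤ bS := by
      rw [← ha, ← av_mul_left, hbS]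
      apply av_mono
      intro v
      by_cases hv : v ∈ S
      · simp only [hZ, hv, if_true]; linarith [hSθ v hv]
      · simp [hZ, hv]
    have h2 : θ ≤ k * bS := by
      have hk0 : (0:ℝ) < k := by linarith
      calc θ = k * (θ * (1/k)) := by field_simp
        _ ≤ _ := by gcongr
    linarith
  have hbYm : bY ≤ (1 - k * bS) / k := by
    rw [sub_div, mul_div_cancel_left₀ _ (by positivity)]
    linarith
  rcases hθ1.lt_or_eq with hlt | heq
  · -- θ < 1
    have hτ : 0 < 1 - θ := by linarith
    have hQle : Q ≤ q * (bY * (av Y)^(q-1)) / (1 - θ) := by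
      rw [hbY, ← av_single_marginal, div_eq_mul_inv, ← av_mul_right]
      apply av_mono
      intro z
      rw [mul_assoc]
      apply mul_le_mul_of_nonneg_left _ (hP0 _ _)
      have h0 : 0 ≤ ∑ i, w (z i) := Finset.sum_nonneg fun i _ => hw0 _
      split_ifs with h
      · rw [← div_eq_mul_inv, le_div_iff₀ hτ]; linarith
      · positivity
    have hPle : P ≤ av Z * (av Y * (av Y)^(q-1)) * (1 - 1/(1-θ)) + bS * (av Y * (av Y)^(q-1)) / (1 - θ)
        + av Z * (q * (bY * (av Y)^(q-1))) / (1 - θ) := by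
      have hpt : ∀ v, ∀ z : Fin q → V, Z v * (∏ j, Y (z j)) * (if 1 ≤ w v + ∑ i, w (z i) then (1:ℝ) else 0)
        ≤ (Z v * (1 - 1/(1-θ)) + Z v * w v * (1/(1-θ))) * (∏ j, Y (z j))
          + (Z v * (1/(1-θ))) * ((∏ j, Y (z j)) * ∑ i, w (z i)) := by
        intro v z
        have h0 : 0 ≤ ∑ i, w (z i) := Finset.sum_nonneg fun i _ => hw0 _
        have hrw : (Z v * (1 - 1/(1-θ)) + Z v * w v * (1/(1-θ))) * (∏ j, Y (z j))
          + (Z v * (1/(1-θ))) * ((∏ j, Y (z j)) * ∑ i, w (z i)) =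
          Z v * (∏ j, Y (z j)) * (1 - (1 - w v - ∑ i, w (z i)) / (1-θ)) := by
          field_simp; ring
        rw [hrw]
        by_cases hv : v ∈ S
        · apply mul_le_mul_of_nonneg_left _ (mul_nonneg (hZ0 _) (hP0 _ _))
          split_ifs with h
          · have : (1 - w v - ∑ i, w (z i)) / (1-θ) ≤ 0 := div_nonpos_of_nonpos_of_nonneg (by linarith) hτ.le
            linarith
          · have : (1 - w v - ∑ i, w (z i)) / (1-θ) ≤ 1 := by
              rw [div_le_one hτ]; linarith [hSθ v hv]
            linarith
        · simp [hZ, hv]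
      have h1 : P ≤ _ := av_mono (fun v => av_mono (hpt v))
      refine h1.trans (le_of_eq ?_)
      simp only [av_add, av_mul_left, hYpow, av_single_marginal, av_mul_right]
      rw [hsplit', ← hbS, ← hbY]
      ring
    have := weight_algebra k q (av Z) (av Y) (1 - k * bS) (1 - θ) bS bY X1 ((q+1) * P) Q P ((av Y)^(q-1))
      hkR hqR hkqR ha hb rfl hbY0 hbYm hτ (by linarith) hmθ (pow_pos hbpos _) hX1le hQle hPle rfl
    rw [← hb, hsplit]
    rw [hsplit, hsplit'] at hmain
    exact hmain.trans this
  · -- θ = 1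
    have hbY00 : bY = 0 := by
      have hk0 : (0:ℝ) < k := by linarith
      have : (1 - k * bS) / k ≤ 0 := div_nonpos_of_nonpos_of_nonneg (by linarith) hk0.le
      linarith
    have hX10 : X1 ≤ 0 := by simpa [hbY00] using hX1le
    have hPle : P ≤ av Z * (av Y)^q := by
      have : av Z * (av Y)^q = av (fun v => av (fun z : Fin q → V => Z v * (∏ j, Y (z j)))) := by
        simp only [av_mul_left, hYpow, av_mul_right]
      rw [this]
      refine av_mono fun v => av_mono fun z => ?_
      refine mul_le_of_le_one_right (mul_nonneg (hZ0 _) (hP0 _ _)) ?_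
      split_ifs <;> norm_num
    rw [← hb]
    have h1 : 0 ≤ ((q:ℝ) + 1) * (2 * q + 1 - k) / ((k:ℝ) - 1)^2 := by
      have : 0 ≤ 2 * (q:ℝ) + 1 - k := by linarith
      positivity
    have h2 := mul_nonneg h1 (pow_nonneg hbpos.le (q+1))
    have h3 : (q + 1) * P ≤ ((q:ℝ)+1) * (av Z * (av Y)^q) := by gcongr
    linarith

/-- the constant `g` -/
noncomputable def gc (k r : ℝ) (rn : ℕ) : ℝ :=
  1 - (1 - r * (2 * r - 1 - k) / (k - 1)^2) * (1 - 1/k)^rn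

lemma weight_ineq {V : Type*} [Fintype V] [DecidableEq V] (w : V → ℝ) (hw0 : ∀ v, 0 ≤ w v)
    (r k s : ℕ) (hk : 2 ≤ k) (hr : 2 ≤ r) (hkr : k + 1 ≤ 2 * r)
    (hs : 1 ≤ s) (hV : Fintype.card V = k * s) (hsum : ∑ v, w v ≤ s) :
    pr (fun x : Fin r → V => 1 ≤ ∑ i, w (x i)) ≤ gc k r r := by
  obtain ⟨q, rfl⟩ : ∃ q, r = q + 1 := ⟨r - 1, by omega⟩
  have h := weight_core (fun v => min (w v) 1) (fun v => le_min (hw0 v) zero_le_one)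
    (fun v => min_le_right _ _) q k s hk (by omega) (by omega) hs hV
    ((Finset.sum_le_sum fun v _ => min_le_left _ _).trans hsum)
  refine le_trans (pr_mono ?_) (h.trans (le_of_eq ?_))
  · intro x hx
    by_cases hall : ∀ i, w (x i) ≤ 1
    · simpa [min_eq_left (hall _)] using hx
    · push Not at hall
      obtain ⟨i, hi⟩ := hall
      calc (1:ℝ) = min (w (x i)) 1 := by rw [min_eq_right hi.le]
        _ ≤ _ := Finset.single_le_sum (f := fun i => min (w (x i)) 1)
          (fun i _ => le_min (hw0 _) zero_le_one) (mem_univ i)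
  · unfold gc; push_cast; ring_nf

end PMH


namespace PMH
open Finset
open scoped Classical

lemma lp_dual {I E : Type*} [Fintype I] [Fintype E] (A : E → I → ℝ) (s : ℝ) (hs : 0 < s) :
    (∃ x : E → ℝ, (∀ e, 0 ≤ x e) ∧ (∀ i, ∑ e, x e * A e i ≤ 1) ∧ ∑ e, x e = s) ∨
    (∃ w : I → ℝ, (∀ i, 0 ≤ w i) ∧ ∑ i, w i ≤ s ∧ ∀ e, 1 ≤ ∑ i, w i * A e i) := by
  by_contra hcon
  push Not at hcon
  obtain ⟨h1, h2⟩ := hcon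
  let L : (E → ℝ) →ₗ[ℝ] (I → ℝ) :=
    { toFun := fun x i => s * ∑ e, x e * A e i
      map_add' := by intro x y; ext i; simp [add_mul, Finset.sum_add_distrib, mul_add]
      map_smul' := by
        intro c x; ext i
        simp only [Pi.smul_apply, smul_eq_mul, RingHom.id_apply, Finset.mul_sum]
        refine Finset.sum_congr rfl fun e _ => ?_
        ring }
  let K : Set (I → ℝ) := L '' (stdSimplex ℝ E)
  let C : Set (I → ℝ) := Set.Iic (fun _ => (1:ℝ))
  have hKc : IsCompact K := (isCompact_stdSimplex ℝ E).image (LinearMap.continuous_of_finiteDimensional L)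
  have hKconv : Convex ℝ K := (convex_stdSimplex ℝ E).linear_image L
  have hCconv : Convex ℝ C := convex_Iic _
  have hCcl : IsClosed C := isClosed_Iic
  have hdisj : Disjoint C K := by
    rw [Set.disjoint_left]
    rintro y hyC ⟨x, hx, rfl⟩
    refine h1 (fun e => s * x e) (fun e => mul_nonneg hs.le (hx.1 e)) (fun i => ?_) ?_
    · have := hyC i
      simp only [L, LinearMap.coe_mk, AddHom.coe_mk] at this
      rw [Finset.mul_sum] at this
      simpa [mul_assoc] using this
    · rw [← Finset.mul_sum, hx.2, mul_one]
  obtain ⟨f, u, v, hfC, huv, hfK⟩ := geometric_hahn_banach_closed_compact hCconv hCcl hKconv hKc hdisj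
  let c : I → ℝ := fun i => f (Pi.single i 1)
  have hf : ∀ y : I → ℝ, f y = ∑ i, y i * c i := by
    intro y
    conv_lhs => rw [← Finset.univ_sum_single y]
    rw [map_sum]
    refine Finset.sum_congr rfl fun i _ => ?_
    have : (Pi.single i (y i) : I → ℝ) = y i • Pi.single i 1 := by
      rw [← Pi.single_smul]; simp
    rw [this, map_smul, smul_eq_mul]
  have hc0 : ∀ i, 0 ≤ c i := by
    intro i
    by_contra hneg
    push Not at hneg
    have h3 := hfC (Pi.single i (-(|u| / (-c i)))) (by
      intro j
      by_cases hj : j = i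
      · subst hj; simp only [Pi.single_eq_same]
        have : 0 ≤ |u| / (-c j) := by apply div_nonneg (abs_nonneg _); linarith
        linarith
      · simp [Pi.single_eq_of_ne hj])
    have : (Pi.single i (-(|u| / (-c i))) : I → ℝ) = (-(|u| / (-c i))) • Pi.single i 1 := by
      rw [← Pi.single_smul]; simp
    rw [this, map_smul, smul_eq_mul] at h3
    have h4 : -(|u| / (-c i)) * c i = |u| := by field_simp [hneg.ne]
    have : -(|u| / (-c i)) * f (Pi.single i 1) = |u| := h4
    rw [this] at h3
    exact absurd h3 (not_lt.2 (le_abs_self u))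
  have hC1 : ∑ i, c i < u := by
    have := hfC (fun _ => 1) (fun _ => le_rfl)
    rw [hf] at this; simpa using this
  have hE : ∀ e, v < s * ∑ i, A e i * c i := by
    intro e
    have := hfK (L (Pi.single e 1)) ⟨_, single_mem_stdSimplex ℝ e, rfl⟩
    rw [hf] at this
    refine this.trans_le (le_of_eq ?_)
    rw [Finset.mul_sum]
    refine Finset.sum_congr rfl fun i _ => ?_
    simp only [L, LinearMap.coe_mk, AddHom.coe_mk]
    rw [Finset.sum_eq_single e]
    · simp; ring
    · intro b _ hb; simp [Pi.single_eq_of_ne hb]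
    · simp
  rcases isEmpty_or_nonempty E with hemp | ⟨⟨e0⟩⟩
  · obtain ⟨e, _⟩ := h2 (fun _ => 0) (fun _ => le_refl _) (by simpa using hs.le)
    exact hemp.elim e
  have hSpos : 0 < ∑ i, c i := by
    refine lt_of_le_of_ne (Finset.sum_nonneg fun i _ => hc0 i) ?_
    intro h0
    have hz : ∀ i, c i = 0 := fun i =>
      (Finset.sum_eq_zero_iff_of_nonneg (fun i _ => hc0 i)).1 h0.symm i (mem_univ i)
    have h5 := hE e0
    simp only [hz, mul_zero, Finset.sum_const_zero] at h5
    rw [← h0] at hC1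
    linarith
  obtain ⟨e, he⟩ := h2 (fun i => c i * (s / ∑ i, c i)) (fun i => mul_nonneg (hc0 i) (by positivity))
    (by rw [← Finset.sum_mul]; field_simp; exact le_refl _)
  have h6 : ∑ i, c i * (s / ∑ i, c i) * A e i = (s * ∑ i, A e i * c i) / ∑ i, c i := by
    rw [Finset.mul_sum, Finset.sum_div]
    refine Finset.sum_congr rfl fun i _ => ?_
    ring
  rw [h6, div_lt_one hSpos] at he
  linarith [hE e]

/-- `load y z i`: number of times the vertex `i` occurs in the two tuples -/
noncomputable def load {I : Type*} {d r : ℕ} (e : (Fin d → I) × (Fin r → I)) (i : I) : ℝ :=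
  (∑ j, if e.1 j = i then (1:ℝ) else 0) + ∑ j, if e.2 j = i then (1:ℝ) else 0

lemma sum_load {I : Type*} [Fintype I] {d r : ℕ} (e : (Fin d → I) × (Fin r → I)) (w : I → ℝ) :
    ∑ i, w i * load e i = (∑ j, w (e.1 j)) + ∑ j, w (e.2 j) := by
  unfold load
  simp only [mul_add, Finset.sum_add_distrib, Finset.mul_sum]
  rw [Finset.sum_comm]
  congr 1
  · simp
  · rw [Finset.sum_comm]; simp

lemma cover_reduce {I : Type*} [Fintype I] [DecidableEq I] [Nonempty I] (k d r m : ℕ) (hk : 2 ≤ k) (hr : 2 ≤ r) (hd : 1 ≤ d)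
    (hkdr : d + r = k) (hkr : k + 1 ≤ 2 * r) (hI : Fintype.card I = k * m) (η : ℝ) (hη : 0 < η) (hη1 : η ≤ 1)
    (hm : 4 ≤ η * m) (F : (Fin d → I) → (Fin r → I) → Prop)
    (hbad : pr (fun y => pr (F y) ≤ gc k r r) < (η / (4 * k))^d)
    (w : I → ℝ) (hw0 : ∀ i, 0 ≤ w i) (hws : ∑ i, w i ≤ (1 - η) * m)
    (hcov : ∀ y z, F y z → 1 ≤ (∑ j, w (y j)) + ∑ j, w (z j)) : False := by
  have hm1 : (0:ℝ) < m := by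
    rcases Nat.eq_zero_or_pos m with h | h
    · subst h; simp at hm; linarith
    · exact_mod_cast h
  have hm1' : 1 ≤ m := by exact_mod_cast hm1
  set l : ℕ := ⌊η * m / 2⌋₊ with hl
  have hl1 : (l:ℝ) ≤ η * m / 2 := Nat.floor_le (by linarith)
  have hl2 : η * m / 4 ≤ l := by
    have := Nat.lt_floor_add_one (η * m / 2)
    rw [← hl] at this; linarith
  have hlm : l ≤ m := by
    have : (l:ℝ) ≤ m := by nlinarith
    exact_mod_cast this
  have hl0 : 1 ≤ l := by
    have : (0:ℝ) < l := by linarith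
    exact_mod_cast this
  have hkR : (2:ℝ) ≤ k := by exact_mod_cast hk
  obtain ⟨L, θ, hLc, hLθ, hLθ', hLx⟩ := exists_top_set (fun i => - w i) l hl0
    (by rw [hI]; nlinarith)
  -- pick a good T in L^d
  obtain ⟨T, hTL, hTgood⟩ : ∃ T : Fin d → I, (∀ i, T i ∈ L) ∧ gc k r r < pr (F T) := by
    by_contra hno
    push Not at hno
    have h1 : pr (fun T : Fin d → I => ∀ i, T i ∈ L) ≤ pr (fun y => pr (F y) ≤ gc k r r) :=
      pr_mono fun T hT => hno T hT
    have h2 : pr (fun T : Fin d → I => ∀ i, T i ∈ L) = ((l:ℝ) / (k * m))^d := by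
      refine (pr_pi (Ω := fun _ : Fin d => I) (fun _ v => v ∈ L)).trans ?_
      simp only [Finset.prod_const, Finset.card_univ, Fintype.card_fin]
      rw [pr_eq]; simp [hLc, hI]
    have h3 : (η / (4 * k))^d ≤ ((l:ℝ) / (k * m))^d := by
      refine pow_le_pow_left₀ (by positivity) ?_ d
      rw [div_le_div_iff₀ (by positivity) (by positivity)]
      nlinarith
    linarith
  set t0 : ℝ := (∑ i, w (T i)) / d with ht0
  have hdR : (1:ℝ) ≤ d := by exact_mod_cast hd
  have hdt : (d:ℝ) * t0 = ∑ i, w (T i) := by rw [ht0]; field_simp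
  have ht00 : 0 ≤ t0 := by
    rw [ht0]; exact div_nonneg (Finset.sum_nonneg fun i _ => hw0 _) (by positivity)
  have ht0θ : t0 ≤ -θ := by
    rw [ht0, div_le_iff₀ (by positivity)]
    calc ∑ i, w (T i) ≤ ∑ _i : Fin d, -θ := Finset.sum_le_sum fun i _ => by
          have := hLθ _ (hTL i); linarith
      _ = _ := by simp; ring
  have hcardc : ((Lᶜ).card : ℝ) = k * m - l := by
    rw [Finset.card_compl, hI, hLc, Nat.cast_sub (by nlinarith)]; push_cast; ring
  have hθ1 : -θ ≤ 1 := by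
    have h1 : ((Lᶜ).card : ℝ) * (-θ) ≤ ∑ i, w i := by
      calc ((Lᶜ).card : ℝ) * (-θ) = ∑ _i ∈ Lᶜ, (-θ) := by simp
        _ ≤ ∑ i ∈ Lᶜ, w i := Finset.sum_le_sum fun i hi => by
            have := hLθ' i (by simpa using hi); linarith
        _ ≤ _ := Finset.sum_le_sum_of_subset_of_nonneg (subset_univ _) fun i _ _ => hw0 i
    rw [hcardc] at h1
    have hlmR : (l:ℝ) ≤ m := by exact_mod_cast hlm
    by_contra hc
    push Not at hc
    have : (m:ℝ) ≤ k * m - l := by nlinarith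
    nlinarith
  have htot : ∑ i, max (w i) t0 < m := by
    have h1 : ∀ i, max (w i) t0 ≤ w i + if i ∈ L then t0 else 0 := by
      intro i
      by_cases hi : i ∈ L
      · simp only [hi, if_true]; exact max_le (by linarith) (by linarith [hw0 i])
      · simp only [hi, if_false, add_zero]
        have := hLθ' i hi
        exact max_le le_rfl (by linarith)
    calc ∑ i, max (w i) t0 ≤ ∑ i, (w i + if i ∈ L then t0 else 0) := Finset.sum_le_sum fun i _ => h1 i
      _ = (∑ i, w i) + l * t0 := by rw [Finset.sum_add_distrib]; simp [hLc]
      _ < m := by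
        have : (l:ℝ) * t0 ≤ l * 1 := by gcongr; linarith
        nlinarith
  have hkt : k * t0 < 1 := by
    have : (k * m : ℝ) * t0 ≤ ∑ i, max (w i) t0 := by
      calc (k * m : ℝ) * t0 = ∑ _i : I, t0 := by simp [hI]
        _ ≤ _ := Finset.sum_le_sum fun i _ => le_max_right _ _
    by_contra hc
    push Not at hc
    nlinarith
  have hpos : 0 < 1 - k * t0 := by linarith
  have hwi := weight_ineq (fun i => (max (w i) t0 - t0) / (1 - k * t0))
    (fun i => div_nonneg (by linarith [le_max_right (w i) t0]) hpos.le) r k m hk hr hkr hm1' hI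
    (by
      rw [← Finset.sum_div, div_le_iff₀ hpos, Finset.sum_sub_distrib]
      simp [hI]; nlinarith)
  have : pr (F T) ≤ gc k r r := by
    refine le_trans (pr_mono ?_) hwi
    intro z hz
    have h1 := hcov T z hz
    rw [← Finset.sum_div, le_div_iff₀ hpos, Finset.sum_sub_distrib]
    have h2 : ∑ j, w (z j) ≤ ∑ j, max (w (z j)) t0 := Finset.sum_le_sum fun i _ => le_max_left _ _
    have h3 : (k:ℝ) = d + r := by rw [← hkdr]; push_cast; ring
    simp
    rw [h3]
    nlinarith
  linarith

lemma sum_dite_subtype {E : Type*} [Fintype E] (P : E → Prop) (f : {e // P e} → ℝ) (c : E → ℝ) :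
    ∑ e, (if h : P e then f ⟨e, h⟩ else 0) * c e = ∑ e : {e // P e}, f e * c e := by
  refine (Fintype.sum_of_injective Subtype.val Subtype.val_injective _ _ ?_ ?_).symm
  · intro e he
    have : ¬ P e := fun h => he ⟨⟨e, h⟩, rfl⟩
    simp [this]
  · rintro ⟨e, h⟩; simp [h]

lemma frac_matching {I : Type*} [Fintype I] [DecidableEq I] [Nonempty I] (k d r m : ℕ) (hk : 2 ≤ k) (hr : 2 ≤ r) (hd : 1 ≤ d)
    (hkdr : d + r = k) (hkr : k + 1 ≤ 2 * r) (hI : Fintype.card I = k * m) (η : ℝ) (hη : 0 < η) (hη1 : η < 1)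
    (hm : 4 ≤ η * m) (F : (Fin d → I) → (Fin r → I) → Prop)
    (hbad : pr (fun y => pr (F y) ≤ gc k r r) < (η / (4 * k))^d) :
    ∃ x : ((Fin d → I) × (Fin r → I)) → ℝ, (∀ e, 0 ≤ x e) ∧ (∀ e, ¬ F e.1 e.2 → x e = 0) ∧
      (∀ i, ∑ e, x e * load e i ≤ 1) ∧ ∑ e, x e = (1 - η) * m := by
  have hm0 : (0:ℝ) < m := by
    rcases Nat.eq_zero_or_pos m with h | h
    · subst h; simp at hm; linarith
    · exact_mod_cast h
  rcases lp_dual (E := {e : (Fin d → I) × (Fin r → I) // F e.1 e.2}) (fun e i => load e.1 i) ((1 - η) * m)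
    (mul_pos (by linarith) hm0) with ⟨x, hx0, hxl, hxs⟩ | ⟨w, hw0, hws, hcov⟩
  · refine ⟨fun e => if h : F e.1 e.2 then x ⟨e, h⟩ else 0, ?_, ?_, ?_, ?_⟩
    · intro e; dsimp only; split_ifs with h
      · exact hx0 _
      · exact le_rfl
    · intro e h; simp [h]
    · intro i
      refine le_trans (le_of_eq ?_) (hxl i)
      exact sum_dite_subtype _ x (fun e => load e i)
    · have := sum_dite_subtype (fun e : (Fin d → I) × (Fin r → I) => F e.1 e.2) x (fun _ => 1)
      simp only [mul_one] at this
      rw [← hxs, ← this]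
  · exfalso
    refine cover_reduce k d r m hk hr hd hkdr hkr hI η hη hη1.le hm F hbad w hw0 hws ?_
    intro y z h
    have := hcov ⟨(y, z), h⟩
    rwa [sum_load] at this

end PMH


namespace PMH
open Finset
open scoped Classical

lemma av_ite {Ω : Type*} [Fintype Ω] (P : Ω → Prop) [h : DecidablePred P] :
    av (fun ω => if P ω then (1:ℝ) else 0) = pr P := by
  unfold pr; congr 1; ext ω; by_cases h : P ω <;> simp [h]

lemma pr_sumElim {D R U : Type*} [Fintype D] [Fintype R] [DecidableEq D] [DecidableEq R] [Fintype U]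
    (F : (D ⊕ R → U) → Prop) :
    av (fun a : D → U => pr (fun b : R → U => F (Sum.elim a b))) = pr F := by
  unfold pr
  rw [← av_prod (fun x : (D → U) × (R → U) => if F (Sum.elim x.1 x.2) then (1:ℝ) else 0)]
  refine Eq.trans ?_ (av_equiv (Equiv.sumArrowEquivProdArrow D R U).symm _)
  rfl

lemma av_sumElim {D R U : Type*} [Fintype D] [Fintype R] [DecidableEq D] [DecidableEq R] [Fintype U]
    (F : (D ⊕ R → U) → ℝ) :
    av (fun a : D → U => av (fun b : R → U => F (Sum.elim a b))) = av F := by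
  rw [← av_prod (fun x : (D → U) × (R → U) => F (Sum.elim x.1 x.2))]
  refine Eq.trans ?_ (av_equiv (Equiv.sumArrowEquivProdArrow D R U).symm F)
  rfl

lemma av_arrowProd {D U K : Type*} [Fintype D] [DecidableEq D] [Fintype U] [Fintype K]
    (F : (D → U × K) → ℝ) :
    av F = av (fun a : D → U => av (fun p : D → K => F (fun i => (a i, p i)))) := by
  rw [← av_prod (fun x : (D → U) × (D → K) => F (fun i => (x.1 i, x.2 i)))]
  exact (av_equiv (Equiv.arrowProdEquivProdArrow D (fun _ => U) (fun _ => K)).symm F).symm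

lemma av_abs_le {Ω : Type*} [Fintype Ω] [Nonempty Ω] (f : Ω → ℝ) (c : ℝ) (h : ∀ ω, f ω ≤ c) : av f ≤ c := by
  have := av_mono (g := fun _ => c) h
  rwa [av_const] at this

lemma le_av_of {Ω : Type*} [Fintype Ω] [Nonempty Ω] (f : Ω → ℝ) (c : ℝ) (h : ∀ ω, c ≤ f ω) : c ≤ av f := by
  have := av_mono (f := fun _ => c) h
  rwa [av_const] at this

section sampling
variable {D R B K : Type} [Fintype D] [Fintype R] [DecidableEq D] [DecidableEq R]
  [Fintype B] [Nonempty B] [Fintype K] [Nonempty K]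

lemma sampling_cov (q : (D → B) → (D → K) → (R → B) → (R → K) → Prop) {m : ℕ}
    (f : (D → B) → (D → K) → ℝ) (hf : ∀ β p, f β p = av (fun β' => pr (q β p β')))
    (a : D → Fin m) (b b' : R → Fin m) (hinj : Function.Injective (Sum.elim a (Sum.elim b b'))) :
    av (fun ω : Fin m → B => av (fun p : D → K =>
      (pr (q (fun i => ω (a i)) p (fun i => ω (b i))) - f (fun i => ω (a i)) p) *
      (pr (q (fun i => ω (a i)) p (fun i => ω (b' i))) - f (fun i => ω (a i)) p))) = 0 := by
  have h := av_comp_inj (V := B) _ hinj (fun x : D ⊕ (R ⊕ R) → B => av (fun p : D → K =>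
      (pr (q (fun i => x (Sum.inl i)) p (fun i => x (Sum.inr (Sum.inl i)))) - f (fun i => x (Sum.inl i)) p) *
      (pr (q (fun i => x (Sum.inl i)) p (fun i => x (Sum.inr (Sum.inr i)))) - f (fun i => x (Sum.inl i)) p)))
  simp only [Sum.elim_inl, Sum.elim_inr] at h
  rw [h, ← av_sumElim]
  have : ∀ β : D → B, av (fun x : R ⊕ R → B => av (fun p : D → K =>
      (pr (q β p (fun i => x (Sum.inl i))) - f β p) *
      (pr (q β p (fun i => x (Sum.inr i))) - f β p))) = 0 := by
    intro β
    rw [av_comm, ← av_const (Ω := D → K) 0]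
    congr 1; ext p
    rw [← av_sumElim]
    simp only [Sum.elim_inl, Sum.elim_inr, av_mul_left, av_mul_right, av_sub, av_const, ← hf, sub_self, mul_zero]
  simp only [Sum.elim_inl, Sum.elim_inr]
  simp only [this, av_const]

lemma sampling (Q : (D → B × K) → (R → B × K) → Prop) {m : ℕ} [Nonempty (Fin m)] (g ε γ : ℝ) (hε : 0 < ε)
    (hQ : pr (fun y => pr (Q y) < g + ε) ≤ γ) :
    av (fun ω : Fin m → B => pr (fun y : D → Fin m × K => pr (fun z : R → Fin m × K =>
      Function.Injective (Sum.elim (fun i => (y i).1) (fun i => (z i).1)) ∧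
      Q (fun i => (ω (y i).1, (y i).2)) (fun i => (ω (z i).1, (z i).2))) ≤ g)) ≤
    γ + ((Fintype.card D : ℝ) + 2 * Fintype.card R)^2 * (1 + 4 / ε^2 + 2 / ε) / m := by
  set C : ℝ := ((Fintype.card D : ℝ) + 2 * Fintype.card R)^2 with hC
  have hm0 : (0:ℝ) < m := by
    obtain ⟨x⟩ := (inferInstance : Nonempty (Fin m))
    exact_mod_cast lt_of_le_of_lt (Nat.zero_le _) x.2
  let q : (D → B) → (D → K) → (R → B) → (R → K) → Prop :=
    fun β p β' p' => Q (fun i => (β i, p i)) (fun i => (β' i, p' i))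
  let f : (D → B) → (D → K) → ℝ := fun β p => pr (Q (fun i => (β i, p i)))
  have hf : ∀ β p, f β p = av (fun β' => pr (q β p β')) := by
    intro β p
    exact av_arrowProd _
  let Gd : (Fin m → B) → (D → Fin m) → (D → K) → (R → Fin m) → ℝ := fun ω a p b =>
    pr (q (fun i => ω (a i)) p (fun i => ω (b i))) - f (fun i => ω (a i)) p
  have hGd : ∀ ω a p b, |Gd ω a p b| ≤ 1 := by
    intro ω a p b
    rw [abs_le]
    have h1 := pr_nonneg (q (fun i => ω (a i)) p (fun i => ω (b i)))
    have h2 := pr_le_one (q (fun i => ω (a i)) p (fun i => ω (b i)))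
    have h3 : 0 ≤ f (fun i => ω (a i)) p := pr_nonneg _
    have h4 : f (fun i => ω (a i)) p ≤ 1 := pr_le_one _
    simp only [Gd]
    constructor <;> linarith
  -- term 1
  have T1 : av (fun ω : Fin m → B => av (fun a : D → Fin m => pr (fun p : D → K => f (fun i => ω (a i)) p < g + ε)))
      ≤ γ + C / m := by
    rw [av_comm]
    have h1 : ∀ a : D → Fin m, av (fun ω : Fin m → B => pr (fun p : D → K => f (fun i => ω (a i)) p < g + ε)) ≤
        γ + if ¬ Function.Injective a then 1 else 0 := by
      intro a
      by_cases ha : Function.Injective a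
      · have := av_comp_inj (V := B) a ha (fun x : D → B => pr (fun p : D → K => f x p < g + ε))
        rw [this]
        simp only [ha, not_true, if_false, add_zero]
        refine le_trans (le_of_eq ?_) hQ
        exact (av_arrowProd (fun y => if pr (Q y) < g + ε then (1:ℝ) else 0)).symm
      · simp only [ha, not_false_eq_true, if_true]
        have h0 : 0 ≤ γ := (pr_nonneg _).trans hQ
        refine (av_abs_le _ 1 fun ω => pr_le_one _).trans (by linarith)
    refine (av_mono h1).trans ?_
    rw [av_add, av_const]
    gcongr
    rw [av_ite]
    refine (pr_not_inj_le (κ := D) (V := Fin m)).trans ?_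
    rw [Fintype.card_fin, hC]
    gcongr
    have : (0:ℝ) ≤ Fintype.card R := by positivity
    linarith
  -- term 2
  have T2 : av (fun ω : Fin m → B => av (fun a : D → Fin m => pr (fun p : D → K =>
      (ε/2)^2 ≤ (av (fun b : R → Fin m => Gd ω a p b))^2))) ≤ (C / m) / (ε/2)^2 := by
    have h1 : av (fun ω : Fin m → B => av (fun a : D → Fin m => av (fun p : D → K =>
      (av (fun b : R → Fin m => Gd ω a p b))^2))) ≤ C / m := by
      have hsq : ∀ ω a p, (av (fun b : R → Fin m => Gd ω a p b))^2 =
          av (fun b => av (fun b' => Gd ω a p b * Gd ω a p b')) := by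
        intro ω a p
        simp only [av_mul_left, av_mul_right, sq]
      simp only [hsq]
      have hswap : av (fun ω : Fin m → B => av (fun a : D → Fin m => av (fun p : D → K =>
          av (fun b : R → Fin m => av (fun b' : R → Fin m => Gd ω a p b * Gd ω a p b'))))) =
          av (fun a : D → Fin m => av (fun b : R → Fin m => av (fun b' : R → Fin m =>
            av (fun ω : Fin m → B => av (fun p : D → K => Gd ω a p b * Gd ω a p b'))))) := by
        rw [av_comm]
        congr 1; ext a
        have e1 : ∀ ω, av (fun p : D → K =>
          av (fun b : R → Fin m => av (fun b' : R → Fin m => Gd ω a p b * Gd ω a p b'))) =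
          av (fun b : R → Fin m => av (fun b' : R → Fin m => av (fun p : D → K => Gd ω a p b * Gd ω a p b'))) := by
          intro ω
          rw [av_comm]; congr 1; ext b; rw [av_comm]
        simp only [e1]
        rw [av_comm]; congr 1; ext b; rw [av_comm]
      rw [hswap]
      have hb : ∀ (a : D → Fin m) (b b' : R → Fin m),
          av (fun ω : Fin m → B => av (fun p : D → K => Gd ω a p b * Gd ω a p b')) ≤
          if ¬ Function.Injective (Sum.elim a (Sum.elim b b')) then 1 else 0 := by
        intro a b b'
        by_cases hi : Function.Injective (Sum.elim a (Sum.elim b b'))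
        · simp only [hi, not_true, if_false]
          exact (sampling_cov q f hf a b b' hi).le
        · simp only [hi, not_false_eq_true, if_true]
          refine av_abs_le _ _ fun ω => av_abs_le _ _ fun p => ?_
          have := mul_le_one₀ (hGd ω a p b) (abs_nonneg _) (hGd ω a p b')
          rw [← abs_mul] at this
          exact (le_abs_self _).trans this
      refine (av_mono fun a => av_mono fun b => av_mono fun b' => hb a b b').trans ?_
      have e2 : ∀ a : D → Fin m, av (fun b : R → Fin m => av (fun b' : R → Fin m =>
          if ¬ Function.Injective (Sum.elim a (Sum.elim b b')) then (1:ℝ) else 0)) =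
          av (fun c : R ⊕ R → Fin m => if ¬ Function.Injective (Sum.elim a c) then (1:ℝ) else 0) := fun a =>
        av_sumElim (fun c : R ⊕ R → Fin m => if ¬ Function.Injective (Sum.elim a c) then (1:ℝ) else 0)
      simp only [e2]
      rw [av_sumElim (fun x : D ⊕ (R ⊕ R) → Fin m => if ¬ Function.Injective x then (1:ℝ) else 0)]
      rw [av_ite]
      refine (pr_not_inj_le (κ := D ⊕ (R ⊕ R)) (V := Fin m)).trans (le_of_eq ?_)
      rw [hC]; simp; ring
    have h2 : ∀ ω a, pr (fun p : D → K => (ε/2)^2 ≤ (av (fun b : R → Fin m => Gd ω a p b))^2) ≤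
        av (fun p : D → K => (av (fun b : R → Fin m => Gd ω a p b))^2) * (1 / (ε/2)^2) := by
      intro ω a
      rw [mul_one_div]
      exact pr_markov (fun p => sq_nonneg _) (by positivity)
    refine (av_mono fun ω => av_mono fun a => h2 ω a).trans ?_
    simp only [av_mul_right]
    rw [mul_one_div]
    gcongr
  -- term 3
  have T3 : pr (fun a : D → Fin m => ε/2 ≤ pr (fun b : R → Fin m => ¬ Function.Injective (Sum.elim a b))) ≤
      (C / m) / (ε/2) := by
    refine (pr_markov (fun a => pr_nonneg _) (by positivity)).trans ?_
    gcongr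
    refine le_trans (le_of_eq (pr_sumElim (fun x : D ⊕ R → Fin m => ¬ Function.Injective x))) ?_
    refine (pr_not_inj_le (κ := D ⊕ R) (V := Fin m)).trans ?_
    rw [hC, Fintype.card_fin]; push_cast [Fintype.card_sum]
    gcongr
    have : (0:ℝ) ≤ Fintype.card R := by positivity
    linarith
  have hmain : ∀ (ω : Fin m → B) (a : D → Fin m) (p : D → K),
      (if pr (fun z : R → Fin m × K =>
      Function.Injective (Sum.elim a (fun i => (z i).1)) ∧
      Q (fun i => (ω (a i), p i)) (fun i => (ω (z i).1, (z i).2))) ≤ g then (1:ℝ) else 0) ≤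
      (if f (fun i => ω (a i)) p < g + ε then (1:ℝ) else 0) +
      ((if (ε/2)^2 ≤ (av (fun b : R → Fin m => Gd ω a p b))^2 then (1:ℝ) else 0) +
      (if ε/2 ≤ pr (fun b : R → Fin m => ¬ Function.Injective (Sum.elim a b)) then (1:ℝ) else 0)) := by
    intro ω a p
    have hnn : ∀ (P : Prop), (0:ℝ) ≤ if P then (1:ℝ) else 0 := fun P => by split_ifs <;> norm_num
    by_cases c1 : f (fun i => ω (a i)) p < g + ε
    · simp only [c1, if_true]
      have := hnn ((ε/2)^2 ≤ (av (fun b : R → Fin m => Gd ω a p b))^2)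
      have := hnn (ε/2 ≤ pr (fun b : R → Fin m => ¬ Function.Injective (Sum.elim a b)))
      split_ifs <;> linarith
    by_cases c2 : (ε/2)^2 ≤ (av (fun b : R → Fin m => Gd ω a p b))^2
    · simp only [c2, c1, if_true, if_false]
      have := hnn (ε/2 ≤ pr (fun b : R → Fin m => ¬ Function.Injective (Sum.elim a b)))
      split_ifs <;> linarith
    by_cases c3 : ε/2 ≤ pr (fun b : R → Fin m => ¬ Function.Injective (Sum.elim a b))
    · simp only [c3, c2, c1, if_true, if_false]
      split_ifs <;> linarith
    simp only [c3, c2, c1, if_false, add_zero]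
    rw [if_neg]
    push Not at c1 c2 c3 ⊢
    have hx : pr (fun z : R → Fin m × K =>
      Function.Injective (Sum.elim a (fun i => (z i).1)) ∧
      Q (fun i => (ω (a i), p i)) (fun i => (ω (z i).1, (z i).2))) =
      av (fun b : R → Fin m => av (fun p' : R → K => if Function.Injective (Sum.elim a b) ∧
        q (fun i => ω (a i)) p (fun i => ω (b i)) p' then (1:ℝ) else 0)) := by
      simp only [av_ite]; exact av_arrowProd _
    rw [hx]
    have hlow : av (fun b : R → Fin m => Gd ω a p b) + f (fun i => ω (a i)) p - pr (fun b : R → Fin m => ¬ Function.Injective (Sum.elim a b)) ≤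
        av (fun b : R → Fin m => av (fun p' : R → K => if Function.Injective (Sum.elim a b) ∧
        q (fun i => ω (a i)) p (fun i => ω (b i)) p' then (1:ℝ) else 0)) := by
      have hc := av_const (Ω := R → Fin m) (f (fun i => ω (a i)) p)
      rw [← hc, ← av_add]
      rw [← av_ite, ← av_sub]
      apply av_mono
      intro b
      by_cases hi : Function.Injective (Sum.elim a b)
      · simp only [hi, true_and, not_true, if_false, Gd]
        apply le_of_eq; simp only [av_ite]; ring
      · simp only [hi, false_and, not_false_eq_true, if_true, if_false]
        have h2 := pr_le_one (q (fun i => ω (a i)) p (fun i => ω (b i)))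
        rw [av_const]
        simp only [Gd]; linarith
    have habs := abs_lt_of_sq_lt_sq c2 (by positivity)
    rw [abs_lt] at habs
    linarith
  have hfin : av (fun ω : Fin m → B => pr (fun y : D → Fin m × K => pr (fun z : R → Fin m × K =>
      Function.Injective (Sum.elim (fun i => (y i).1) (fun i => (z i).1)) ∧
      Q (fun i => (ω (y i).1, (y i).2)) (fun i => (ω (z i).1, (z i).2))) ≤ g)) ≤
      av (fun ω : Fin m → B => av (fun a : D → Fin m => av (fun p : D → K =>
       (if f (fun i => ω (a i)) p < g + ε then (1:ℝ) else 0) +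
      ((if (ε/2)^2 ≤ (av (fun b : R → Fin m => Gd ω a p b))^2 then (1:ℝ) else 0) +
      (if ε/2 ≤ pr (fun b : R → Fin m => ¬ Function.Injective (Sum.elim a b)) then (1:ℝ) else 0))))) := by
    apply av_mono; intro ω
    refine le_trans (le_of_eq (av_arrowProd _)) ?_
    exact av_mono fun a => av_mono fun p => hmain ω a p
  refine hfin.trans ?_
  simp only [av_add, av_const]
  have : γ + C * (1 + 4 / ε ^ 2 + 2 / ε) / m = (γ + C / m) + ((C/m)/(ε/2)^2 + (C/m)/(ε/2)) := by
    field_simp; ring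
  rw [this]
  simp only [av_ite]
  linarith
end sampling
end PMH


namespace PMH
open Finset
open scoped Classical

lemma av_pow_le {Ω : Type*} [Fintype Ω] [Nonempty Ω] (f : Ω → ℝ) (hf : ∀ ω, 0 ≤ f ω) (n : ℕ) :
    (av f)^n ≤ av (fun ω => (f ω)^n) := by
  have hc : (Fintype.card Ω : ℝ) ≠ 0 := by exact_mod_cast Fintype.card_ne_zero
  have := Real.pow_arith_mean_le_arith_mean_pow univ (fun _ : Ω => (1:ℝ) / Fintype.card Ω) f
    (fun _ _ => by positivity) (by simp [hc]) (fun i _ => hf i) n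
  simp only [one_div_mul_eq_div, ← Finset.sum_div] at this
  exact this

lemma av_fin_cons {m : ℕ} {U : Type*} [Fintype U] (F : (Fin (m+1) → U) → ℝ) :
    av F = av (fun a : U => av (fun b : Fin m → U => F (Fin.cons a b))) := by
  rw [← av_prod (fun x : U × (Fin m → U) => F (Fin.cons x.1 x.2))]
  exact (av_equiv (Fin.consEquiv (fun _ : Fin (m+1) => U)) F).symm

lemma supersat_av {B : Type*} [Fintype B] [Nonempty B] (t : ℕ) : ∀ (m : ℕ) (f : (Fin m → B) → ℝ), (∀ x, 0 ≤ f x) →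
    (av f)^(t^m) ≤ av (fun β : Fin m → Fin t → B => ∏ s : Fin m → Fin t, f (fun i => β i (s i))) := by
  intro m
  induction m with
  | zero =>
    intro f hf
    simp only [pow_zero, pow_one]
    have h1 : ∀ x : Fin 0 → B, f x = f Fin.elim0 := fun x => by congr 1; exact Subsingleton.elim _ _
    have h2 : av f = f Fin.elim0 := by
      rw [show f = fun _ => f Fin.elim0 from funext h1, av_const]
    rw [h2]
    have : ∀ β : Fin 0 → Fin t → B, ∏ s : Fin 0 → Fin t, f (fun i => β i (s i)) = f Fin.elim0 := by
      intro β
      rw [Fintype.prod_unique, h1]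
    simp only [this]
    rw [av_const]
  | succ m ih =>
    intro f hf
    have h1 := av_fin_cons (fun β : Fin (m+1) → Fin t → B => ∏ s : Fin (m+1) → Fin t, f (fun i => β i (s i)))
    rw [h1]
    have h2 : ∀ (β0 : Fin t → B) (β' : Fin m → Fin t → B),
        ∏ s : Fin (m+1) → Fin t, f (fun i => (Fin.cons β0 β' : Fin (m+1) → Fin t → B) i (s i)) =
        ∏ s' : Fin m → Fin t, ∏ s0 : Fin t, f (Fin.cons (β0 s0) (fun i => β' i (s' i))) := by
      intro β0 β'
      rw [← Equiv.prod_comp (Fin.consEquiv (fun _ : Fin (m+1) => Fin t)), Fintype.prod_prod_type, Finset.prod_comm]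
      refine Finset.prod_congr rfl fun s' _ => Finset.prod_congr rfl fun s0 _ => ?_
      congr 1
      ext i
      refine Fin.cases ?_ (fun j => ?_) i <;> simp [Fin.consEquiv]
    simp only [h2]
    have h3 : ∀ β0 : Fin t → B, (av (fun x' : Fin m → B => ∏ s0 : Fin t, f (Fin.cons (β0 s0) x')))^(t^m) ≤
        av (fun β' : Fin m → Fin t → B => ∏ s' : Fin m → Fin t, ∏ s0 : Fin t, f (Fin.cons (β0 s0) (fun i => β' i (s' i)))) :=
      fun β0 => ih (fun x' => ∏ s0 : Fin t, f (Fin.cons (β0 s0) x')) (fun x => Finset.prod_nonneg fun i _ => hf _)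
    refine le_trans ?_ (av_mono h3)
    refine le_trans ?_ (av_pow_le _ (fun β0 => av_nonneg fun x => Finset.prod_nonneg fun i _ => hf _) _)
    rw [av_comm, pow_succ', pow_mul]
    refine pow_le_pow_left₀ (pow_nonneg (av_nonneg hf) _) ?_ _
    have h4 : ∀ x' : Fin m → B, av (fun β0 : Fin t → B => ∏ s0 : Fin t, f (Fin.cons (β0 s0) x')) =
        (av (fun b : B => f (Fin.cons b x')))^t := by
      intro x'
      rw [av_pi_prod (κ := Fin t) (Ω := fun _ => B) (fun _ b => f (Fin.cons b x'))]
      simp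
    simp only [h4]
    refine le_trans ?_ (av_pow_le _ (fun x' => av_nonneg fun b => hf _) _)
    rw [av_fin_cons f, av_comm]

lemma supersat {B : Type*} [Fintype B] [Nonempty B] (t m : ℕ) (P : (Fin m → B) → Prop) (ρ : ℝ) (hρ : 0 ≤ ρ)
    (hP : ρ ≤ pr P) :
    ρ^(t^m) ≤ pr (fun β : Fin m → Fin t → B => ∀ s : Fin m → Fin t, P (fun i => β i (s i))) := by
  have := supersat_av t m (fun x => if P x then (1:ℝ) else 0) (fun x => by split_ifs <;> norm_num)
  refine (pow_le_pow_left₀ hρ hP _).trans (this.trans (le_of_eq ?_))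
  unfold pr; congr 1; ext β
  by_cases h : ∀ s : Fin m → Fin t, P (fun i => β i (s i))
  · simp [h]
  · rw [if_neg h]
    push Not at h
    obtain ⟨s, hs⟩ := h
    exact Finset.prod_eq_zero (mem_univ s) (by simp [hs])

lemma supersat_inj {B : Type*} [Fintype B] [DecidableEq B] [Nonempty B] (t m : ℕ) (P : (Fin m → B) → Prop) (ρ : ℝ) (hρ : 0 ≤ ρ)
    (hP : ρ ≤ pr P) (hN : ((m:ℝ) * t)^2 / Fintype.card B < ρ^(t^m)) :
    ∃ β : Fin m → Fin t → B, (∀ i l i' l', β i l = β i' l' → i = i' ∧ l = l') ∧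
      ∀ s : Fin m → Fin t, P (fun i => β i (s i)) := by
  have h1 := supersat t m P ρ hρ hP
  have h2 : pr (fun β : Fin m → Fin t → B => ¬ Function.Injective (Function.uncurry β)) ≤
      ((m:ℝ) * t)^2 / Fintype.card B := by
    refine le_trans (le_of_eq (pr_equiv (Equiv.curry (Fin m) (Fin t) B).symm (fun x => ¬ Function.Injective x))) ?_
    refine (pr_not_inj_le).trans ?_
    simp
  have h3 := pr_and_not (fun β : Fin m → Fin t → B => ∀ s : Fin m → Fin t, P (fun i => β i (s i)))
    (fun β => Function.Injective (Function.uncurry β))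
  have h4 : pr (fun β : Fin m → Fin t → B => (∀ s : Fin m → Fin t, P (fun i => β i (s i))) ∧ ¬ Function.Injective (Function.uncurry β))
    ≤ pr (fun β : Fin m → Fin t → B => ¬ Function.Injective (Function.uncurry β)) := pr_mono fun _ h => h.2
  obtain ⟨β, hβ, hi⟩ := exists_of_pr_pos (P := fun β : Fin m → Fin t → B =>
    (∀ s : Fin m → Fin t, P (fun i => β i (s i))) ∧ Function.Injective (Function.uncurry β)) (by linarith)
  refine ⟨β, fun i l i' l' h => ?_, hβ⟩
  have := @hi (i, l) (i', l') h
  simpa using this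

/-- vertices of an edge-tuple -/
def vtx {I : Type*} {d r : ℕ} (e : (Fin d → I) × (Fin r → I)) : Fin d ⊕ Fin r → I := Sum.elim e.1 e.2

lemma le_load {I : Type*} {d r : ℕ} (e : (Fin d → I) × (Fin r → I)) (i : I) (h : ∃ j, vtx e j = i) :
    1 ≤ load e i := by
  unfold load
  have n1 : ∀ j, (0:ℝ) ≤ if e.1 j = i then (1:ℝ) else 0 := fun j => by split_ifs <;> norm_num
  have n2 : ∀ j, (0:ℝ) ≤ if e.2 j = i then (1:ℝ) else 0 := fun j => by split_ifs <;> norm_num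
  have p1 := Finset.sum_nonneg (s := univ) fun j _ => n1 j
  have p2 := Finset.sum_nonneg (s := univ) fun j _ => n2 j
  obtain ⟨j | j, hj⟩ := h
  · simp only [vtx, Sum.elim_inl] at hj
    have := Finset.single_le_sum (f := fun j => if e.1 j = i then (1:ℝ) else 0) (fun j _ => n1 j) (mem_univ j)
    simp only [hj, if_true] at this
    linarith
  · simp only [vtx, Sum.elim_inr] at hj
    have := Finset.single_le_sum (f := fun j => if e.2 j = i then (1:ℝ) else 0) (fun j _ => n2 j) (mem_univ j)
    simp only [hj, if_true] at this
    linarith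

lemma augment {V B K : Type} [DecidableEq V] [Fintype K] [DecidableEq K] {m d r t : ℕ} (hdr : 1 ≤ d) (φ : B × K ≃ V)
    (H : Finset (Finset V)) (ht : 1 ≤ t)
    (F : Finset ((Fin d → Fin m × K) × (Fin r → Fin m × K)))
    (hF : ∀ e ∈ F, Function.Injective (fun j => (vtx e j).1))
    (n : (Fin d → Fin m × K) × (Fin r → Fin m × K) → ℕ) (hn : ∀ e ∉ F, n e = 0)
    (hload : ∀ i, ∑ e, (n e : ℝ) * load e i ≤ t)
    (β : Fin m → Fin t → B) (hβ : ∀ i l i' l', β i l = β i' l' → i = i' ∧ l = l')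
    (hβF : ∀ s : Fin m → Fin t, ∀ e ∈ F,
      univ.image (fun j => φ (β (vtx e j).1 (s (vtx e j).1), (vtx e j).2)) ∈ H) :
    ∃ M' : Finset (Finset V), M' ⊆ H ∧ (M' : Set (Finset V)).PairwiseDisjoint id ∧ M'.card = ∑ e, n e ∧
      ∀ f ∈ M', ∀ v ∈ f, ∃ i l, (φ.symm v).1 = β i l := by
  let It := Σ e : (Fin d → Fin m × K) × (Fin r → Fin m × K), Fin (n e)
  have hItF : ∀ a : It, a.1 ∈ F := by
    rintro ⟨e, c⟩
    by_contra h
    have := hn e h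
    exact absurd c.2 (by omega)
  -- labels
  have hlab : ∀ i : Fin m × K, ∃ f : It → Fin t, ∀ a b : It, (∃ j, vtx a.1 j = i) → (∃ j, vtx b.1 j = i) → f a = f b → a = b := by
    intro i
    let S : Finset It := univ.filter fun a => ∃ j, vtx a.1 j = i
    have hS : S.card ≤ t := by
      have h1 : (S.card : ℝ) ≤ ∑ e, (n e : ℝ) * load e i := by
        rw [Finset.card_filter]
        push_cast
        rw [Fintype.sum_sigma]
        refine Finset.sum_le_sum fun e _ => ?_
        by_cases h : ∃ j, vtx e j = i
        · simp only [h, if_true, Finset.sum_const, Finset.card_univ, Fintype.card_fin, nsmul_eq_mul]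
          exact mul_le_mul_of_nonneg_left (le_load e i h) (by positivity)
        · simp only [h, if_false, Finset.sum_const_zero]
          refine mul_nonneg (by positivity) ?_
          unfold load
          refine add_nonneg (Finset.sum_nonneg fun j _ => ?_) (Finset.sum_nonneg fun j _ => ?_) <;>
          split_ifs <;> norm_num
      exact_mod_cast h1.trans (hload i)
    obtain ⟨g⟩ := Function.Embedding.nonempty_of_card_le (α := S) (β := Fin t) (by simpa using hS)
    refine ⟨fun a => if h : a ∈ S then g ⟨a, h⟩ else ⟨0, ht⟩, fun a b ha hb hab => ?_⟩
    have ha' : a ∈ S := by simpa [S] using ha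
    have hb' : b ∈ S := by simpa [S] using hb
    simp only [ha', hb', dif_pos] at hab
    simpa using g.injective hab
  choose lab hlab using hlab
  let edge : It → Finset V := fun a =>
    univ.image (fun j => φ (β (vtx a.1 j).1 (lab (vtx a.1 j) a), (vtx a.1 j).2))
  have hedgeH : ∀ a, edge a ∈ H := by
    intro a
    have hinj := hF _ (hItF a)
    let s : Fin m → Fin t := fun b => if h : ∃ j, (vtx a.1 j).1 = b then lab (vtx a.1 h.choose) a else ⟨0, ht⟩
    have hs : ∀ j, s (vtx a.1 j).1 = lab (vtx a.1 j) a := by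
      intro j
      have h : ∃ j', (vtx a.1 j').1 = (vtx a.1 j).1 := ⟨j, rfl⟩
      simp only [s, h, dif_pos]
      have := hinj h.choose_spec
      rw [this]
    have := hβF s a.1 (hItF a)
    simp only [hs] at this
    exact this
  have hdisj : ∀ a b, a ≠ b → Disjoint (edge a) (edge b) := by
    intro a b hab
    rw [Finset.disjoint_left]
    intro v hva hvb
    simp only [edge, Finset.mem_image, mem_univ, true_and] at hva hvb
    obtain ⟨j, hj⟩ := hva
    obtain ⟨j', hj'⟩ := hvb
    have h1 := φ.injective (hj.trans hj'.symm)
    rw [Prod.mk.injEq] at h1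
    obtain ⟨h2, h3⟩ := hβ _ _ _ _ h1.1
    have h4 : vtx a.1 j = vtx b.1 j' := Prod.ext h2 h1.2
    rw [← h4] at h3
    exact hab (hlab _ a b ⟨j, rfl⟩ ⟨j', h4.symm⟩ h3)
  have hne : ∀ a, (edge a).Nonempty := fun a => ⟨_, Finset.mem_image_of_mem _ (mem_univ (Sum.inl ⟨0, hdr⟩))⟩
  have hinj : Function.Injective edge := by
    intro a b hab
    by_contra h
    have := hdisj a b h
    rw [hab, disjoint_self] at this
    exact (hne b).ne_empty this
  refine ⟨univ.image edge, ?_, ?_, ?_, ?_⟩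
  · intro f hf
    obtain ⟨a, _, rfl⟩ := Finset.mem_image.1 hf
    exact hedgeH a
  · intro f hf g hg hfg
    simp only [coe_image, coe_univ, Set.image_univ, Set.mem_range] at hf hg
    obtain ⟨a, rfl⟩ := hf
    obtain ⟨b, rfl⟩ := hg
    exact hdisj a b fun h => hfg (by rw [h])
  · rw [Finset.card_image_of_injective _ hinj, Finset.card_univ, Fintype.card_sigma]; simp
  · intro f hf v hv
    obtain ⟨a, _, rfl⟩ := Finset.mem_image.1 hf
    obtain ⟨j, _, rfl⟩ := Finset.mem_image.1 hv
    exact ⟨_, _, by rw [Equiv.symm_apply_apply]⟩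

end PMH


namespace PMH
open Finset
open scoped Classical

lemma exists_blocks {V : Type} [Fintype V] [DecidableEq V] (k N : ℕ) (hk : 1 ≤ k) (hV : Fintype.card V = k * N)
    (M : Finset (Finset V)) (hMk : ∀ e ∈ M, e.card = k) (hM : (M : Set (Finset V)).PairwiseDisjoint id) :
    ∃ φ : ({e // e ∈ M} ⊕ Fin (N - M.card)) × Fin k ≃ V,
      (∀ v, ∀ e : {e // e ∈ M}, v ∈ e.1 ↔ (φ.symm v).1 = Sum.inl e) ∧ M.card ≤ N := by
  set U : Finset V := (M.biUnion id)ᶜ with hU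
  have hcov : (M.biUnion id).card = k * M.card := by
    rw [Finset.card_biUnion (fun a ha b hb hab => hM ha hb hab)]
    simp only [id]
    rw [Finset.sum_congr rfl (fun e he => hMk e he)]; simp [mul_comm]
  have hMN : M.card ≤ N := by
    have := Finset.card_le_univ (M.biUnion id)
    rw [hcov, hV] at this
    exact Nat.le_of_mul_le_mul_left this hk
  have hUc : U.card = (N - M.card) * k := by
    rw [hU, Finset.card_compl, hcov, hV, Nat.sub_mul, mul_comm, mul_comm k]
  let ψ : U ≃ Fin (N - M.card) × Fin k := Fintype.equivOfCardEq (by simp [hUc])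
  have hex : ∀ v : V, v ∉ U → ∃ e ∈ M, v ∈ e := by
    intro v hv
    simpa [hU] using hv
  let blk : V → {e // e ∈ M} ⊕ Fin (N - M.card) := fun v =>
    if h : v ∈ U then Sum.inr (ψ ⟨v, h⟩).1 else Sum.inl ⟨(hex v h).choose, (hex v h).choose_spec.1⟩
  have hblk1 : ∀ v, ∀ e : {e // e ∈ M}, v ∈ e.1 ↔ blk v = Sum.inl e := by
    intro v e
    by_cases h : v ∈ U
    · have : v ∉ e.1 := by
        intro hv
        rw [hU, Finset.mem_compl] at h
        exact h (Finset.mem_biUnion.2 ⟨e.1, e.2, hv⟩)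
      simp [blk, h, this]
    · simp only [blk, h, dif_neg, not_false_eq_true, Sum.inl.injEq]
      constructor
      · intro hv
        by_contra hne
        have := hM (hex v h).choose_spec.1 e.2 (fun hh => hne (Subtype.ext hh))
        exact (Finset.disjoint_left.1 this) (hex v h).choose_spec.2 hv
      · intro he
        rw [← he]
        exact (hex v h).choose_spec.2
  have hblk2 : ∀ v i, blk v = Sum.inr i ↔ ∃ h : v ∈ U, (ψ ⟨v, h⟩).1 = i := by
    intro v i
    by_cases h : v ∈ U
    · simp [blk, h]
    · simp [blk, h]
  have hfib : ∀ b, Fintype.card {v // blk v = b} = k := by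
    intro b
    rw [Fintype.card_subtype]
    rcases b with e | i
    · rw [← hMk e.1 e.2]
      congr 1; ext v; simp [hblk1]
    · have : (univ.filter fun v => blk v = Sum.inr i) = univ.image (fun j : Fin k => (ψ.symm (i, j)).1) := by
        ext v
        simp only [mem_filter, mem_univ, true_and, hblk2, mem_image]
        constructor
        · rintro ⟨h, hi⟩
          refine ⟨(ψ ⟨v, h⟩).2, ?_⟩
          rw [← hi]; simp
        · rintro ⟨j, rfl⟩
          exact ⟨(ψ.symm (i, j)).2, by simp⟩
      rw [this, Finset.card_image_of_injective, Finset.card_univ, Fintype.card_fin]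
      intro j j' h
      have := ψ.symm.injective (Subtype.ext h)
      simpa using this
  let e1 : (Σ b, {v // blk v = b}) ≃ V := Equiv.sigmaFiberEquiv blk
  let e2 : (Σ b, {v // blk v = b}) ≃ (Σ _b : {e // e ∈ M} ⊕ Fin (N - M.card), Fin k) :=
    Equiv.sigmaCongrRight fun b => Fintype.equivOfCardEq (by simp [hfib])
  let e3 : (Σ _b : {e // e ∈ M} ⊕ Fin (N - M.card), Fin k) ≃ ({e // e ∈ M} ⊕ Fin (N - M.card)) × Fin k := Equiv.sigmaEquivProd _ _
  refine ⟨(e3.symm.trans e2.symm).trans e1, ?_, hMN⟩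
  intro v e
  rw [hblk1]
  exact Iff.rfl

/-- if M is a maximum matching it cannot be augmented inside a few blocks -/
lemma no_augment {V : Type} [DecidableEq V] {k q m t : ℕ} 
    (H M : Finset (Finset V)) (hMH : M ⊆ H) (hM : (M : Set (Finset V)).PairwiseDisjoint id)
    (hne : ∀ e ∈ H, e.Nonempty)
    (hmax : ∀ M' ⊆ H, (M' : Set (Finset V)).PairwiseDisjoint id → M'.card ≤ M.card)
    (φ : ({e // e ∈ M} ⊕ Fin q) × Fin k ≃ V)
    (hφ : ∀ v, ∀ e : {e // e ∈ M}, v ∈ e.1 ↔ (φ.symm v).1 = Sum.inl e)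
    (β : Fin m → Fin t → {e // e ∈ M} ⊕ Fin q) (Js : Finset (Fin m)) (hJ : ∀ i l, (β i l).isLeft = true → i ∈ Js)
    (M' : Finset (Finset V)) (hM'H : M' ⊆ H) (hM' : (M' : Set (Finset V)).PairwiseDisjoint id)
    (hM'β : ∀ f ∈ M', ∀ v ∈ f, ∃ i l, (φ.symm v).1 = β i l) : M'.card ≤ t * Js.card := by
  let R : Finset (Finset V) := M.filter fun e => ∃ i l, ∃ h : e ∈ M, β i l = Sum.inl ⟨e, h⟩
  have hR : R.card ≤ t * Js.card := by
    have : R ⊆ (Js ×ˢ (univ : Finset (Fin t))).image (fun p => match β p.1 p.2 with | Sum.inl e => e.1 | Sum.inr _ => ∅) := by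
      intro e he
      obtain ⟨heM, i, l, h, hil⟩ := Finset.mem_filter.1 he
      refine Finset.mem_image.2 ⟨(i, l), ?_, by simp [hil]⟩
      simp only [mem_product, mem_univ, and_true]
      exact hJ i l (by rw [hil]; rfl)
    refine (Finset.card_le_card this).trans (Finset.card_image_le.trans ?_)
    rw [Finset.card_product]; simp [mul_comm]
  have hdisjR : ∀ e ∈ M \ R, ∀ f ∈ M', Disjoint e f := by
    intro e he f hf
    rw [Finset.mem_sdiff] at he
    rw [Finset.disjoint_left]
    intro v hve hvf
    obtain ⟨i, l, hil⟩ := hM'β f hf v hvf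
    have := (hφ v ⟨e, he.1⟩).1 hve
    exact he.2 (Finset.mem_filter.2 ⟨he.1, i, l, he.1, by rw [← hil, this]⟩)
  have hd : Disjoint (M \ R) M' := by
    rw [Finset.disjoint_left]
    intro e he he'
    have := hdisjR e he e he'
    rw [disjoint_self] at this
    exact (hne e (hM'H he')).ne_empty this
  have h1 := hmax ((M \ R) ∪ M') (Finset.union_subset (Finset.sdiff_subset.trans hMH) hM'H) (by
    intro a ha b hb hab
    simp only [coe_union, Set.mem_union, mem_coe] at ha hb
    rcases ha with ha | ha <;> rcases hb with hb | hb
    · exact hM (Finset.mem_sdiff.1 ha).1 (Finset.mem_sdiff.1 hb).1 hab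
    · exact hdisjR a ha b hb
    · exact (hdisjR b hb a ha).symm
    · exact hM' ha hb hab)
  rw [Finset.card_union_of_disjoint hd, Finset.card_sdiff_of_subset (Finset.filter_subset _ _)] at h1
  have h2 : R.card ≤ M.card := Finset.card_le_card (Finset.filter_subset _ _)
  have h3 : (M.filter fun e => ∃ i l, ∃ h : e ∈ M, β i l = Sum.inl ⟨e, h⟩).card = R.card := rfl
  omega

lemma exists_type {Ω T : Type*} [Fintype Ω] [Fintype T] [DecidableEq T] [Nonempty T] (P : Ω → Prop) (ty : Ω → T) (ρ : ℝ)
    (h : ρ ≤ pr P) : ∃ τ, ρ / Fintype.card T ≤ pr (fun ω => P ω ∧ ty ω = τ) := by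
  have h1 : pr P ≤ ∑ τ, pr (fun ω => P ω ∧ ty ω = τ) := by
    refine le_trans (pr_mono ?_) (pr_exists_le _)
    intro ω hω
    exact ⟨ty ω, hω, rfl⟩
  obtain ⟨τ, hτ⟩ := exists_av_le (fun τ => pr (fun ω => P ω ∧ ty ω = τ))
  refine ⟨τ, le_trans ?_ hτ⟩
  unfold av
  gcongr
  exact h.trans h1

lemma exists_max_matching {V : Type} [DecidableEq V] (H : Finset (Finset V)) :
    ∃ M ⊆ H, (M : Set (Finset V)).PairwiseDisjoint id ∧
      ∀ M' ⊆ H, (M' : Set (Finset V)).PairwiseDisjoint id → M'.card ≤ M.card := by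
  obtain ⟨M, hM, hmax⟩ := Finset.exists_max_image (H.powerset.filter fun M : Finset (Finset V) => (M : Set (Finset V)).PairwiseDisjoint id)
    Finset.card ⟨∅, by simp⟩
  simp only [mem_filter, mem_powerset] at hM hmax
  exact ⟨M, hM.1, hM.2, fun M' h1 h2 => hmax M' ⟨h1, h2⟩⟩

lemma apm_core {V : Type} [Fintype V] [DecidableEq V] (k d r m t N : ℕ) (hk : 2 ≤ k) (hr : 2 ≤ r) (hd : 1 ≤ d)
    (hkdr : d + r = k) (hkr : k + 1 ≤ 2 * r) (ε η : ℝ) (hε : 0 < ε) (hη : 0 < η) (hη1 : η < 1)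
    (c0 : ℝ) (hc0 : c0 = (η / 4 / (4 * k))^d) (γ : ℝ) (hγ : γ ≤ c0 * η / 16)
    (hm4 : 4 ≤ η / 4 * m)
    (hmC : ((d:ℝ) + 2 * r)^2 * (1 + 4 / ε^2 + 2 / ε) / m ≤ c0 * η / 16)
    (ht : (Fintype.card ((Fin d → Fin m × Fin k) × (Fin r → Fin m × Fin k)) : ℝ) < t * (η * m / 4))
    (ht1 : 1 ≤ t)
    (hN : ((m:ℝ) * t)^2 / N < (η / 4 / Fintype.card (Finset ((Fin d → Fin m × Fin k) × (Fin r → Fin m × Fin k)) × Finset (Fin m)))^(t^m))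
    (hN1 : 1 ≤ N)
    (hV : Fintype.card V = k * N) (H : Finset (Finset V)) (hH : ∀ e ∈ H, e.card = k)
    (hdeg : pr (fun y : Fin d → V => pr (fun z : Fin r → V => univ.image (Sum.elim y z) ∈ H) < gc k r r + ε) ≤ γ) :
    ∃ M ⊆ H, (M : Set (Finset V)).PairwiseDisjoint id ∧ (1 - η) * N ≤ M.card := by
  obtain ⟨M, hMH, hM, hmax⟩ := exists_max_matching H
  refine ⟨M, hMH, hM, ?_⟩
  by_contra hlt
  push Not at hlt
  obtain ⟨φ, hφ, hMN⟩ := exists_blocks k N (by omega) hV M (fun e he => hH e (hMH he)) hM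
  let B : Type := {e // e ∈ M} ⊕ Fin (N - M.card)
  have hBc : Fintype.card B = N := by
    simp [B]; omega
  have hm0 : (0:ℝ) < m := by nlinarith
  have hm1 : 0 < m := by exact_mod_cast hm0
  have : Nonempty B := by rw [← Fintype.card_pos_iff, hBc]; omega
  have : Nonempty (Fin m) := ⟨⟨0, hm1⟩⟩
  have : Nonempty (Fin k) := ⟨⟨0, by omega⟩⟩
  have hc0p : 0 < c0 := by rw [hc0]; positivity
  let Q : (Fin d → B × Fin k) → (Fin r → B × Fin k) → Prop := fun y z =>
    univ.image (Sum.elim (fun i => φ (y i)) (fun i => φ (z i))) ∈ H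
  have hQ : pr (fun y => pr (Q y) < gc k r r + ε) ≤ γ := by
    have h1 : ∀ y, pr (Q y) = pr (fun z : Fin r → V => univ.image (Sum.elim (fun i => φ (y i)) z) ∈ H) := by
      intro y
      exact pr_equiv (Equiv.arrowCongr (Equiv.refl (Fin r)) φ) (fun z : Fin r → V => univ.image (Sum.elim (fun i => φ (y i)) z) ∈ H)
    simp only [h1]
    exact (pr_equiv (Equiv.arrowCongr (Equiv.refl (Fin d)) φ) (fun y : Fin d → V => pr (fun z : Fin r → V => univ.image (Sum.elim y z) ∈ H) < gc k r r + ε)).le.trans hdeg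
  let Fp : (Fin m → B) → (Fin d → Fin m × Fin k) → (Fin r → Fin m × Fin k) → Prop := fun ω y z =>
      Function.Injective (Sum.elim (fun i => (y i).1) (fun i => (z i).1)) ∧
      Q (fun i => (ω (y i).1, (y i).2)) (fun i => (ω (z i).1, (z i).2))
  have hS := sampling (m := m) Q (gc k r r) ε γ hε hQ
  simp only [Fintype.card_fin] at hS
  have hS1 : pr (fun ω : Fin m → B => c0 ≤ pr (fun y => pr (Fp ω y) ≤ gc k r r)) ≤ η / 8 := by
    refine (pr_markov (fun ω => pr_nonneg _) hc0p).trans ?_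
    rw [div_le_iff₀ hc0p]
    refine hS.trans ?_
    linarith
  let Jf : (Fin m → B) → Finset (Fin m) := fun ω => univ.filter fun i => (ω i).isLeft = true
  have hJ1 : pr (fun ω : Fin m → B => (1 - η/2) * m ≤ ((Jf ω).card : ℝ)) ≤ 1 - η / 2 := by
    have hpos : 0 < (1 - η/2) * m := mul_pos (by linarith) hm0
    refine (pr_markov (fun ω => by positivity) hpos).trans ?_
    have h1 : av (fun ω : Fin m → B => ((Jf ω).card : ℝ)) ≤ (1 - η) * m := by
      have h2 : ∀ ω : Fin m → B, ((Jf ω).card : ℝ) = ∑ i, if ω i ∈ (univ.filter fun b : B => b.isLeft = true) then (1:ℝ) else 0 := by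
        intro ω
        simp only [Jf, Finset.card_filter]; push_cast; simp
      simp only [h2, av_sum]
      have h3 : ∀ i : Fin m, av (fun ω : Fin m → B => if ω i ∈ (univ.filter fun b : B => b.isLeft = true) then (1:ℝ) else 0) ≤ 1 - η := by
        intro i
        rw [av_ite, pr_apply_mem, hBc, div_le_iff₀ (by exact_mod_cast hN1)]
        have h4 : (univ.filter fun b : B => b.isLeft = true).card ≤ M.card := by
          have : (univ.filter fun b : B => b.isLeft = true) ⊆ univ.image (fun e : {e // e ∈ M} => (Sum.inl e : B)) := by
            intro b hb
            simp only [mem_filter, mem_univ, true_and] at hb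
            rcases b with e | i
            · simp
            · simp at hb
          refine (Finset.card_le_card this).trans (Finset.card_image_le.trans ?_)
          simp
        have h5 : ((univ.filter fun b : B => b.isLeft = true).card : ℝ) ≤ M.card := by exact_mod_cast h4
        linarith
      refine (Finset.sum_le_sum fun i _ => h3 i).trans (le_of_eq ?_)
      simp; ring
    rw [div_le_iff₀ hpos]
    nlinarith [mul_pos hη hη]
  have hgood : η / 4 ≤ pr (fun ω : Fin m → B => ¬ (c0 ≤ pr (fun y => pr (Fp ω y) ≤ gc k r r) ∨ (1 - η/2) * m ≤ ((Jf ω).card : ℝ))) := by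
    rw [pr_not]
    have := pr_or_le (fun ω : Fin m → B => c0 ≤ pr (fun y => pr (Fp ω y) ≤ gc k r r)) (fun ω => (1 - η/2) * m ≤ ((Jf ω).card : ℝ))
    linarith
  let ty : (Fin m → B) → Finset ((Fin d → Fin m × Fin k) × (Fin r → Fin m × Fin k)) × Finset (Fin m) :=
    fun ω => (univ.filter fun e => Fp ω e.1 e.2, Jf ω)
  obtain ⟨⟨F, Js⟩, hτ⟩ := exists_type _ ty _ hgood
  obtain ⟨β, hβ, hβP⟩ := supersat_inj t m _ _ (by positivity) hτ (by rw [hBc]; exact hN)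
  have hFp : ∀ s : Fin m → Fin t, ∀ e, e ∈ F ↔ Fp (fun i => β i (s i)) e.1 e.2 := by
    intro s e
    have := congrArg Prod.fst (hβP s).2
    simp only [ty] at this
    rw [← this]; simp
  have hJs : ∀ s : Fin m → Fin t, Jf (fun i => β i (s i)) = Js := fun s => congrArg Prod.snd (hβP s).2
  let s0 : Fin m → Fin t := fun _ => ⟨0, ht1⟩
  have hg0 := (hβP s0).1
  push Not at hg0
  obtain ⟨hg1, hg2⟩ := hg0
  rw [hJs s0] at hg2
  obtain ⟨x, hx0, hxF, hxl, hxs⟩ := frac_matching (I := Fin m × Fin k) k d r m hk hr hd hkdr hkr (by simp [mul_comm]) (η/4) (by positivity) (by linarith) hm4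
    (Fp (fun i => β i (s0 i))) (by rw [← hc0]; exact hg1)
  let n : (Fin d → Fin m × Fin k) × (Fin r → Fin m × Fin k) → ℕ := fun e => ⌊t * x e⌋₊
  have hnx : ∀ e, (n e : ℝ) ≤ t * x e := fun e => Nat.floor_le (mul_nonneg (by positivity) (hx0 e))
  have hload0 : ∀ (e : (Fin d → Fin m × Fin k) × (Fin r → Fin m × Fin k)) i, 0 ≤ load e i := by
    intro e i
    unfold load
    refine add_nonneg (Finset.sum_nonneg fun j _ => ?_) (Finset.sum_nonneg fun j _ => ?_) <;>
    split_ifs <;> norm_num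
  have hvt : ∀ e : (Fin d → Fin m × Fin k) × (Fin r → Fin m × Fin k),
      (fun j => (vtx e j).1) = Sum.elim (fun i => (e.1 i).1) (fun i => (e.2 i).1) := by
    intro e; ext j; rcases j with j | j <;> rfl
  obtain ⟨M', hM'H, hM'd, hM'c, hM'β⟩ := augment (r := r) hd φ H ht1 F
    (by
      intro e he
      rw [hvt]
      exact ((hFp s0 e).1 he).1)
    n (by
      intro e he
      have : x e = 0 := hxF e (fun h => he ((hFp s0 e).2 h))
      simp [n, this])
    (by
      intro i
      calc ∑ e, (n e : ℝ) * load e i ≤ ∑ e, t * (x e * load e i) := Finset.sum_le_sum fun e _ => by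
            rw [← mul_assoc]; exact mul_le_mul_of_nonneg_right (hnx e) (hload0 e i)
        _ = t * ∑ e, x e * load e i := by rw [Finset.mul_sum]
        _ ≤ t * 1 := by gcongr; exact hxl i
        _ = t := mul_one _)
    β hβ (by
      intro s e he
      have := ((hFp s e).1 he).2
      have h2 : (fun j => φ (β (vtx e j).1 (s (vtx e j).1), (vtx e j).2)) =
        Sum.elim (fun i => φ (β (e.1 i).1 (s (e.1 i).1), (e.1 i).2)) (fun i => φ (β (e.2 i).1 (s (e.2 i).1), (e.2 i).2)) := by
        ext j; rcases j with j | j <;> rfl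
      rw [h2]
      exact this)
  have hfin := no_augment H M hMH hM (fun e he => by rw [← Finset.card_pos, hH e he]; omega) hmax φ hφ β Js
    (by
      intro i l hil
      rw [← hJs (fun _ => l)]
      simpa [Jf] using hil) M' hM'H hM'd hM'β
  rw [hM'c] at hfin
  have hfinR : (∑ e, (n e : ℝ)) ≤ t * Js.card := by exact_mod_cast hfin
  have hlow : (t:ℝ) * ((1 - η/4) * m) - Fintype.card ((Fin d → Fin m × Fin k) × (Fin r → Fin m × Fin k)) ≤ ∑ e, (n e : ℝ) := by
    rw [← hxs, Finset.mul_sum]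
    have : ∑ e, (t * x e - 1) ≤ ∑ e, (n e : ℝ) := Finset.sum_le_sum fun e _ => by
      have := Nat.lt_floor_add_one (t * x e)
      simp only [n]; linarith
    rw [Finset.sum_sub_distrib] at this
    simpa using this
  have htR : (0:ℝ) < t := by exact_mod_cast ht1
  have : (t:ℝ) * Js.card ≤ t * ((1 - η/2) * m) := by gcongr
  linarith

lemma apm (k d r : ℕ) (hk : 2 ≤ k) (hr : 2 ≤ r) (hd : 1 ≤ d)
    (hkdr : d + r = k) (hkr : k + 1 ≤ 2 * r) (ε η : ℝ) (hε : 0 < ε) (hη : 0 < η) (hη1 : η < 1) :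
    ∃ γ : ℝ, 0 < γ ∧ ∃ N0 : ℕ, ∀ (V : Type) [Fintype V] [DecidableEq V] (N : ℕ), N0 ≤ N →
      Fintype.card V = k * N → ∀ H : Finset (Finset V), (∀ e ∈ H, e.card = k) →
      pr (fun y : Fin d → V => pr (fun z : Fin r → V => univ.image (Sum.elim y z) ∈ H) < gc k r r + ε) ≤ γ →
      ∃ M ⊆ H, (M : Set (Finset V)).PairwiseDisjoint id ∧ (1 - η) * N ≤ M.card := by
  set c0 : ℝ := (η / 4 / (4 * k))^d with hc0
  have hc0p : 0 < c0 := by rw [hc0]; positivity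
  set C : ℝ := ((d:ℝ) + 2 * r)^2 * (1 + 4 / ε^2 + 2 / ε) with hC
  have hCp : 0 < C := by positivity
  obtain ⟨m, hm⟩ := exists_nat_gt (16 / η + 16 * C / (c0 * η))
  have h1 : 0 < 16 / η := by positivity
  have h2 : 0 < 16 * C / (c0 * η) := by positivity
  have hm0 : (0:ℝ) < m := by linarith
  have hm4 : 4 ≤ η / 4 * m := by
    have : 16 / η < m := by linarith
    rw [div_lt_iff₀ hη] at this; linarith
  have hmC : C / m ≤ c0 * η / 16 := by
    have : 16 * C / (c0 * η) < m := by linarith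
    rw [div_lt_iff₀ (by positivity)] at this
    rw [div_le_iff₀ hm0]; linarith
  obtain ⟨t, ht⟩ := exists_nat_gt (1 + (Fintype.card ((Fin d → Fin m × Fin k) × (Fin r → Fin m × Fin k)) : ℝ) / (η * m / 4))
  have h3 : 0 ≤ (Fintype.card ((Fin d → Fin m × Fin k) × (Fin r → Fin m × Fin k)) : ℝ) / (η * m / 4) := by positivity
  have ht1 : 1 ≤ t := by
    have : (1:ℝ) ≤ t := by linarith
    exact_mod_cast this
  have ht2 : (Fintype.card ((Fin d → Fin m × Fin k) × (Fin r → Fin m × Fin k)) : ℝ) < t * (η * m / 4) := by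
    rw [← div_lt_iff₀ (by positivity)]; linarith
  set ρ : ℝ := (η / 4 / Fintype.card (Finset ((Fin d → Fin m × Fin k) × (Fin r → Fin m × Fin k)) × Finset (Fin m)))^(t^m) with hρ
  have hρp : 0 < ρ := by
    rw [hρ]
    apply pow_pos
    apply div_pos (by positivity)
    exact_mod_cast Fintype.card_pos
  obtain ⟨N0, hN0⟩ := exists_nat_gt (1 + ((m:ℝ) * t)^2 / ρ)
  have h4 : 0 ≤ ((m:ℝ) * t)^2 / ρ := by positivity
  refine ⟨c0 * η / 16, by positivity, N0, ?_⟩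
  intro V _ _ N hN hV H hH hdeg
  have hNR : (N0:ℝ) ≤ N := by exact_mod_cast hN
  have hN1 : 1 ≤ N := by
    have : (1:ℝ) ≤ N := by linarith
    exact_mod_cast this
  refine apm_core k d r m t N hk hr hd hkdr hkr ε η hε hη hη1 c0 hc0 _ le_rfl hm4 hmC ht2 ht1 ?_ hN1 hV H hH hdeg
  rw [← hρ, div_lt_iff₀ (by exact_mod_cast hN1), mul_comm ρ, ← div_lt_iff₀ hρp]
  linarith

end PMH


namespace PMH
open Finset
open scoped Classical

section graph
variable {V : Type} [Fintype V] [DecidableEq V] [Nonempty V] {q : ℕ}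

/-- `z` is in the link of `v` -/
def Lk (H : Finset (Finset V)) (v : V) (z : Fin q → V) : Prop := insert v (univ.image z) ∈ H

/-- auxiliary graph: many common links -/
def Adj (q : ℕ) (b : ℝ) (H : Finset (Finset V)) (u v : V) : Prop :=
  b ≤ pr (fun z : Fin q → V => Lk H u z ∧ Lk H v z)

lemma Adj.symm' {b : ℝ} {H : Finset (Finset V)} {u v : V} (h : Adj q b H u v) : Adj q b H v u := by
  unfold Adj at *
  rwa [pr_congr (Q := fun z : Fin q → V => Lk H u z ∧ Lk H v z) (fun z => and_comm)]

lemma adj_three {b γ : ℝ} {H : Finset (Finset V)} (hb : b ≤ 1/12) (hγ : γ ≤ 1/12)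
    (hdeg : ∀ v, 1/2 - γ ≤ pr (fun z : Fin q → V => Lk H v z)) (u v w : V) :
    Adj q b H u v ∨ Adj q b H u w ∨ Adj q b H v w := by
  by_contra h
  push Not at h
  obtain ⟨h1, h2, h3⟩ := h
  unfold Adj at h1 h2 h3
  push Not at h1 h2 h3
  have key : pr (fun z : Fin q → V => Lk H u z) + pr (fun z : Fin q → V => Lk H v z) + pr (fun z : Fin q → V => Lk H w z)
      - pr (fun z : Fin q → V => Lk H u z ∧ Lk H v z) - pr (fun z : Fin q → V => Lk H u z ∧ Lk H w z)
      - pr (fun z : Fin q → V => Lk H v z ∧ Lk H w z) ≤ 1 := by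
    unfold pr
    rw [← av_add, ← av_add, ← av_sub, ← av_sub, ← av_sub]
    refine av_abs_le _ _ fun z => ?_
    by_cases a1 : Lk H u z <;> by_cases a2 : Lk H v z <;> by_cases a3 : Lk H w z <;> simp [a1, a2, a3] <;> norm_num
  have := hdeg u; have := hdeg v; have := hdeg w
  linarith

/-- hybrid tuple -/
def hyb (i : ℕ) (x : Fin q ⊕ Fin q → V) : Fin q → V := fun j => if j.val < i then x (Sum.inr j) else x (Sum.inl j)

lemma hyb_insert (x : Fin q ⊕ Fin q → V) (i : Fin q) :
    insert (x (Sum.inr i)) (univ.image (hyb i.val x)) = insert (x (Sum.inl i)) (univ.image (hyb (i.val+1) x)) := by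
  ext a
  simp only [mem_insert, mem_image, mem_univ, true_and, hyb]
  constructor
  · rintro (rfl | ⟨j, rfl⟩)
    · right; exact ⟨i, by simp⟩
    · by_cases h : j = i
      · subst h; left; simp
      · right
        refine ⟨j, ?_⟩
        have h' : j.val ≠ i.val := fun hh => h (Fin.ext hh)
        by_cases h2 : j.val < i.val
        · rw [if_pos h2, if_pos (by omega)]
        · rw [if_neg h2, if_neg (by omega)]
  · rintro (rfl | ⟨j, rfl⟩)
    · right; exact ⟨i, by simp⟩
    · by_cases h : j = i
      · subst h; left; simp
      · right
        refine ⟨j, ?_⟩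
        have h' : j.val ≠ i.val := fun hh => h (Fin.ext hh)
        by_cases h2 : j.val < i.val
        · rw [if_pos h2, if_pos (by omega)]
        · rw [if_neg h2, if_neg (by omega)]

lemma pr_hyb (G : V → (Fin q → V) → Prop) (i : Fin q) (s : Fin q ⊕ Fin q) (i' : ℕ)
    (hs : (s = Sum.inr i ∧ i' = i.val) ∨ (s = Sum.inl i ∧ i' = i.val + 1)) :
    pr (fun x : Fin q ⊕ Fin q → V => G (x s) (hyb i' x)) = av (fun v => pr (G v)) := by
  let σ : Option (Fin q) → Fin q ⊕ Fin q := fun o => o.elim s (fun j => if j.val < i' then Sum.inr j else Sum.inl j)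
  have hσ : Function.Injective σ := by
    intro a b hab
    rcases a with _ | a <;> rcases b with _ | b
    · rfl
    · exfalso
      simp only [σ, Option.elim] at hab
      split_ifs at hab with h1 <;> rcases hs with ⟨rfl, rfl⟩ | ⟨rfl, rfl⟩ <;> simp at hab <;> subst hab <;> omega
    · exfalso
      simp only [σ, Option.elim] at hab
      split_ifs at hab with h1 <;> rcases hs with ⟨rfl, rfl⟩ | ⟨rfl, rfl⟩ <;> simp at hab <;> subst hab <;> omega
    · simp only [σ, Option.elim] at hab
      split_ifs at hab <;> simp at hab <;> simp [hab]
  have h := pr_comp_inj (V := V) σ hσ (fun e => G (e none) (fun j => e (some j)))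
  have h2 : ∀ x : Fin q ⊕ Fin q → V, (fun j : Fin q => x (σ (some j))) = hyb i' x := by
    intro x; ext j
    simp only [σ, Option.elim, hyb]
    split_ifs <;> rfl
  simp only [h2] at h
  refine h.trans ?_
  rw [← pr_prod]
  exact pr_equiv (Equiv.piOptionEquivProd (β := fun _ : Option (Fin q) => V)) (fun p => G p.1 p.2)

lemma adj_degree {b γ ζ : ℝ} {H : Finset (Finset V)} (hq : 1 ≤ q) (hb0 : 0 < b) (hγ0 : 0 < γ) (hζ0 : 0 < ζ)
    (hb : b * (100 * (q:ℝ)) ≤ 1) (hγ : γ * (100 * (q:ℝ)) ≤ 1) (hζ : ζ * (100 * (q:ℝ)) ≤ 1)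
    (hdeg : ∀ v, 1/2 - γ ≤ pr (fun z : Fin q → V => Lk H v z)) (x : V) :
    ζ ≤ pr (fun v => Adj q b H x v) := by
  by_contra hlt
  push Not at hlt
  have hqR : (1:ℝ) ≤ q := by exact_mod_cast hq
  have hb' : b ≤ 1/100 := by nlinarith
  have hγ' : γ ≤ 1/100 := by nlinarith
  have hζ' : ζ ≤ 1/100 := by nlinarith
  set P : (Fin q → V) → Prop := fun z => Lk H x z with hP
  set p := pr P with hp
  have hp1 : 1/2 - γ ≤ p := hdeg x
  have incl : ∀ v, pr (fun z => Lk H v z ∧ P z) + pr (fun z => ¬ Lk H v z ∧ ¬ P z) = 1 - pr (fun z : Fin q → V => Lk H v z) - p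
      + 2 * pr (fun z => Lk H v z ∧ P z) := by
    intro v
    rw [← av_const (Ω := Fin q → V) 1, hp]
    unfold pr
    rw [← av_mul_left, ← av_add, ← av_sub, ← av_sub, ← av_add]
    congr 1; ext z
    by_cases a1 : Lk H v z <;> by_cases a2 : P z <;> simp [a1, a2] <;> norm_num
  have hcomm : ∀ v, pr (fun z => Lk H v z ∧ P z) = pr (fun z : Fin q → V => Lk H x z ∧ Lk H v z) := fun v =>
    pr_congr fun z => and_comm
  -- p is close to 1/2
  have hp2 : p ≤ 1/2 + γ + b := by
    obtain ⟨v, hv⟩ : ∃ v, ¬ Adj q b H x v := by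
      apply exists_of_pr_pos
      rw [pr_not]; linarith
    unfold Adj at hv
    push Not at hv
    have h1 := incl v
    have h2 := pr_nonneg (fun z => ¬ Lk H v z ∧ ¬ P z)
    have h3 := hdeg v
    rw [hcomm] at h1
    linarith
  set κ : ℝ := ζ + (2 * b + 2 * γ) with hκ
  have hfail : av (fun v => pr (fun z => (Lk H v z ↔ P z))) ≤ κ := by
    have h1 : ∀ v, pr (fun z => (Lk H v z ↔ P z)) ≤ (if Adj q b H x v then 1 else 0) + (2 * b + 2 * γ) := by
      intro v
      by_cases ha : Adj q b H x v
      · simp only [ha, if_true]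
        have := pr_le_one (fun z => (Lk H v z ↔ P z))
        linarith
      · simp only [ha, if_false, zero_add]
        unfold Adj at ha
        push Not at ha
        have h2 : pr (fun z => (Lk H v z ↔ P z)) ≤ pr (fun z => Lk H v z ∧ P z) + pr (fun z => ¬ Lk H v z ∧ ¬ P z) := by
          refine le_trans (pr_mono ?_) (pr_or_le _ _)
          intro z hz
          tauto
        have h3 := incl v
        rw [hcomm] at h3 h2
        have := hdeg v
        linarith
    refine (av_mono h1).trans ?_
    rw [av_add, av_const]
    have : av (fun v => if Adj q b H x v then (1:ℝ) else 0) = pr (fun v => Adj q b H x v) := rfl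
    rw [this]; linarith
  have hstep : ∀ i : ℕ, i ≤ q → pr (fun x' : Fin q ⊕ Fin q → V => ¬ (P (hyb 0 x') ↔ P (hyb i x'))) ≤ 2 * i * κ := by
    intro i
    induction i with
    | zero => intro _; simp [pr_false]
    | succ i ih =>
      intro hi
      have h1 := ih (by omega)
      let j : Fin q := ⟨i, by omega⟩
      have e1 := pr_hyb (V := V) (fun v z => (Lk H v z ↔ P z)) j (Sum.inr j) i (Or.inl ⟨rfl, rfl⟩)
      have e2 := pr_hyb (V := V) (fun v z => (Lk H v z ↔ P z)) j (Sum.inl j) (i+1) (Or.inr ⟨rfl, rfl⟩)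
      have h3 : pr (fun x' : Fin q ⊕ Fin q → V => ¬ (P (hyb 0 x') ↔ P (hyb (i+1) x'))) ≤
        pr (fun x' : Fin q ⊕ Fin q → V => ¬ (P (hyb 0 x') ↔ P (hyb i x'))) +
        (pr (fun x' : Fin q ⊕ Fin q → V => (Lk H (x' (Sum.inr j)) (hyb i x') ↔ P (hyb i x'))) +
        pr (fun x' : Fin q ⊕ Fin q → V => (Lk H (x' (Sum.inl j)) (hyb (i+1) x') ↔ P (hyb (i+1) x')))) := by
        refine le_trans (pr_mono ?_) ((pr_or_le _ _).trans (add_le_add le_rfl (pr_or_le _ _)))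
        intro x' hx'
        have : Lk H (x' (Sum.inr j)) (hyb i x') ↔ Lk H (x' (Sum.inl j)) (hyb (i+1) x') := by
          unfold Lk
          rw [show insert (x' (Sum.inr j)) (univ.image (hyb i x')) = _ from hyb_insert x' j]
        tauto
      rw [e1, e2] at h3
      push_cast
      linarith
  have hlast := hstep q le_rfl
  have e0 : ∀ x' : Fin q ⊕ Fin q → V, hyb 0 x' = fun j => x' (Sum.inl j) := by intro x'; ext j; simp [hyb]
  have eq' : ∀ x' : Fin q ⊕ Fin q → V, hyb q x' = fun j => x' (Sum.inr j) := by intro x'; ext j; simp [hyb]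
  simp only [e0, eq'] at hlast
  have hind : pr (fun x' : Fin q ⊕ Fin q → V => ¬ (P (fun j => x' (Sum.inl j)) ↔ P (fun j => x' (Sum.inr j)))) = 2 * p * (1 - p) := by
    rw [← pr_sumElim]
    simp only [Sum.elim_inl, Sum.elim_inr]
    have h1 : ∀ a : Fin q → V, pr (fun b : Fin q → V => ¬ (P a ↔ P b)) = (if P a then (1:ℝ) else 0) * (1 - 2 * p) + p := by
      intro a
      by_cases ha : P a
      · simp only [ha, true_iff, if_true]; rw [pr_not, ← hp]; ring
      · simp only [ha, false_iff, not_not, if_false]; rw [← show p = pr (fun b => P b) from rfl]; ring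
    simp only [h1]
    rw [av_add, av_mul_right, av_const]
    have : av (fun a => if P a then (1:ℝ) else 0) = p := rfl
    rw [this]; ring
  rw [hind] at hlast
  have hκq : 2 * q * κ ≤ 1/5 := by rw [hκ]; nlinarith
  nlinarith

end graph
end PMH


namespace PMH
open Finset
open scoped Classical

section dichotomy
variable {V : Type} [Fintype V] [DecidableEq V] [Nonempty V]

/-- a graph with no independent triple and linear minimum degree is a robust
expander or splits in two cliquish parts -/
lemma dichotomy (R : V → V → Prop) (hsymm : ∀ u v, R u v → R v u)
    (h3 : ∀ u v w, R u v ∨ R u w ∨ R v w) {ζ : ℝ} (hζ : 0 < ζ)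
    (hdeg : ∀ x, ζ ≤ pr (fun v => R x v)) :
    ∃ A : Finset V, (∀ u v, (u ∈ A ↔ v ∈ A) →
        ζ^2/16 ≤ pr (fun p : V × V => R u p.1 ∧ R p.1 p.2 ∧ R p.2 v)) ∧
      (A = ∅ ∨ (ζ/2 ≤ pr (fun v => v ∈ A) ∧ ζ/2 ≤ pr (fun v => v ∉ A))) := by
  obtain ⟨s, hs⟩ : ∃ s, s = ζ/4 := ⟨_, rfl⟩
  have hs0 : 0 < s := by rw [hs]; positivity
  by_cases hall : ∀ u v, ζ^2/16 ≤ pr (fun p : V × V => R u p.1 ∧ R p.1 p.2 ∧ R p.2 v)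
  · exact ⟨∅, fun u v _ => hall u v, Or.inl rfl⟩
  push Not at hall
  obtain ⟨x, y, hxy⟩ := hall
  have hxy' : pr (fun p : V × V => R x p.1 ∧ R p.1 p.2 ∧ R p.2 y) < s^2 := by
    refine hxy.trans_eq ?_; rw [hs]; ring
  have hxy'' : pr (fun p : V × V => R y p.1 ∧ R p.1 p.2 ∧ R p.2 x) < s^2 := by
    refine lt_of_eq_of_lt ?_ hxy'
    refine Eq.trans ?_ (pr_equiv (Equiv.prodComm V V) _)
    apply pr_congr
    rintro ⟨a, b⟩
    simp only [Equiv.prodComm_apply, Prod.swap]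
    exact ⟨fun h => ⟨hsymm _ _ h.2.2, hsymm _ _ h.2.1, hsymm _ _ h.1⟩, fun h => ⟨hsymm _ _ h.2.2, hsymm _ _ h.2.1, hsymm _ _ h.1⟩⟩
  -- generic facts about C1 with the roles of x and y
  let C : V → V → V → Prop := fun x y a => R x a ∧ pr (fun b => R y b ∧ R a b) < s
  have hCsize : ∀ x y, pr (fun p : V × V => R x p.1 ∧ R p.1 p.2 ∧ R p.2 y) < s^2 → 3 * s ≤ pr (C x y) := by
    intro x y h
    have h1 := pr_and_not (fun a => R x a) (fun a => pr (fun b => R y b ∧ R a b) < s)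
    have h2 : pr (fun a => R x a ∧ ¬ pr (fun b => R y b ∧ R a b) < s) * s ≤ s^2 := by
      refine le_trans (pr_prod_ge (P := fun a => R x a ∧ ¬ pr (fun b => R y b ∧ R a b) < s)
        (Q := fun a b => R y b ∧ R a b) hs0.le le_rfl ?_) (le_trans (pr_mono ?_) h.le)
      · intro a ha
        exact not_lt.1 ha.2
      · rintro ⟨a, b⟩ ⟨⟨h1, h2⟩, h3, h4⟩
        exact ⟨h1, h4, hsymm _ _ h3⟩
    have h3 : pr (fun a => R x a ∧ ¬ pr (fun b => R y b ∧ R a b) < s) ≤ s := by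
      refine le_of_mul_le_mul_right (h2.trans_eq (sq s)) hs0
    have := hdeg x
    change 3 * s ≤ pr (fun a => R x a ∧ pr (fun b => R y b ∧ R a b) < s)
    linarith
  have hCclique : ∀ x y a a', C x y a → C x y a' → R a a' := by
    intro x y a a' ha ha'
    by_contra hn
    have h1 : pr (fun b => R y b) ≤ pr (fun b => R y b ∧ R a b) + pr (fun b => R y b ∧ R a' b) := by
      refine le_trans (pr_mono ?_) (pr_or_le _ _)
      intro b hb
      rcases h3 a a' b with h | h | h
      · exact absurd h hn
      · exact Or.inl ⟨hb, h⟩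
      · exact Or.inr ⟨hb, h⟩
    have := hdeg y
    have := ha.2
    have := ha'.2
    linarith
  let m : V → V → V → ℝ := fun x y z => pr (fun a => C x y a ∧ ¬ R z a)
  have hm : ∀ z, m x y z < s ∨ m y x z < s := by
    intro z
    by_contra hn
    push Not at hn
    have h1 : m x y z * m y x z ≤ pr (fun p : V × V => R x p.1 ∧ R p.1 p.2 ∧ R p.2 y) := by
      rw [← pr_prod_indep]
      apply pr_mono
      rintro ⟨a, b⟩ ⟨⟨h1, h2⟩, h4, h5⟩
      refine ⟨h1.1, ?_, hsymm _ _ h4.1⟩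
      rcases h3 z a b with h | h | h
      · exact absurd h h2
      · exact absurd h h5
      · exact h
    have : s * s ≤ m x y z * m y x z := mul_le_mul hn.1 hn.2 hs0.le (hs0.le.trans hn.1)
    nlinarith
  have hwalk : ∀ x y u v, 3 * s ≤ pr (C x y) → m x y u ≤ s → m x y v ≤ s →
      ζ^2/16 ≤ pr (fun p : V × V => R u p.1 ∧ R p.1 p.2 ∧ R p.2 v) := by
    intro x y u v hc hu hv
    have hu' : 2 * s ≤ pr (fun a => C x y a ∧ R u a) := by
      have := pr_and_not (C x y) (fun a => R u a)
      simp only [m] at hu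
      linarith
    have hv' : 2 * s ≤ pr (fun a => C x y a ∧ R v a) := by
      have := pr_and_not (C x y) (fun a => R v a)
      simp only [m] at hv
      linarith
    have h1 : (2*s)*(2*s) ≤ pr (fun a => C x y a ∧ R u a) * pr (fun a => C x y a ∧ R v a) :=
      mul_le_mul hu' hv' (by positivity) (pr_nonneg _)
    rw [← pr_prod_indep] at h1
    refine le_trans (le_trans ?_ h1) (pr_mono ?_)
    · rw [hs]; nlinarith [sq_nonneg ζ]
    · rintro ⟨a, b⟩ ⟨⟨h1, h2⟩, h4, h5⟩
      exact ⟨h2, hCclique x y a b h1 h4, hsymm _ _ h5⟩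
  have hC1 := hCsize x y hxy'
  have hC2 := hCsize y x hxy''
  refine ⟨univ.filter (fun z => m x y z ≤ s), ?_, Or.inr ⟨?_, ?_⟩⟩
  · intro u v huv
    simp only [mem_filter, mem_univ, true_and] at huv
    by_cases hu : m x y u ≤ s
    · exact hwalk x y u v hC1 hu (huv.1 hu)
    · have hv := fun h => hu (huv.2 h)
      exact hwalk y x u v hC2 ((hm u).resolve_left fun h => hu h.le).le ((hm v).resolve_left fun h => hv h.le).le
  · have : pr (C x y) ≤ pr (fun v => v ∈ univ.filter (fun z => m x y z ≤ s)) := by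
      apply pr_mono
      intro a ha
      simp only [mem_filter, mem_univ, true_and, m]
      refine le_trans (le_of_eq ?_) hs0.le
      rw [← pr_false (Ω := V)]
      apply pr_congr
      intro b
      simp only [iff_false, not_and, not_not]
      exact fun hb => hCclique x y a b ha hb
    linarith
  · have : pr (C y x) ≤ pr (fun v => v ∉ univ.filter (fun z => m x y z ≤ s)) := by
      apply pr_mono
      intro b hb
      simp only [mem_filter, mem_univ, true_and, m, not_le]
      have h1 := pr_and_not (C x y) (fun a => R b a)
      have h2 : pr (fun a => C x y a ∧ R b a) ≤ pr (fun a => R x a ∧ R b a) :=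
        pr_mono fun a h => ⟨h.1.1, h.2⟩
      have := hb.2
      linarith
    linarith
end dichotomy

end PMH


namespace PMH
open Finset
open scoped Classical

/-- `S` can be perfectly matched -/
def PM {V : Type} [DecidableEq V] (H : Finset (Finset V)) (S : Finset V) : Prop :=
  ∃ M ⊆ H, (M : Set (Finset V)).PairwiseDisjoint id ∧ M.biUnion id = S

section pm
variable {V : Type} [DecidableEq V] {H : Finset (Finset V)}

lemma PM.edge {e : Finset V} (he : e ∈ H) : PM H e :=
  ⟨{e}, by simpa using he, by simp, by simp⟩

lemma PM.empty : PM H ∅ := ⟨∅, by simp, by simp, by simp⟩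

lemma PM.mono {H' : Finset (Finset V)} (h : H ⊆ H') {S : Finset V} (hS : PM H S) : PM H' S := by
  obtain ⟨M, h1, h2, h3⟩ := hS
  exact ⟨M, h1.trans h, h2, h3⟩

lemma PM.biUnion {ι : Type*} [DecidableEq ι] (s : Finset ι) (f : ι → Finset V) (hf : ∀ i ∈ s, PM H (f i))
    (hd : (s : Set ι).PairwiseDisjoint f) : PM H (s.biUnion f) := by
  choose! M h1 h2 h3 using hf
  refine ⟨s.biUnion M, ?_, ?_, ?_⟩
  · exact biUnion_subset.2 h1
  · intro e he e' he' hne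
    simp only [coe_biUnion, Set.mem_iUnion, mem_coe] at he he'
    obtain ⟨i, hi, hei⟩ := he
    obtain ⟨j, hj, hej⟩ := he'
    by_cases hij : i = j
    · subst hij
      exact h2 i hi hei hej hne
    · have := hd hi hj hij
      refine Disjoint.mono ?_ ?_ this
      · rw [← h3 i hi]; exact subset_biUnion_of_mem id hei
      · rw [← h3 j hj]; exact subset_biUnion_of_mem id hej
  · rw [biUnion_biUnion]
    exact biUnion_congr rfl fun i hi => h3 i hi

lemma PM.union {S T : Finset V} (hS : PM H S) (hT : PM H T) (hd : Disjoint S T) : PM H (S ∪ T) := by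
  have := PM.biUnion (H := H) (univ : Finset Bool) (fun b => if b then S else T) (by intro b _; cases b <;> simpa)
    (by intro b _ c _ hbc; cases b <;> cases c <;> simp_all [Function.onFun, disjoint_comm])
  simpa using this

lemma PM.label {X I : Type*} [Fintype X] [Fintype I] [DecidableEq I] (φ : X → V) (hφ : Function.Injective φ)
    (l : X → I) (h : ∀ i, PM H ((univ.filter fun x => l x = i).image φ)) : PM H (univ.image φ) := by
  have := PM.biUnion (H := H) (univ : Finset I) (fun i => (univ.filter fun x => l x = i).image φ) (fun i _ => h i) (by
    intro i _ j _ hij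
    simp only [Function.onFun]
    rw [disjoint_image hφ, disjoint_left]
    simp only [mem_filter, mem_univ, true_and]
    rintro x rfl
    exact hij)
  convert this using 1
  ext v; simp

end pm

/-- index set for swapping gadgets -/
abbrev SW (q : ℕ) := Fin 2 ⊕ (Fin 3 × Fin q)

section swap
variable {V : Type} [Fintype V] [DecidableEq V] {q : ℕ}

/-- a swapping gadget for `u`,`v` -/
def swapOK (H : Finset (Finset V)) (u v : V) (T : SW q → V) : Prop :=
  (Lk H u (fun c => T (Sum.inr (0, c))) ∧ Lk H (T (Sum.inl 0)) (fun c => T (Sum.inr (0, c)))) ∧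
  (Lk H (T (Sum.inl 0)) (fun c => T (Sum.inr (1, c))) ∧ Lk H (T (Sum.inl 1)) (fun c => T (Sum.inr (1, c)))) ∧
  (Lk H (T (Sum.inl 1)) (fun c => T (Sum.inr (2, c))) ∧ Lk H v (fun c => T (Sum.inr (2, c))))

omit [Fintype V] in
lemma swap_pm_left {H : Finset (Finset V)} {u v : V} {T : SW q → V} (h : swapOK H u v T)
    (hinj : Function.Injective T) (hu : ∀ x, T x ≠ u) : PM H (insert u (univ.image T)) := by
  have hφ : Function.Injective (fun o : Option (SW q) => o.elim u T) := by
    intro a b hab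
    rcases a with _ | a <;> rcases b with _ | b
    · rfl
    · exact absurd hab.symm (hu b)
    · exact absurd hab (hu a)
    · exact congrArg some (hinj hab)
  have := PM.label (H := H) (fun o : Option (SW q) => o.elim u T) hφ
    (fun o => o.elim (0 : Fin 3) (Sum.elim (fun i => if i = 0 then 1 else 2) (fun p => p.1))) (by
    intro i
    apply PM.edge
    obtain ⟨⟨h1, h2⟩, ⟨h3, h4⟩, h5, h6⟩ := h
    unfold Lk at *
    fin_cases i
    · convert h1 using 1
      ext w
      simp [Option.exists, Prod.exists]
      grind
    · convert h3 using 1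
      ext w
      simp [Option.exists, Prod.exists, eq_comm]
    · convert h5 using 1
      ext w
      simp [Option.exists, Prod.exists, eq_comm])
  convert this using 1
  ext w
  simp [Option.exists, eq_comm]

omit [Fintype V] in
lemma swap_pm_right {H : Finset (Finset V)} {u v : V} {T : SW q → V} (h : swapOK H u v T)
    (hinj : Function.Injective T) (hu : ∀ x, T x ≠ v) : PM H (insert v (univ.image T)) := by
  have hφ : Function.Injective (fun o : Option (SW q) => o.elim v T) := by
    intro a b hab
    rcases a with _ | a <;> rcases b with _ | b
    · rfl
    · exact absurd hab.symm (hu b)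
    · exact absurd hab (hu a)
    · exact congrArg some (hinj hab)
  have := PM.label (H := H) (fun o : Option (SW q) => o.elim v T) hφ
    (fun o => o.elim (2 : Fin 3) (Sum.elim (fun i => if i = 0 then 0 else 1) (fun p => p.1))) (by
    intro i
    apply PM.edge
    obtain ⟨⟨h1, h2⟩, ⟨h3, h4⟩, h5, h6⟩ := h
    unfold Lk at *
    fin_cases i
    · convert h2 using 1
      ext w
      simp [Option.exists, Prod.exists, eq_comm]
    · convert h4 using 1
      ext w
      simp [Option.exists, Prod.exists, eq_comm]
    · convert h6 using 1
      ext w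
      simp [Option.exists, Prod.exists]
      grind)
  convert this using 1
  ext w
  simp [Option.exists, eq_comm]

lemma swap_density [Nonempty V] {H : Finset (Finset V)} {u v : V} {b w : ℝ} (hb : 0 ≤ b)
    (hw : w ≤ pr (fun p : V × V => Adj q b H u p.1 ∧ Adj q b H p.1 p.2 ∧ Adj q b H p.2 v)) :
    w * b^3 ≤ pr (fun T : SW q → V => swapOK H u v T) := by
  rw [← pr_sumElim]
  have h1 : w ≤ pr (fun a : Fin 2 → V => Adj q b H u (a 0) ∧ Adj q b H (a 0) (a 1) ∧ Adj q b H (a 1) v) := by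
    refine hw.trans (le_of_eq ?_)
    exact (pr_equiv (finTwoArrowEquiv V) (fun p : V × V => Adj q b H u p.1 ∧ Adj q b H p.1 p.2 ∧ Adj q b H p.2 v)).symm
  have h2 := pr_prod_ge (Ω' := Fin 3 × Fin q → V) (q := b^3)
    (P := fun a : Fin 2 → V => Adj q b H u (a 0) ∧ Adj q b H (a 0) (a 1) ∧ Adj q b H (a 1) v)
    (Q := fun a T => swapOK H u v (Sum.elim a T)) (by positivity) h1 (by
      intro a ⟨h1, h2, h3⟩
      unfold Adj at h1 h2 h3
      have e1 := pr_equiv (Equiv.curry (Fin 3) (Fin q) V) (fun S => ∀ i, (![fun z => Lk H u z ∧ Lk H (a 0) z,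
        fun z => Lk H (a 0) z ∧ Lk H (a 1) z, fun z => Lk H (a 1) z ∧ Lk H v z] i) (S i))
      rw [pr_pi, Fin.prod_univ_three] at e1
      have : b^3 ≤ pr (fun z : Fin q → V => Lk H u z ∧ Lk H (a 0) z) * pr (fun z : Fin q → V => Lk H (a 0) z ∧ Lk H (a 1) z)
         * pr (fun z : Fin q → V => Lk H (a 1) z ∧ Lk H v z) := by
        rw [pow_three']
        exact mul_le_mul (mul_le_mul h1 h2 hb (pr_nonneg _)) h3 hb (mul_nonneg (pr_nonneg _) (pr_nonneg _))
      refine this.trans (e1.symm.le.trans (pr_mono ?_))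
      intro T hT
      exact ⟨hT 0, hT 1, hT 2⟩)
  refine h2.trans ?_
  rw [pr_prod (fun (a : Fin 2 → V) T => (Adj q b H u (a 0) ∧ Adj q b H (a 0) (a 1) ∧ Adj q b H (a 1) v) ∧
    swapOK H u v (Sum.elim a T))]
  apply av_mono
  intro a
  exact pr_mono fun T h => h.2
end swap
end PMH


namespace PMH
open Finset
open scoped Classical

/-- `g` is an absorber for `Q` -/
def absorbs {V : Type} [DecidableEq V] {J : Type} [Fintype J] (H : Finset (Finset V)) (g : J → V) (Q : Finset V) : Prop :=
  Function.Injective g ∧ Disjoint (univ.image g) Q ∧ PM H (univ.image g) ∧ PM H (univ.image g ∪ Q)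

/-- positive part of the absorber -/
abbrev PP (q : ℕ) := Fin (2*(q+1)+2) × Fin (q+1)
/-- negative part of the absorber -/
abbrev NN (q : ℕ) := Fin (2*(q+1)) × Fin (q+1)
/-- index set of an absorber -/
abbrev JJ (q : ℕ) := (PP q ⊕ NN q) ⊕ (PP q × SW q)

/-- an edge of given pattern -/
def edgePat {V : Type} [DecidableEq V] {k : ℕ} (H : Finset (Finset V)) (A : Finset V) (j : ℕ) (e : Fin k → V) : Prop :=
  univ.image e ∈ H ∧ ∀ c, (e c ∈ A ↔ c.val < j)

lemma exists_type_equiv {X Y : Type} [Fintype X] [Fintype Y] (p : X → Prop) (r : Y → Prop) [DecidablePred p] [DecidablePred r]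
    (h : Fintype.card X = Fintype.card Y)
    (h' : (univ.filter p).card = (univ.filter r).card) : ∃ θ : X ≃ Y, ∀ x, p x ↔ r (θ x) := by
  have e1 : Fintype.card {x // p x} = Fintype.card {y // r y} := by
    rw [Fintype.card_subtype, Fintype.card_subtype, h']
  have e2 : Fintype.card {x // ¬ p x} = Fintype.card {y // ¬ r y} := by
    rw [Fintype.card_subtype_compl, Fintype.card_subtype_compl, h, e1]
  let f1 := Fintype.equivOfCardEq e1
  let f2 := Fintype.equivOfCardEq e2
  refine ⟨(Equiv.sumCompl p).symm.trans ((Equiv.sumCongr f1 f2).trans (Equiv.sumCompl r)), ?_⟩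
  intro x
  by_cases hx : p x
  · simp [Equiv.sumCompl_symm_apply_of_pos hx, hx, (f1 ⟨x, hx⟩).2]
  · simp [Equiv.sumCompl_symm_apply_of_neg hx, hx, (f2 ⟨x, hx⟩).2]

section absorber
variable {V : Type} [Fintype V] [DecidableEq V] {q : ℕ}

omit [Fintype V] in
lemma absorber_valid {H : Finset (Finset V)} {Q : Finset V} (t : Fin (2*(q+1)) → V) (ht : Function.Injective t)
    (htQ : univ.image t = Q) (θ : PP q ≃ Fin (2*(q+1)) ⊕ NN q) (g : JJ q → V)
    (hpos : ∀ i, univ.image (fun c => g (Sum.inl (Sum.inl (i, c)))) ∈ H)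
    (hneg : ∀ i, univ.image (fun c => g (Sum.inl (Sum.inr (i, c)))) ∈ H)
    (hsw : ∀ p, swapOK H (g (Sum.inl (Sum.inl p))) (Sum.elim t (fun y => g (Sum.inl (Sum.inr y))) (θ p))
      (fun s => g (Sum.inr (p, s))))
    (hinj : Function.Injective g) (hd : ∀ x, g x ∉ Q) : absorbs H g Q := by
  refine ⟨hinj, ?_, ?_, ?_⟩
  · rw [disjoint_left]; intro v hv
    obtain ⟨x, -, rfl⟩ := mem_image.1 hv
    exact hd x
  · apply PM.label g hinj (I := Fin (2*(q+1)) ⊕ PP q)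
      (Sum.elim (Sum.elim (fun p => Sum.inr p) (fun y => Sum.inl y.1)) (fun p => Sum.inr p.1))
    rintro (i | p)
    · apply PM.edge
      convert hneg i using 1
      ext v
      simp only [mem_image, mem_filter, mem_univ, true_and, Sum.exists, Sum.elim_inl, Sum.elim_inr, reduceCtorEq,
        false_and, exists_false, false_or, or_false, Sum.inl.injEq]
      constructor
      · rintro ⟨⟨a, c⟩, rfl, h⟩; exact ⟨c, h⟩
      · rintro ⟨c, h⟩; exact ⟨(i, c), rfl, h⟩
    · convert swap_pm_left (hsw p) ?_ ?_ using 1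
      · ext v
        simp only [mem_image, mem_filter, mem_univ, true_and, Sum.exists, Sum.elim_inl, Sum.elim_inr, reduceCtorEq,
          false_and, exists_false, or_false, Sum.inr.injEq, mem_insert, exists_eq_left, Prod.exists]
        grind
      · intro a b hab
        have := hinj hab
        simpa using this
      · intro x hx
        have := hinj hx
        simp at this
  · have hinj2 : Function.Injective (Sum.elim g t) := by
      rintro (a | a) (b | b) hab
      · exact congrArg _ (hinj hab)
      · exact absurd (by rw [← htQ]; exact mem_image.2 ⟨b, mem_univ _, hab.symm⟩) (hd a)
      · exact absurd (by rw [← htQ]; exact mem_image.2 ⟨a, mem_univ _, hab⟩) (hd b)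
      · exact congrArg _ (ht hab)
    have := PM.label (H := H) (Sum.elim g t) hinj2 (I := Fin (2*(q+1)+2) ⊕ PP q)
      (Sum.elim (Sum.elim (Sum.elim (fun p => Sum.inl p.1) (fun y => Sum.inr (θ.symm (Sum.inr y)))) (fun p => Sum.inr p.1))
        (fun i => Sum.inr (θ.symm (Sum.inl i)))) (by
      rintro (i | p)
      · apply PM.edge
        convert hpos i using 1
        ext v
        simp only [mem_image, mem_filter, mem_univ, true_and, Sum.exists, Sum.elim_inl, Sum.elim_inr, reduceCtorEq,
          false_and, exists_false, or_false, Sum.inl.injEq]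
        constructor
        · rintro ⟨⟨a, c⟩, rfl, h⟩; exact ⟨c, h⟩
        · rintro ⟨c, h⟩; exact ⟨(i, c), rfl, h⟩
      · convert swap_pm_right (hsw p) ?_ ?_ using 1
        · ext v
          simp only [mem_image, mem_filter, mem_univ, true_and, Sum.exists, Sum.elim_inl, Sum.elim_inr, reduceCtorEq,
            false_and, exists_false, false_or, Sum.inr.injEq, mem_insert, Equiv.symm_apply_eq]
          constructor
          · rintro ((⟨y, h1, h2⟩ | ⟨⟨p', s⟩, rfl, h2⟩) | ⟨i, h1, h2⟩)
            · left; rw [← h1]; exact h2.symm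
            · right
              rcases s with s | s
              · exact Or.inl ⟨s, h2⟩
              · exact Or.inr ⟨s, h2⟩
            · left; rw [← h1]; exact h2.symm
          · rintro (h | ⟨s, h⟩ | ⟨s, h⟩)
            · rcases hθ : θ p with i | y
              · right; rw [hθ] at h; exact ⟨i, rfl, h.symm⟩
              · left; left; rw [hθ] at h; exact ⟨y, rfl, h.symm⟩
            · left; right; exact ⟨(p, Sum.inl s), rfl, h⟩
            · left; right; exact ⟨(p, Sum.inr s), rfl, h⟩
        · intro a b hab
          have := hinj hab
          simpa using this
        · intro x hx
          rcases hθ : θ p with i | y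
          · rw [hθ] at hx
            have := hinj2 (a₁ := Sum.inl (Sum.inr (p, x))) (a₂ := Sum.inr i) hx
            simp at this
          · rw [hθ] at hx
            have := hinj hx
            simp at this)
    convert this using 1
    rw [← htQ]
    ext v
    simp only [mem_union, mem_image, mem_univ, true_and, Sum.exists, Sum.elim_inl, Sum.elim_inr]

lemma card_pat {m k : ℕ} (f : Fin m → ℕ) (hf : ∀ i, f i ≤ k) :
    (univ.filter (fun p : Fin m × Fin k => p.2.val < f p.1)).card = ∑ i, f i := by
  rw [card_filter, Fintype.sum_prod_type]
  apply sum_congr rfl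
  intro i _
  rw [← card_filter]
  have := hf i
  have e := Fin.card_filter_val_lt (n := k) (m := f i)
  simp only at e ⊢
  omega

lemma absorber_density [Nonempty V] {H : Finset (Finset V)} {A Q : Finset V} {τ σ : ℝ} (hτ : 0 ≤ τ) (hσ : 0 ≤ σ)
    (hsw : ∀ u v, (u ∈ A ↔ v ∈ A) → σ ≤ pr (fun T : SW q → V => swapOK H u v T))
    (hQ : Q.card = 2*(q+1)) (pos : Fin (2*(q+1)+2) → ℕ) (neg : Fin (2*(q+1)) → ℕ)
    (hpk : ∀ i, pos i ≤ q+1) (hnk : ∀ i, neg i ≤ q+1)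
    (hpos : ∀ i, τ ≤ pr (fun e : Fin (q+1) → V => edgePat H A (pos i) e))
    (hneg : ∀ i, τ ≤ pr (fun e : Fin (q+1) → V => edgePat H A (neg i) e))
    (hsum : ∑ i, pos i = (Q ∩ A).card + ∑ i, neg i) :
    τ^(2*(q+1)+2) * τ^(2*(q+1)) * σ^(Fintype.card (PP q)) -
      (Fintype.card (JJ q) : ℝ)^2 / Fintype.card V - (Fintype.card (JJ q) : ℝ) * (2*(q+1)) / Fintype.card V ≤
    pr (fun g : JJ q → V => absorbs H g Q) := by
  obtain ⟨t, ht, htQ⟩ : ∃ t : Fin (2*(q+1)) → V, Function.Injective t ∧ univ.image t = Q := by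
    refine ⟨fun i => ((Q.equivFinOfCardEq hQ).symm i : V), ?_, ?_⟩
    · exact Subtype.val_injective.comp (Q.equivFinOfCardEq hQ).symm.injective
    · ext v
      simp only [mem_image, mem_univ, true_and]
      constructor
      · rintro ⟨i, rfl⟩; exact ((Q.equivFinOfCardEq hQ).symm i).2
      · intro hv; exact ⟨Q.equivFinOfCardEq hQ ⟨v, hv⟩, by simp⟩
  obtain ⟨θ, hθ⟩ := exists_type_equiv (X := PP q) (Y := Fin (2*(q+1)) ⊕ NN q)
    (fun p => p.2.val < pos p.1) (Sum.elim (fun i => t i ∈ A) (fun y => y.2.val < neg y.1))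
    (by simp; ring) (by
      refine Eq.trans (by convert card_pat pos hpk) ?_
      rw [hsum, ← card_pat _ hnk]
      rw [card_filter _ (univ : Finset (Fin (2*(q+1)) ⊕ NN q)), Fintype.sum_sum_type]
      refine congrArg₂ (· + ·) ?_ (by
        rw [card_filter]; exact sum_congr rfl fun y _ => by by_cases h : y.2.val < neg y.1 <;> simp [h])
      refine Eq.trans ?_ (show (univ.filter (fun i => t i ∈ A)).card = _ by
        rw [card_filter]; exact sum_congr rfl fun y _ => by by_cases h : t y ∈ A <;> simp [h])
      rw [← card_image_of_injective _ ht]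
      congr 1
      ext v
      rw [← htQ]
      simp only [mem_inter, mem_image, mem_filter, mem_univ, true_and]
      grind)
  let F : (PP q ⊕ NN q → V) → Prop := fun x => (∀ i, edgePat H A (pos i) (fun c => x (Sum.inl (i, c)))) ∧
    (∀ i, edgePat H A (neg i) (fun c => x (Sum.inr (i, c))))
  let G : (PP q ⊕ NN q → V) → (PP q × SW q → V) → Prop := fun x T =>
    ∀ p, swapOK H (x (Sum.inl p)) (Sum.elim t (fun y => x (Sum.inr y)) (θ p)) (fun s => T (p, s))
  have h1 : τ^(2*(q+1)+2) * τ^(2*(q+1)) ≤ pr F := by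
    have e1 := pr_equiv (Equiv.sumArrowEquivProdArrow (PP q) (NN q) V) (fun x =>
      (∀ i, edgePat H A (pos i) (fun c => x.1 (i, c))) ∧ (∀ i, edgePat H A (neg i) (fun c => x.2 (i, c))))
    rw [pr_prod_indep (fun x : PP q → V => ∀ i, edgePat H A (pos i) (fun c => x (i, c)))
      (fun x : NN q → V => ∀ i, edgePat H A (neg i) (fun c => x (i, c)))] at e1
    have e2 := pr_equiv (Equiv.curry (Fin (2*(q+1)+2)) (Fin (q+1)) V) (fun x => ∀ i, edgePat H A (pos i) (x i))
    have e3 := pr_equiv (Equiv.curry (Fin (2*(q+1))) (Fin (q+1)) V) (fun x => ∀ i, edgePat H A (neg i) (x i))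
    rw [pr_pi] at e2 e3
    have e4 : τ^(2*(q+1)+2) ≤ ∏ i, pr (fun e : Fin (q+1) → V => edgePat H A (pos i) e) := by
      have := prod_le_prod (s := univ) (f := fun _ : Fin (2*(q+1)+2) => τ) (fun _ _ => hτ) (fun i _ => hpos i)
      simpa using this
    have e5 : τ^(2*(q+1)) ≤ ∏ i, pr (fun e : Fin (q+1) → V => edgePat H A (neg i) e) := by
      have := prod_le_prod (s := univ) (f := fun _ : Fin (2*(q+1)) => τ) (fun _ _ => hτ) (fun i _ => hneg i)
      simpa using this
    refine le_trans ?_ e1.symm.le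
    exact mul_le_mul (e4.trans e2.symm.le) (e5.trans e3.symm.le) (by positivity) (pr_nonneg _)
  have h2 : ∀ x, F x → σ^(Fintype.card (PP q)) ≤ pr (G x) := by
    intro x hx
    have e1 := pr_equiv (Equiv.curry (PP q) (SW q) V) (fun T => ∀ p,
      swapOK H (x (Sum.inl p)) (Sum.elim t (fun y => x (Sum.inr y)) (θ p)) (T p))
    rw [pr_pi] at e1
    refine le_trans ?_ e1.symm.le
    have := prod_le_prod (s := univ) (f := fun _ : PP q => σ)
      (g := fun p => pr (fun T : SW q → V => swapOK H (x (Sum.inl p)) (Sum.elim t (fun y => x (Sum.inr y)) (θ p)) T))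
      (fun _ _ => hσ) (fun p _ => by
      apply hsw
      rw [(hx.1 p.1).2 p.2, hθ p]
      rcases θ p with i | y
      · rfl
      · simp only [Sum.elim_inr]
        exact ((hx.2 y.1).2 y.2).symm)
    simpa using this
  have h3 := pr_prod_ge (by positivity) h1 h2
  have h4 : pr (fun x : (PP q ⊕ NN q → V) × (PP q × SW q → V) => F x.1 ∧ G x.1 x.2) =
      pr (fun g : JJ q → V => F (fun x => g (Sum.inl x)) ∧ G (fun x => g (Sum.inl x)) (fun x => g (Sum.inr x))) :=
    (pr_equiv (Equiv.sumArrowEquivProdArrow (PP q ⊕ NN q) (PP q × SW q) V)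
      (fun x : (PP q ⊕ NN q → V) × (PP q × SW q → V) => F x.1 ∧ G x.1 x.2)).symm
  rw [h4] at h3
  have h5 : pr (fun g : JJ q → V => F (fun x => g (Sum.inl x)) ∧ G (fun x => g (Sum.inl x)) (fun x => g (Sum.inr x))) ≤
      pr (fun g : JJ q → V => absorbs H g Q) + pr (fun g : JJ q → V => ¬ Function.Injective g) +
        pr (fun g : JJ q → V => ∃ i, g i ∈ Q) := by
    refine le_trans (pr_mono (Q := fun g => (absorbs H g Q ∨ ¬ Function.Injective g) ∨ ∃ i, g i ∈ Q) ?_)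
      ((pr_or_le _ _).trans (by gcongr; exact pr_or_le _ _))
    rintro g ⟨⟨hF1, hF2⟩, hG⟩
    by_cases hi : Function.Injective g
    · by_cases hm : ∃ i, g i ∈ Q
      · exact Or.inr hm
      · push Not at hm
        exact Or.inl (Or.inl (absorber_valid t ht htQ θ g (fun i => (hF1 i).1) (fun i => (hF2 i).1) hG hi hm))
    · exact Or.inl (Or.inr hi)
  have h6 := pr_not_inj_le (V := V) (κ := JJ q)
  have h7 := pr_meets_le (V := V) (κ := JJ q) Q
  rw [hQ] at h7
  push_cast at h7
  linarith
end absorber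
end PMH


namespace PMH
open Finset
open scoped Classical

section robust
variable {V : Type} [Fintype V] [DecidableEq V] [Nonempty V]

/-- number of coordinates lying in `A` -/
def cnt {k : ℕ} (A : Finset V) (e : Fin k → V) : ℕ := (univ.filter fun c => e c ∈ A).card

/-- pattern `j` is robust -/
def Rob (k : ℕ) (τ : ℝ) (H : Finset (Finset V)) (A : Finset V) (j : ℕ) : Prop :=
  τ ≤ pr (fun e : Fin k → V => edgePat H A j e)

omit [Fintype V] [Nonempty V] in
lemma cnt_le {k : ℕ} (A : Finset V) (e : Fin k → V) : cnt A e ≤ k := by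
  unfold cnt
  exact (card_le_univ _).trans (by simp)

lemma wrong_le {k : ℕ} {τ : ℝ} (hτ : 0 ≤ τ) (H : Finset (Finset V)) (A : Finset V) :
    pr (fun e : Fin k → V => univ.image e ∈ H ∧ ¬ Rob k τ H A (cnt A e)) ≤ 2^k * τ := by
  have h1 : pr (fun e : Fin k → V => univ.image e ∈ H ∧ ¬ Rob k τ H A (cnt A e)) ≤
      pr (fun e : Fin k → V => ∃ π : Fin k → Bool, univ.image e ∈ H ∧ ¬ Rob k τ H A (cnt A e) ∧ ∀ c, (e c ∈ A ↔ π c = true)) := by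
    apply pr_mono
    rintro e ⟨h1, h2⟩
    exact ⟨fun c => decide (e c ∈ A), h1, h2, fun c => by simp⟩
  refine h1.trans ((pr_exists_le _).trans ?_)
  have h2 : ∀ π : Fin k → Bool, pr (fun e : Fin k → V => univ.image e ∈ H ∧ ¬ Rob k τ H A (cnt A e) ∧
      ∀ c, (e c ∈ A ↔ π c = true)) ≤ τ := by
    intro π
    obtain ⟨m, hm⟩ : ∃ m, m = (univ.filter fun c => π c = true).card := ⟨_, rfl⟩
    have hmk : m ≤ k := by rw [hm]; exact (card_le_univ _).trans (by simp)
    have hcnt : ∀ e : Fin k → V, (∀ c, (e c ∈ A ↔ π c = true)) → cnt A e = m := by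
      intro e he
      rw [hm]; unfold cnt
      congr 1; ext c; simp [he c]
    by_cases hR : Rob k τ H A m
    · refine le_trans (le_of_eq ?_) hτ
      rw [← pr_false (Ω := Fin k → V)]
      apply pr_congr
      intro e
      simp only [iff_false]
      rintro ⟨_, h2, h3⟩
      rw [hcnt e h3] at h2
      exact h2 hR
    · obtain ⟨σ, hσ⟩ := exists_type_equiv (X := Fin k) (Y := Fin k) (fun c => c.val < m) (fun c => π c = true) rfl (by
        rw [← hm]
        have e := Fin.card_filter_val_lt (n := k) (m := m)
        omega)
      unfold Rob at hR
      refine le_trans ?_ (not_le.1 hR).le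
      rw [← pr_comp_inj (V := V) σ σ.injective (fun e => edgePat H A m e)]
      apply pr_mono
      rintro e ⟨h1, h2, h3⟩
      refine ⟨?_, fun c => ?_⟩
      · convert h1 using 1
        ext v
        simp only [mem_image, mem_univ, true_and]
        constructor
        · rintro ⟨c, h⟩; exact ⟨σ c, h⟩
        · rintro ⟨c, h⟩; exact ⟨σ.symm c, by simpa using h⟩
      · rw [h3, hσ]
  refine (sum_le_sum fun π _ => h2 π).trans ?_
  simp

omit [Nonempty V] in
lemma pr_cons {m : ℕ} (P : (Fin (m+1) → V) → Prop) :
    pr (fun x : V × (Fin m → V) => P (Fin.cons x.1 x.2)) = pr P :=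
  pr_equiv (Fin.consEquiv (fun _ : Fin (m+1) => V)) P

omit [Fintype V] [Nonempty V] in
lemma image_cons {m : ℕ} (v : V) (z : Fin m → V) : univ.image (Fin.cons v z : Fin (m+1) → V) = insert v (univ.image z) := by
  ext w
  simp [Fin.exists_fin_succ, eq_comm]

omit [Fintype V] [Nonempty V] in
lemma cnt_cons {m : ℕ} (A : Finset V) (v : V) (z : Fin m → V) :
    cnt A (Fin.cons v z : Fin (m+1) → V) = (if v ∈ A then 1 else 0) + cnt A z := by
  unfold cnt
  rw [card_filter, Fin.sum_univ_succ, card_filter]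
  simp only [Fin.cons_zero, Fin.cons_succ]

lemma robust_half {q : ℕ} {γ τ ρ : ℝ} (hτ : 0 ≤ τ) (hρ : 0 < ρ) {H : Finset (Finset V)} (A B : Finset V) (i : ℕ)
    (hB : ∀ v ∈ B, (if v ∈ A then 1 else 0) = i)
    (hdeg : ∀ v, 1/2 - γ ≤ pr (fun z : Fin q → V => Lk H v z)) (hBρ : ρ ≤ pr (fun v => v ∈ B)) :
    1/2 - γ - 2^(q+1) * τ / ρ ≤ pr (fun z : Fin q → V => Rob (q+1) τ H A (i + cnt A z)) := by
  have h1 : pr (fun v => v ∈ B) * (1/2 - γ) ≤ pr (fun x : V × (Fin q → V) => x.1 ∈ B ∧ Lk H x.1 x.2) := by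
    by_cases h0 : 0 ≤ 1/2 - γ
    · exact pr_prod_ge h0 le_rfl fun v _ => hdeg v
    · exact (mul_nonpos_of_nonneg_of_nonpos (pr_nonneg _) (not_le.1 h0).le).trans (pr_nonneg _)
  have h2 : pr (fun x : V × (Fin q → V) => x.1 ∈ B ∧ Lk H x.1 x.2) ≤
      pr (fun x : V × (Fin q → V) => x.1 ∈ B ∧ Rob (q+1) τ H A (i + cnt A x.2)) +
      pr (fun x : V × (Fin q → V) => univ.image (Fin.cons x.1 x.2 : Fin (q+1) → V) ∈ H ∧
        ¬ Rob (q+1) τ H A (cnt A (Fin.cons x.1 x.2 : Fin (q+1) → V))) := by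
    refine le_trans (pr_mono ?_) (pr_or_le _ _)
    rintro ⟨v, z⟩ ⟨hv, hz⟩
    simp only at hv hz ⊢
    by_cases hR : Rob (q+1) τ H A (i + cnt A z)
    · exact Or.inl ⟨hv, hR⟩
    · right
      rw [image_cons, cnt_cons, hB v hv]
      exact ⟨hz, hR⟩
  rw [pr_cons (fun e => univ.image e ∈ H ∧ ¬ Rob (q+1) τ H A (cnt A e)),
    pr_prod_indep (fun v => v ∈ B) (fun z => Rob (q+1) τ H A (i + cnt A z))] at h2
  have h3 := wrong_le (k := q+1) hτ H A
  have h4 : pr (fun v => v ∈ B) * (1/2 - γ - pr (fun z : Fin q → V => Rob (q+1) τ H A (i + cnt A z))) ≤ 2^(q+1) * τ := by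
    nlinarith
  have h5 : 1/2 - γ - pr (fun z : Fin q → V => Rob (q+1) τ H A (i + cnt A z)) ≤ 2^(q+1) * τ / ρ := by
    by_cases h0 : 0 ≤ 1/2 - γ - pr (fun z : Fin q → V => Rob (q+1) τ H A (i + cnt A z))
    · rw [le_div_iff₀ hρ]
      nlinarith
    · exact (not_le.1 h0).le.trans (by positivity)
  linarith

lemma robust_struct {q : ℕ} {γ τ ρ : ℝ} (hτ : 0 ≤ τ) (hρ : 0 < ρ) {H : Finset (Finset V)} (A : Finset V)
    (hdeg : ∀ v, 1/2 - γ ≤ pr (fun z : Fin q → V => Lk H v z)) (hA : ρ ≤ pr (fun v => v ∈ A))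
    (hA' : ρ ≤ pr (fun v => v ∉ A)) (hsmall : 2 * γ + 2 * (2^(q+1) * τ / ρ) < ρ^q) :
    (∃ j ≤ q, Rob (q+1) τ H A j ∧ Rob (q+1) τ H A (j+1)) ∨
    ∃ c < 2, ∀ j ≤ q+1, (Rob (q+1) τ H A j ↔ j % 2 = c) := by
  by_cases hcons : ∃ j ≤ q, Rob (q+1) τ H A j ∧ Rob (q+1) τ H A (j+1)
  · exact Or.inl hcons
  right
  push Not at hcons
  have h1 := robust_half (q := q) (γ := γ) hτ hρ (H := H) A A 1 (fun v hv => by simp [hv]) hdeg hA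
  have h0 := robust_half (q := q) (γ := γ) hτ hρ (H := H) A Aᶜ 0 (fun v hv => by simp at hv; simp [hv]) hdeg (by simpa using hA')
  simp only [zero_add] at h0
  have hor : ∀ i ≤ q, Rob (q+1) τ H A i ∨ Rob (q+1) τ H A (i+1) := by
    intro i hi
    by_contra hn
    push Not at hn
    have hi1 : ρ^q ≤ pr (fun z : Fin q → V => ∀ c, (z c ∈ A ↔ c.val < i)) := by
      rw [pr_pi (Ω := fun _ : Fin q => V) (fun c v => (v ∈ A ↔ c.val < i))]
      have := prod_le_prod (s := univ) (f := fun _ : Fin q => ρ) (g := fun c => pr (fun v => (v ∈ A ↔ c.val < i)))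
        (fun _ _ => hρ.le) (fun c _ => by
          by_cases hc : c.val < i
          · simpa [hc] using hA
          · simpa [hc] using hA')
      simpa using this
    have hi2 : pr (fun z : Fin q → V => Rob (q+1) τ H A (cnt A z)) + pr (fun z : Fin q → V => Rob (q+1) τ H A (1 + cnt A z))
        + pr (fun z : Fin q → V => ∀ c, (z c ∈ A ↔ c.val < i)) ≤ 1 := by
      unfold pr
      rw [← av_add, ← av_add]
      apply av_abs_le
      intro z
      have hz := cnt_le A z
      have hz' := hcons _ hz
      rw [add_comm (cnt A z)] at hz'
      beta_reduce
      by_cases hzi : ∀ c, (z c ∈ A ↔ c.val < i)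
      · have : cnt A z = i := by
          unfold cnt
          rw [filter_congr (q := fun c : Fin q => c.val < i) (fun c _ => hzi c)]
          have e := Fin.card_filter_val_lt (n := q) (m := i)
          omega
        rw [this, add_comm 1 i]
        simp [hn.1, hn.2]
        split_ifs <;> norm_num
      · rw [if_neg hzi]
        by_cases a1 : Rob (q+1) τ H A (cnt A z)
        · simp [a1, hz' a1]
        · simp [a1]; split_ifs <;> norm_num
    linarith
  refine ⟨if Rob (q+1) τ H A 0 then 0 else 1, by split_ifs <;> norm_num, ?_⟩
  intro j
  induction j with
  | zero => intro _; by_cases h : Rob (q+1) τ H A 0 <;> simp [h]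
  | succ j ih =>
    intro hj
    have ih := ih (by omega)
    have a := hor j (by omega)
    have b := hcons j (by omega)
    by_cases h : Rob (q+1) τ H A 0
    · simp only [h, if_true] at ih ⊢
      by_cases hj : Rob (q+1) τ H A j
      · have := ih.1 hj
        have := b hj
        constructor
        · intro h; exact absurd h this
        · intro; exfalso; omega
      · have h9 : ¬ (j % 2 = _) := fun h => hj (ih.2 h)
        have := a.resolve_left hj
        constructor
        · intro; omega
        · intro; exact this
    · simp only [h, if_false] at ih ⊢
      by_cases hj : Rob (q+1) τ H A j
      · have := ih.1 hj
        have := b hj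
        constructor
        · intro h; exact absurd h this
        · intro; exfalso; omega
      · have h9 : ¬ (j % 2 = _) := fun h => hj (ih.2 h)
        have := a.resolve_left hj
        constructor
        · intro; omega
        · intro; exact this
end robust
end PMH


namespace PMH
open Finset
open scoped Classical

section struct
variable {V : Type} [Fintype V] [DecidableEq V]

lemma sum_step (m s j δ : ℕ) (hs : s ≤ m) : ∑ i : Fin m, (if i.val < s then j + δ else j) = m * j + s * δ := by
  have : ∀ i : Fin m, (if i.val < s then j + δ else j) = j + (if i.val < s then 1 else 0) * δ := by
    intro i; split_ifs <;> simp
  rw [sum_congr rfl fun i _ => this i, sum_add_distrib, ← sum_mul, ← card_filter, Fin.card_filter_val_lt]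
  simp [hs]

lemma absorb_case [Nonempty V] {q : ℕ} {H : Finset (Finset V)} {A Q : Finset V} {τ σ : ℝ} (hτ : 0 ≤ τ) (hσ : 0 ≤ σ)
    (hsw : ∀ u v, (u ∈ A ↔ v ∈ A) → σ ≤ pr (fun T : SW q → V => swapOK H u v T))
    (hQ : Q.card = 2*(q+1)) (j δ s t : ℕ) (hs : s ≤ 2*(q+1)+2) (ht : t ≤ 2*(q+1)) (hjk : j + δ ≤ q+1)
    (hj : Rob (q+1) τ H A j) (hjδ : Rob (q+1) τ H A (j+δ))
    (hsum : (Q ∩ A).card + t * δ = 2 * j + s * δ) :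
    τ^(2*(q+1)+2) * τ^(2*(q+1)) * σ^(Fintype.card (PP q)) -
      (Fintype.card (JJ q) : ℝ)^2 / Fintype.card V - (Fintype.card (JJ q) : ℝ) * (2*(q+1)) / Fintype.card V ≤
    pr (fun g : JJ q → V => absorbs H g Q) := by
  apply absorber_density hτ hσ hsw hQ (fun i => if i.val < s then j + δ else j) (fun i => if i.val < t then j + δ else j)
  · intro i; split_ifs <;> omega
  · intro i; split_ifs <;> omega
  · intro i; split_ifs
    · exact hjδ
    · exact hj
  · intro i; split_ifs
    · exact hjδ
    · exact hj
  · rw [sum_step _ _ _ _ hs, sum_step _ _ _ _ ht]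
    have : (2*(q+1)+2) * j = 2 * (q+1) * j + 2 * j := by ring
    omega

lemma absorb_struct (q : ℕ) (hq : 2 ≤ q) (τ' : ℝ) (hτ' : 0 < τ') : ∃ γ > 0, ∃ β > 0, ∃ n0 : ℕ,
    ∀ (V : Type) [Fintype V] [DecidableEq V], n0 ≤ Fintype.card V → ∀ H : Finset (Finset V),
    (∀ e ∈ H, e.card = q+1) → (∀ v, 1/2 - γ ≤ pr (fun z : Fin q → V => Lk H v z)) →
    ∃ A : Finset V, ∃ c < 2, ((A = ∅ ∧ c = 0) ∨ (A.Nonempty ∧ Aᶜ.Nonempty)) ∧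
      pr (fun e : Fin (q+1) → V => univ.image e ∈ H ∧ (univ.image e ∩ A).card % 2 ≠ c) ≤ τ' ∧
      ∀ Q : Finset V, Q.card = 2*(q+1) → Even (Q ∩ A).card → β ≤ pr (fun g : JJ q → V => absorbs H g Q) := by
  have hqR : (2:ℝ) ≤ q := by exact_mod_cast hq
  obtain ⟨ζ, hζ⟩ : ∃ ζ : ℝ, ζ = 1 / (100 * q) := ⟨_, rfl⟩
  have hζ0 : 0 < ζ := by rw [hζ]; positivity
  have hζ1 : ζ * (100 * q) = 1 := by rw [hζ]; field_simp
  have hζ2 : ζ ≤ 1/200 := by nlinarith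
  obtain ⟨ρ, hρ⟩ : ∃ ρ : ℝ, ρ = ζ/2 := ⟨_, rfl⟩
  have hρ0 : 0 < ρ := by rw [hρ]; positivity
  obtain ⟨τ, hτ⟩ : ∃ τ : ℝ, τ = min (1/4) (min (τ' / 2^(q+1)) (ρ^q / 8 * ρ / 2^(q+1))) := ⟨_, rfl⟩
  have hτ0 : 0 < τ := by rw [hτ]; positivity
  have hτ1 : τ ≤ 1/4 := by rw [hτ]; exact min_le_left _ _
  have hτ2 : 2^(q+1) * τ ≤ τ' := by
    have : τ ≤ τ' / 2^(q+1) := by rw [hτ]; exact (min_le_right _ _).trans (min_le_left _ _)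
    rwa [le_div_iff₀ (by positivity), mul_comm] at this
  have hτ3 : 2^(q+1) * τ / ρ ≤ ρ^q / 8 := by
    have : τ ≤ ρ^q / 8 * ρ / 2^(q+1) := by rw [hτ]; exact (min_le_right _ _).trans (min_le_right _ _)
    rw [div_le_iff₀ hρ0]
    rwa [le_div_iff₀ (by positivity), mul_comm] at this
  obtain ⟨γ, hγ⟩ : ∃ γ : ℝ, γ = min ζ (ρ^q / 8) := ⟨_, rfl⟩
  have hγ0 : 0 < γ := by rw [hγ]; positivity
  have hγ1 : γ ≤ ζ := by rw [hγ]; exact min_le_left _ _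
  have hγ2 : γ ≤ ρ^q / 8 := by rw [hγ]; exact min_le_right _ _
  have hρq : 0 < ρ^q := by positivity
  obtain ⟨σ, hσ⟩ : ∃ σ : ℝ, σ = ζ^2/16 * ζ^3 := ⟨_, rfl⟩
  have hσ0 : 0 < σ := by rw [hσ]; positivity
  obtain ⟨β, hβ⟩ : ∃ β : ℝ, β = τ^(2*(q+1)+2) * τ^(2*(q+1)) * σ^(Fintype.card (PP q)) / 2 := ⟨_, rfl⟩
  have hβ0 : 0 < β := by rw [hβ]; positivity
  obtain ⟨C, hC⟩ : ∃ C : ℝ, C = (Fintype.card (JJ q) : ℝ)^2 + (Fintype.card (JJ q) : ℝ) * (2*(q+1)) := ⟨_, rfl⟩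
  obtain ⟨n0, hn0⟩ := exists_nat_ge (C / β)
  refine ⟨γ, hγ0, β, hβ0, n0 + 1, ?_⟩
  intro V _ _ hV H hH hdeg
  have hVpos : 0 < Fintype.card V := by omega
  have : Nonempty V := Fintype.card_pos_iff.1 hVpos
  have hVR : (0:ℝ) < Fintype.card V := by exact_mod_cast hVpos
  have herr : τ^(2*(q+1)+2) * τ^(2*(q+1)) * σ^(Fintype.card (PP q)) -
      (Fintype.card (JJ q) : ℝ)^2 / Fintype.card V - (Fintype.card (JJ q) : ℝ) * (2*(q+1)) / Fintype.card V ≥ β := by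
    have h1 : C / Fintype.card V ≤ β := by
      rw [div_le_iff₀ hVR, mul_comm, ← div_le_iff₀ hβ0]
      refine hn0.trans ?_
      exact_mod_cast (by omega)
    rw [hC, add_div] at h1
    linarith
  have hcomb := fun (A Q : Finset V) hsw hQ j δ s t hs ht hjk hj hjδ hsum =>
    herr.le.trans (absorb_case (V := V) (q := q) (H := H) (A := A) (Q := Q) (τ := τ) (σ := σ) hτ0.le hσ0.le hsw hQ
      j δ s t hs ht hjk hj hjδ hsum)
  obtain ⟨A, hA, hA2⟩ := dichotomy (V := V) (fun u v => Adj q ζ H u v) (fun u v h => Adj.symm' h)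
    (fun u v w => adj_three (by linarith) (by linarith) hdeg u v w) hζ0
    (fun x => adj_degree (by omega) hζ0 hγ0 hζ0 hζ1.le (by nlinarith) hζ1.le hdeg x)
  have hsw : ∀ u v, (u ∈ A ↔ v ∈ A) → σ ≤ pr (fun T : SW q → V => swapOK H u v T) := by
    intro u v huv
    rw [hσ]
    exact swap_density hζ0.le (hA u v huv)
  rcases hA2 with hA2 | ⟨hA2, hA3⟩
  · refine ⟨∅, 0, by norm_num, Or.inl ⟨rfl, rfl⟩, ?_, ?_⟩
    · refine le_trans (le_of_eq ?_) hτ'.le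
      rw [← pr_false (Ω := Fin (q+1) → V)]
      apply pr_congr; intro e; simp
    · intro Q hQ _
      have hR : Rob (q+1) τ H A 0 := by
        unfold Rob
        have h1 : τ ≤ av (fun v => pr (fun z : Fin q → V => Lk H v z)) :=
          le_av_of _ _ fun v => le_trans (by linarith) (hdeg v)
        rw [← pr_prod] at h1
        refine h1.trans ?_
        rw [← pr_cons]
        apply pr_mono
        rintro ⟨v, z⟩ h
        refine ⟨?_, ?_⟩
        · rw [image_cons]; exact h
        · simp [hA2]
      exact hcomb A Q hsw hQ 0 0 0 0 (by omega) (by omega) (by omega) hR hR (by simp [hA2])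
  · rcases robust_struct (q := q) (γ := γ) hτ0.le hρ0 (H := H) A hdeg (by rw [hρ]; exact hA2) (by rw [hρ]; exact hA3)
      (by linarith) with ⟨j, hjq, hj1, hj2⟩ | ⟨c, hc, hrob⟩
    · refine ⟨∅, 0, by norm_num, Or.inl ⟨rfl, rfl⟩, ?_, ?_⟩
      · refine le_trans (le_of_eq ?_) hτ'.le
        rw [← pr_false (Ω := Fin (q+1) → V)]
        apply pr_congr; intro e; simp
      · intro Q hQ _
        have hle : (Q ∩ A).card ≤ 2*(q+1) := hQ ▸ card_le_card inter_subset_left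
        by_cases hcase : (Q ∩ A).card ≤ 2 * j
        · exact hcomb A Q hsw hQ j 1 0 (2*j - (Q ∩ A).card) (by omega) (by omega) (by omega) hj1 hj2 (by omega)
        · exact hcomb A Q hsw hQ j 1 ((Q ∩ A).card - 2*j) 0 (by omega) (by omega) (by omega) hj1 hj2 (by omega)
    · refine ⟨A, c, hc, Or.inr ⟨?_, ?_⟩, ?_, ?_⟩
      · obtain ⟨v, hv⟩ := exists_of_pr_pos (lt_of_lt_of_le (by positivity) hA2)
        exact ⟨v, hv⟩
      · obtain ⟨v, hv⟩ := exists_of_pr_pos (lt_of_lt_of_le (by positivity) hA3)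
        exact ⟨v, by simpa using hv⟩
      · refine le_trans (pr_mono ?_) ((wrong_le (k := q+1) hτ0.le H A).trans hτ2)
        rintro e ⟨h1, h2⟩
        refine ⟨h1, fun h3 => h2 ?_⟩
        rw [hrob _ (cnt_le A e)] at h3
        rw [← h3]
        congr 1
        have hinj : Function.Injective e := by
          have h9 : Set.InjOn e (univ : Finset (Fin (q+1))) := by
            rw [← Finset.card_image_iff]
            simpa using hH _ h1
          intro x y hxy
          exact h9 (by simp) (by simp) hxy
        unfold cnt
        rw [← card_image_of_injective _ hinj]
        congr 1
        ext v
        simp only [mem_inter, mem_image, mem_filter, mem_univ, true_and]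
        grind
      · intro Q hQ heven
        have hle : (Q ∩ A).card ≤ 2*(q+1) := hQ ▸ card_le_card inter_subset_left
        obtain ⟨a, ha⟩ := heven
        have r1 : Rob (q+1) τ H A c := (hrob c (by omega)).2 (by omega)
        have r2 : Rob (q+1) τ H A (c+2) := (hrob (c+2) (by omega)).2 (by omega)
        by_cases hcase : a ≤ c
        · exact hcomb A Q hsw hQ c 2 0 (c - a) (by omega) (by omega) (by omega) r1 r2 (by omega)
        · exact hcomb A Q hsw hQ c 2 (a - c) 0 (by omega) (by omega) (by omega) r1 r2 (by omega)

end struct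
end PMH


namespace PMH
open Finset
open scoped Classical

section family
variable {V : Type} [Fintype V] [DecidableEq V]

lemma pow_le_two_pow (w : ℕ) (κ : ℝ) (hκ : 0 < κ) : ∃ n0 : ℕ, ∀ n : ℕ, n0 ≤ n → (n:ℝ)^w ≤ 2^(⌊κ * n⌋₊) := by
  have hr : (1:ℝ) < 2^κ := Real.one_lt_rpow (by norm_num) hκ
  have h := tendsto_pow_const_div_const_pow_of_one_lt w hr
  have h2 := (h.eventually (gt_mem_nhds (show (0:ℝ) < 1/2 by norm_num)))
  obtain ⟨n0, hn0⟩ := Filter.eventually_atTop.1 h2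
  refine ⟨n0, fun n hn => ?_⟩
  have h3 := hn0 n hn
  rw [div_lt_iff₀ (by positivity)] at h3
  have h4 : ((2:ℝ)^κ)^n ≤ 2 * 2^(⌊κ * n⌋₊) := by
    rw [← Real.rpow_natCast ((2:ℝ)^κ) n, ← Real.rpow_mul (by norm_num), ← pow_succ', ← Real.rpow_natCast 2]
    apply Real.rpow_le_rpow_of_exponent_le (by norm_num)
    push_cast
    exact (Nat.lt_floor_add_one _).le
  linarith

lemma family_step [Nonempty V] {J : Type} [Fintype J] [Nonempty J] {β : ℝ} 
    (R : (J → V) → Finset V → Prop) (𝒬 : Finset (Finset V))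
    (hR : ∀ Q ∈ 𝒬, β ≤ pr (fun g => R g Q)) (U : Finset V) (hU : (Fintype.card J : ℝ) * U.card / Fintype.card V ≤ β / 2)
    (Φ : Finset V → ℝ) (hΦ : ∀ Q, 0 ≤ Φ Q) :
    ∃ g : J → V, ∑ Q ∈ 𝒬, Φ Q * (1 - 1/2 * if (R g Q ∧ ∀ i, g i ∉ U) then (1:ℝ) else 0) ≤ (1 - β/4) * ∑ Q ∈ 𝒬, Φ Q := by
  obtain ⟨g, hg⟩ := exists_le_av (fun g : J → V => ∑ Q ∈ 𝒬, Φ Q * (1 - 1/2 * if (R g Q ∧ ∀ i, g i ∉ U) then (1:ℝ) else 0))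
  refine ⟨g, hg.trans ?_⟩
  rw [av_sum, mul_sum]
  apply sum_le_sum
  intro Q hQ
  rw [av_mul_left, mul_comm]
  apply mul_le_mul_of_nonneg_right _ (hΦ Q)
  rw [av_sub, av_const, av_mul_left, av_ite]
  have h1 := pr_meets_le (V := V) (κ := J) U
  have h2 := pr_and_not (fun g : J → V => R g Q) (fun g => ∀ i, g i ∉ U)
  have h3 : pr (fun g : J → V => R g Q ∧ ¬ ∀ i, g i ∉ U) ≤ pr (fun g : J → V => ∃ i, g i ∈ U) := by
    apply pr_mono
    rintro g ⟨-, h⟩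
    push Not at h
    exact h
  have := hR Q hQ
  linarith

lemma family_iter [Nonempty V] {J : Type} [Fintype J] [Nonempty J] {β : ℝ} (hβ1 : β ≤ 1)
    (R : (J → V) → Finset V → Prop) (Ok : (J → V) → Prop) (hRO : ∀ g Q, R g Q → Ok g) (𝒬 : Finset (Finset V))
    (hR : ∀ Q ∈ 𝒬, β ≤ pr (fun g => R g Q)) (Z : Finset V) (p : ℕ)
    (hp : (Fintype.card J : ℝ) * (Fintype.card J * p + Z.card) / Fintype.card V ≤ β / 2) :
    ∀ i ≤ p, ∃ 𝒢 : Finset (J → V), 𝒢.card ≤ i ∧ (∀ g ∈ 𝒢, Ok g ∧ ∀ i, g i ∉ Z) ∧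
      (∀ g ∈ 𝒢, ∀ g' ∈ 𝒢, g ≠ g' → ∀ i j, g i ≠ g' j) ∧
      ∑ Q ∈ 𝒬, (1/2 : ℝ)^(𝒢.filter (fun g => R g Q)).card ≤ (1 - β/4)^i * 𝒬.card := by
  intro i
  induction i with
  | zero => intro _; exact ⟨∅, by simp⟩
  | succ i ih =>
    intro hi
    obtain ⟨𝒢, h1, h2, h3, h4⟩ := ih (by omega)
    let U : Finset V := 𝒢.biUnion (fun g => univ.image g) ∪ Z
    have hUc : (U.card : ℝ) ≤ Fintype.card J * p + Z.card := by
      have a1 : U.card ≤ 𝒢.card * Fintype.card J + Z.card := by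
        refine (card_union_le _ _).trans ?_
        gcongr
        exact card_biUnion_le_card_mul _ _ _ fun g _ => card_image_le.trans (by simp)
      have a2 : 𝒢.card * Fintype.card J ≤ p * Fintype.card J := Nat.mul_le_mul_right _ (by omega)
      have a3 : U.card ≤ Fintype.card J * p + Z.card := by rw [mul_comm _ p]; omega
      exact_mod_cast a3
    obtain ⟨g, hg⟩ := family_step R 𝒬 hR U (le_trans (by gcongr) hp)
      (fun Q => (1/2 : ℝ)^(𝒢.filter (fun g => R g Q)).card) (fun Q => by positivity)
    have hb : (1 - β/4) * ∑ Q ∈ 𝒬, (1/2 : ℝ)^(𝒢.filter (fun g => R g Q)).card ≤ (1 - β/4)^(i+1) * 𝒬.card := by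
      rw [pow_succ', mul_assoc]
      exact mul_le_mul_of_nonneg_left h4 (by linarith)
    by_cases hgood : Ok g ∧ ∀ i, g i ∉ U
    · have hgU : ∀ g' ∈ 𝒢, ∀ i j, g i ≠ g' j := by
        intro g' hg' i j hij
        apply hgood.2 i
        refine mem_union_left _ (mem_biUnion.2 ⟨g', hg', ?_⟩)
        rw [hij]; simp
      have hgn : g ∉ 𝒢 := fun h => hgU g h (Classical.arbitrary J) (Classical.arbitrary J) rfl
      refine ⟨insert g 𝒢, ?_, ?_, ?_, ?_⟩
      · rw [card_insert_of_notMem hgn]; omega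
      · intro g' hg'
        rcases mem_insert.1 hg' with rfl | hg'
        · exact ⟨hgood.1, fun i hi => hgood.2 i (mem_union_right _ hi)⟩
        · exact h2 g' hg'
      · intro a ha b hb hab i j
        rcases mem_insert.1 ha with ha1 | ha1 <;> rcases mem_insert.1 hb with hb1 | hb1
        · exact absurd (ha1.trans hb1.symm) hab
        · rw [ha1]; exact hgU b hb1 i j
        · rw [hb1]; exact (hgU a ha1 j i).symm
        · exact h3 a ha1 b hb1 hab i j
      · refine le_trans (le_of_eq ?_) (hg.trans hb)
        apply sum_congr rfl
        intro Q _
        rw [filter_insert]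
        by_cases hr : R g Q
        · rw [if_pos hr, if_pos ⟨hr, hgood.2⟩, card_insert_of_notMem (by simp [hgn]), pow_succ]
          ring
        · rw [if_neg hr, if_neg (fun h => hr h.1)]
          ring
    · refine ⟨𝒢, by omega, h2, h3, le_trans (le_of_eq ?_) (hg.trans hb)⟩
      apply sum_congr rfl
      intro Q _
      rw [if_neg (fun h => hgood ⟨hRO g Q h.1, h.2⟩)]
      ring

lemma family (J : Type) [Fintype J] [Nonempty J] (w z : ℕ) (β η : ℝ) (hβ : 0 < β) (hβ1 : β ≤ 1) (hη : 0 < η) :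
    ∃ κ > 0, ∃ n0 : ℕ, ∀ (V : Type) [Fintype V] [DecidableEq V], n0 ≤ Fintype.card V →
    ∀ (R : (J → V) → Finset V → Prop) (Ok : (J → V) → Prop), (∀ g Q, R g Q → Ok g) → ∀ (𝒬 : Finset (Finset V)),
    (∀ Q ∈ 𝒬, Q.card = w) → (∀ Q ∈ 𝒬, β ≤ pr (fun g => R g Q)) → ∀ (Z : Finset V), Z.card ≤ z →
    ∃ 𝒢 : Finset (J → V), (∀ g ∈ 𝒢, Ok g ∧ ∀ i, g i ∉ Z) ∧ (∀ g ∈ 𝒢, ∀ g' ∈ 𝒢, g ≠ g' → ∀ i j, g i ≠ g' j) ∧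
      (Fintype.card J : ℝ) * 𝒢.card ≤ η * Fintype.card V ∧
      ∀ Q ∈ 𝒬, κ * Fintype.card V ≤ ((𝒢.filter (fun g => R g Q)).card : ℝ) := by
  have hJ : (0:ℝ) < Fintype.card J := by exact_mod_cast Fintype.card_pos
  obtain ⟨K, hK⟩ := exists_pow_lt_of_lt_one (show (0:ℝ) < 1/4 by norm_num) (show 1 - β/4 < 1 by linarith)
  obtain ⟨η', hη'⟩ : ∃ η', η' = min η (β / (4 * Fintype.card J)) := ⟨_, rfl⟩
  have hη0 : 0 < η' := by rw [hη']; positivity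
  have hη1 : η' ≤ η := by rw [hη']; exact min_le_left _ _
  have hη2 : η' * Fintype.card J ≤ β / 4 := by
    have : η' ≤ β / (4 * Fintype.card J) := by rw [hη']; exact min_le_right _ _
    rw [le_div_iff₀ (by positivity)] at this
    linarith
  obtain ⟨κ, hκ⟩ : ∃ κ : ℝ, κ = η' / (((K:ℝ)+1) * Fintype.card J) := ⟨_, rfl⟩
  have hκ0 : 0 < κ := by rw [hκ]; positivity
  have hκ1 : Fintype.card J * (K * κ) ≤ η' := by
    have : κ * (((K:ℝ)+1) * Fintype.card J) = η' := by rw [hκ]; field_simp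
    nlinarith [mul_pos hκ0 hJ]
  obtain ⟨n0, hn0⟩ := pow_le_two_pow w κ hκ0
  obtain ⟨n1, hn1⟩ := exists_nat_ge (2 / κ)
  obtain ⟨n2, hn2⟩ := exists_nat_ge (4 * Fintype.card J * z / β)
  refine ⟨κ / 2, by positivity, n0 + n1 + n2 + 1, ?_⟩
  intro V _ _ hV R Ok hRO 𝒬 h𝒬 hR Z hZ
  obtain ⟨n, hn⟩ : ∃ n, n = Fintype.card V := ⟨_, rfl⟩
  have hnpos : 0 < n := by omega
  have : Nonempty V := Fintype.card_pos_iff.1 (by omega)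
  have hnR : (0:ℝ) < n := by exact_mod_cast hnpos
  obtain ⟨b, hb⟩ : ∃ b, b = ⌊κ * n⌋₊ := ⟨_, rfl⟩
  have hb1 : (b:ℝ) ≤ κ * n := by rw [hb]; exact Nat.floor_le (by positivity)
  have hb2 : κ / 2 * n ≤ b := by
    have h1 : κ * n < b + 1 := by rw [hb]; exact Nat.lt_floor_add_one _
    have h2 : 2 / κ ≤ n := hn1.trans (by exact_mod_cast (by omega))
    rw [div_le_iff₀ hκ0] at h2
    nlinarith
  have hsz : (Fintype.card J : ℝ) * ((K * b : ℕ) : ℝ) ≤ η' * n := by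
    push_cast
    calc (Fintype.card J : ℝ) * (K * b) ≤ Fintype.card J * (K * (κ * n)) := by gcongr
      _ = Fintype.card J * (K * κ) * n := by ring
      _ ≤ η' * n := by gcongr
  obtain ⟨𝒢, h1, h2, h3, h4⟩ := family_iter hβ1 R Ok hRO 𝒬 hR Z (K * b) (by
    rw [← hn, div_le_iff₀ hnR]
    have h1 : (Z.card : ℝ) ≤ z := by exact_mod_cast hZ
    have h2 : 4 * Fintype.card J * z / β ≤ n := hn2.trans (by exact_mod_cast (by omega))
    rw [div_le_iff₀ hβ] at h2
    have h3 : (Fintype.card J : ℝ) * Z.card ≤ β / 4 * n := by nlinarith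
    have h4 : (Fintype.card J : ℝ) * (Fintype.card J * ((K * b : ℕ) : ℝ)) ≤ Fintype.card J * (η' * n) := by gcongr
    nlinarith) (K * b) le_rfl
  refine ⟨𝒢, h2, h3, ?_, ?_⟩
  · rw [← hn]
    calc (Fintype.card J : ℝ) * 𝒢.card ≤ Fintype.card J * ((K * b : ℕ) : ℝ) := by gcongr
      _ ≤ η' * n := hsz
      _ ≤ η * n := by gcongr
  · intro Q hQ
    rw [← hn]
    refine hb2.trans ?_
    have h5 : (1/2 : ℝ)^(𝒢.filter (fun g => R g Q)).card ≤ (1/2)^b := by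
      calc (1/2 : ℝ)^(𝒢.filter (fun g => R g Q)).card ≤ ∑ Q ∈ 𝒬, (1/2 : ℝ)^(𝒢.filter (fun g => R g Q)).card :=
            single_le_sum (f := fun Q => (1/2 : ℝ)^(𝒢.filter (fun g => R g Q)).card) (fun _ _ => by positivity) hQ
        _ ≤ (1 - β/4)^(K*b) * 𝒬.card := h4
        _ ≤ (1/4)^b * 2^b := by
          rw [pow_mul]
          have h6 : (𝒬.card : ℝ) ≤ 2^b := by
            rw [hb]
            refine le_trans ?_ (hn0 n (by omega))
            have : 𝒬.card ≤ n^w := by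
              calc 𝒬.card ≤ ((univ : Finset V).powersetCard w).card := card_le_card fun Q hQ => by
                    simp [mem_powersetCard, h𝒬 Q hQ]
                _ = n.choose w := by rw [card_powersetCard, card_univ, hn]
                _ ≤ n^w := Nat.choose_le_pow _ _
            exact_mod_cast this
          have : (0:ℝ) ≤ 1 - β/4 := by linarith
          gcongr
        _ = (1/2)^b := by rw [← mul_pow]; norm_num
    have := (pow_le_pow_iff_right_of_lt_one₀ (show (0:ℝ) < 1/2 by norm_num) (by norm_num)).1 h5
    exact_mod_cast this
end family
end PMH


namespace PMH
open Finset
open scoped Classical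

lemma pr_subtype_ge {V κ : Type} [Fintype V] [DecidableEq V] [Fintype κ] [DecidableEq κ] (S : Finset V) [Nonempty {v // v ∈ S}]
    (P : (κ → V) → Prop) :
    pr (fun x : κ → V => P x ∧ ∀ i, x i ∈ S) ≤ pr (fun x : κ → {v // v ∈ S} => P (fun i => (x i : V))) := by
  rw [pr_eq, pr_eq]
  have h : ((univ.filter fun x : κ → V => P x ∧ ∀ i, x i ∈ S)).card ≤
      (univ.filter fun x : κ → {v // v ∈ S} => P (fun i => (x i : V))).card := by
    refine le_trans (card_le_card ?_) (card_image_le (f := fun (x : κ → {v // v ∈ S}) i => (x i : V)))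
    intro x hx
    simp only [mem_filter, mem_univ, true_and] at hx
    refine mem_image.2 ⟨fun i => ⟨x i, hx.2 i⟩, ?_, rfl⟩
    simpa using hx.1
  have hpos : 0 < Fintype.card (κ → {v // v ∈ S}) := Fintype.card_pos
  have hle : Fintype.card (κ → {v // v ∈ S}) ≤ Fintype.card (κ → V) := by
    rw [Fintype.card_fun, Fintype.card_fun]
    exact Nat.pow_le_pow_left (by simpa using card_le_univ S) _
  gcongr

section assembly
variable {V : Type} [Fintype V] [DecidableEq V]

omit [Fintype V] in
lemma PM.dvd {H : Finset (Finset V)} {k : ℕ} (hH : ∀ e ∈ H, e.card = k) {S : Finset V} (h : PM H S) : k ∣ S.card := by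
  obtain ⟨M, h1, h2, rfl⟩ := h
  rw [card_biUnion fun a ha b hb hab => h2 ha hb hab]
  exact dvd_sum fun e he => by simp [hH e (h1 he)]

lemma apm_on (k d r : ℕ) (hk : 2 ≤ k) (hr : 2 ≤ r) (hd : 1 ≤ d) (hkdr : d + r = k) (hkr : k + 1 ≤ 2 * r)
    (ε η : ℝ) (hε : 0 < ε) (hη : 0 < η) (hη1 : η < 1) : ∃ n0 : ℕ, ∀ (V : Type) [Fintype V] [DecidableEq V],
    n0 ≤ Fintype.card V → ∀ H : Finset (Finset V), (∀ e ∈ H, e.card = k) →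
    (∀ y : Fin d → V, Function.Injective y → gc k r r + ε ≤ pr (fun z : Fin r → V => univ.image (Sum.elim y z) ∈ H)) →
    ∀ S : Finset V, (1 - min (1/2) (ε / (2 * r))) * Fintype.card V ≤ S.card → k ∣ S.card →
    ∃ T ⊆ S, PM H T ∧ ((S \ T).card : ℝ) ≤ η * Fintype.card V := by
  obtain ⟨γ, hγ, N0, hN0⟩ := apm k d r hk hr hd hkdr hkr (ε/2) η (by positivity) hη hη1
  obtain ⟨n1, hn1⟩ := exists_nat_ge ((d:ℝ)^2 / γ)
  have hrR : (2:ℝ) ≤ r := by exact_mod_cast hr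
  refine ⟨2 * (k * (N0 + 1)) + 2 * n1 + 2, ?_⟩
  intro V _ _ hV H hH hdeg S hS hkS
  obtain ⟨n, hn⟩ : ∃ n, n = Fintype.card V := ⟨_, rfl⟩
  rw [← hn] at hS hV ⊢
  have hnpos : 0 < n := by omega
  have hnR : (0:ℝ) < n := by exact_mod_cast hnpos
  have hm1 : min (1/2) (ε / (2 * r)) ≤ 1/2 := min_le_left _ _
  have hm2 : min (1/2) (ε / (2 * r)) ≤ ε / (2 * r) := min_le_right _ _
  have hS2 : (n:ℝ) ≤ 2 * S.card := by nlinarith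
  have hS3 : n ≤ 2 * S.card := by exact_mod_cast hS2
  have hSpos : 0 < S.card := by omega
  have : Nonempty {v // v ∈ S} := by
    obtain ⟨v, hv⟩ := card_pos.1 hSpos
    exact ⟨⟨v, hv⟩⟩
  have : Nonempty V := Fintype.card_pos_iff.1 (by omega)
  have hSR : (0:ℝ) < S.card := by exact_mod_cast hSpos
  obtain ⟨N, hN⟩ := hkS
  let f : {v // v ∈ S} ↪ V := Function.Embedding.subtype _
  let H' : Finset (Finset {v // v ∈ S}) := univ.filter fun e => e.map f ∈ H
  have hH' : ∀ e ∈ H', e.card = k := by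
    intro e he
    have := hH _ (mem_filter.1 he).2
    rwa [card_map] at this
  have hbad : pr (fun y : Fin d → {v // v ∈ S} => pr (fun z : Fin r → {v // v ∈ S} => univ.image (Sum.elim y z) ∈ H') <
      gc k r r + ε / 2) ≤ γ := by
    refine le_trans (pr_mono (Q := fun y => ¬ Function.Injective y) ?_) ((pr_not_inj_le).trans ?_)
    · intro y hy hinj
      refine absurd hy (not_lt.2 ?_)
      have h1 := hdeg (fun i => (y i : V)) (Subtype.val_injective.comp hinj)
      have h2 := pr_and_not (fun z : Fin r → V => univ.image (Sum.elim (fun i => (y i : V)) z) ∈ H) (fun z => ∀ i, z i ∈ S)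
      have h3 : pr (fun z : Fin r → V => univ.image (Sum.elim (fun i => (y i : V)) z) ∈ H ∧ ¬ ∀ i, z i ∈ S) ≤ ε / 2 := by
        refine le_trans (pr_mono (Q := fun z : Fin r → V => ∃ i, z i ∈ Sᶜ) ?_) ((pr_meets_le _).trans ?_)
        · rintro z ⟨-, h⟩
          push Not at h
          simpa using h
        · rw [Fintype.card_fin, card_compl, Nat.cast_sub (card_le_univ _), ← hn, div_le_iff₀ hnR]
          have : (n:ℝ) - S.card ≤ ε / (2 * r) * n := by nlinarith
          calc (r:ℝ) * (n - S.card) ≤ r * (ε / (2 * r) * n) := by gcongr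
            _ = ε / 2 * n := by field_simp
      have h4 := pr_subtype_ge S (fun z : Fin r → V => univ.image (Sum.elim (fun i => (y i : V)) z) ∈ H)
      have h5 : pr (fun z : Fin r → {v // v ∈ S} => univ.image (Sum.elim (fun i => (y i : V)) (fun i => (z i : V))) ∈ H)
          = pr (fun z : Fin r → {v // v ∈ S} => univ.image (Sum.elim y z) ∈ H') := by
        apply pr_congr
        intro z
        simp only [H', mem_filter, mem_univ, true_and]
        rw [map_eq_image, image_image]
        have : (fun x => f (Sum.elim y z x)) = Sum.elim (fun i => (y i : V)) (fun i => (z i : V)) := by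
          ext x; rcases x with x | x <;> rfl
        rw [← this]; rfl
      linarith
    · have h1 : Fintype.card {v // v ∈ S} = S.card := by simp
      rw [Fintype.card_fin, h1, div_le_iff₀ hSR, mul_comm, ← div_le_iff₀ hγ]
      refine hn1.trans ?_
      exact_mod_cast (by omega)
  have hNN : N0 ≤ N := by
    by_contra hlt
    have : k * N ≤ k * (N0 + 1) := Nat.mul_le_mul_left _ (by omega)
    omega
  obtain ⟨M, hM, hMd, hMc⟩ := hN0 {v // v ∈ S} N hNN (by simpa using hN) H' hH' hbad
  have hTc : (M.biUnion id).card = k * M.card := by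
    rw [card_biUnion fun a ha b hb hab => hMd ha hb hab, sum_const_nat (m := k)]
    · ring
    · intro e he; exact hH' e (hM he)
  refine ⟨(M.biUnion id).map f, ?_, ?_, ?_⟩
  · intro v hv
    obtain ⟨w, -, rfl⟩ := mem_map.1 hv
    exact w.2
  · refine ⟨M.image (fun e => e.map f), ?_, ?_, ?_⟩
    · intro e he
      obtain ⟨e', he', rfl⟩ := mem_image.1 he
      exact (mem_filter.1 (hM he')).2
    · intro a ha b hb hab
      simp only [coe_image, Set.mem_image, mem_coe] at ha hb
      obtain ⟨a, ha, rfl⟩ := ha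
      obtain ⟨b, hb, rfl⟩ := hb
      have : a ≠ b := fun h => hab (by rw [h])
      simp only [Function.onFun, id]
      exact (disjoint_map f).2 (hMd ha hb this)
    · ext v
      simp only [mem_biUnion, mem_image, id, mem_map]
      constructor
      · rintro ⟨a, ⟨e, he, rfl⟩, hv⟩
        obtain ⟨w, hw, rfl⟩ := mem_map.1 hv
        exact ⟨w, ⟨e, he, hw⟩, rfl⟩
      · rintro ⟨w, ⟨e, he, hw⟩, rfl⟩
        exact ⟨e.map f, ⟨e, he, rfl⟩, mem_map_of_mem f hw⟩
  · rw [card_sdiff_of_subset, card_map, hTc, hN, Nat.cast_sub, Nat.cast_mul, Nat.cast_mul]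
    · have hSn : (S.card : ℝ) ≤ n := by exact_mod_cast hn ▸ card_le_univ S
      rw [hN, Nat.cast_mul] at hSn
      nlinarith [show (0:ℝ) ≤ k by positivity]
    · rw [← hTc, ← hN, ← card_map f]
      apply card_le_card
      intro v hv
      obtain ⟨w, -, rfl⟩ := mem_map.1 hv
      exact w.2
    · intro v hv
      obtain ⟨w, -, rfl⟩ := mem_map.1 hv
      exact w.2

omit [Fintype V] in
lemma even_subset {W A : Finset V} {k m : ℕ} (hm : 1 ≤ m) (hW : W.card = 2 * k * m) (hE : Even (W ∩ A).card) :
    ∃ Q ⊆ W, Q.card = 2 * k ∧ Even (Q ∩ A).card := by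
  obtain ⟨a, ha⟩ := hE
  have h1 : (W ∩ A).card + (W \ A).card = W.card := card_inter_add_card_sdiff W A
  have h2 : 2 * k ≤ W.card := by rw [hW]; exact Nat.le_mul_of_pos_right _ hm
  have hev : W.card = 2 * (k * m) := by rw [hW]; ring
  obtain ⟨x, hx⟩ : ∃ x, x = min a k := ⟨_, rfl⟩
  obtain ⟨B, hB, hBc⟩ := exists_subset_card_eq (show 2 * x ≤ (W ∩ A).card by omega)
  obtain ⟨C, hC, hCc⟩ := exists_subset_card_eq (show 2 * k - 2 * x ≤ (W \ A).card by omega)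
  have hBA : B ⊆ A := hB.trans inter_subset_right
  have hCA : Disjoint C A := disjoint_of_subset_left hC sdiff_disjoint
  refine ⟨B ∪ C, union_subset (hB.trans inter_subset_left) (hC.trans sdiff_subset), ?_, ?_⟩
  · rw [card_union_of_disjoint (disjoint_of_subset_left hBA hCA.symm)]; omega
  · rw [union_inter_distrib_right, inter_eq_left.2 hBA, disjoint_iff_inter_eq_empty.1 hCA, union_empty, hBc]
    exact even_two_mul x

omit [Fintype V] in
lemma absorb_all {J : Type} [Fintype J] {H : Finset (Finset V)} {A : Finset V} {k : ℕ} : ∀ (m : ℕ) (𝒢 : Finset (J → V)) (W : Finset V),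
    W.card = 2 * k * m → Even (W ∩ A).card → (∀ g ∈ 𝒢, PM H (univ.image g)) →
    (∀ g ∈ 𝒢, ∀ g' ∈ 𝒢, g ≠ g' → ∀ i j, g i ≠ g' j) → (∀ g ∈ 𝒢, ∀ i, g i ∉ W) →
    (∀ Q : Finset V, Q.card = 2 * k → Even (Q ∩ A).card → m ≤ (𝒢.filter fun g => absorbs H g Q).card) →
    PM H (𝒢.biUnion (fun g => univ.image g) ∪ W) := by
  intro m
  induction m with
  | zero =>
    intro 𝒢 W hW _ hPM hd _ _
    have : W = ∅ := card_eq_zero.1 (by simpa using hW)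
    rw [this, union_empty]
    apply PM.biUnion _ _ hPM
    intro g hg g' hg' hne
    simp only [Function.onFun]
    rw [disjoint_left]
    intro v hv hv'
    obtain ⟨i, -, rfl⟩ := mem_image.1 hv
    obtain ⟨j, -, h⟩ := mem_image.1 hv'
    exact hd g hg g' hg' hne i j h.symm
  | succ m ih =>
    intro 𝒢 W hW hE hPM hd hdW habs
    obtain ⟨Q, hQW, hQc, hQE⟩ := even_subset (by omega) hW hE
    obtain ⟨g, hg⟩ := card_pos.1 (lt_of_lt_of_le (Nat.succ_pos m) (habs Q hQc hQE))
    obtain ⟨hg𝒢, hgQ⟩ := mem_filter.1 hg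
    have hWQ : (W \ Q ∩ A).card + (Q ∩ A).card = (W ∩ A).card := by
      rw [← card_union_of_disjoint, ← union_inter_distrib_right, sdiff_union_of_subset hQW]
      exact disjoint_of_subset_left inter_subset_left (disjoint_of_subset_right inter_subset_left sdiff_disjoint)
    have h1 := ih (𝒢.erase g) (W \ Q) (by rw [card_sdiff_of_subset hQW, hW, hQc]; ring_nf; omega)
      (by rw [← hWQ] at hE; exact (Nat.even_add.1 hE).2 hQE)
      (fun g' hg' => hPM g' (mem_of_mem_erase hg'))
      (fun a ha b hb => hd a (mem_of_mem_erase ha) b (mem_of_mem_erase hb))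
      (fun a ha i hi => hdW a (mem_of_mem_erase ha) i (mem_sdiff.1 hi).1)
      (fun Q' h1 h2 => by
        have := habs Q' h1 h2
        rw [filter_erase]
        have := pred_card_le_card_erase (s := 𝒢.filter fun g => absorbs H g Q') (a := g)
        omega)
    have h2 := PM.union h1 hgQ.2.2.2 (by
      rw [disjoint_left]
      intro v hv hv'
      rcases mem_union.1 hv with hv | hv <;> rcases mem_union.1 hv' with hv' | hv'
      · obtain ⟨g', hg', hv⟩ := mem_biUnion.1 hv
        obtain ⟨i, -, rfl⟩ := mem_image.1 hv
        obtain ⟨j, -, h⟩ := mem_image.1 hv'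
        exact hd g' (mem_of_mem_erase hg') g hg𝒢 (ne_of_mem_erase hg') i j h.symm
      · obtain ⟨g', hg', hv⟩ := mem_biUnion.1 hv
        obtain ⟨i, -, rfl⟩ := mem_image.1 hv
        exact hdW g' (mem_of_mem_erase hg') i (hQW hv')
      · obtain ⟨i, -, rfl⟩ := mem_image.1 hv'
        exact hdW g hg𝒢 i (mem_sdiff.1 hv).1
      · exact (mem_sdiff.1 hv).2 hv')
    convert h2 using 1
    ext v
    have : v ∈ 𝒢.biUnion (fun g => univ.image g) ↔ v ∈ (𝒢.erase g).biUnion (fun g => univ.image g) ∨ v ∈ univ.image g := by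
      conv_lhs => rw [← insert_erase hg𝒢, biUnion_insert, mem_union, or_comm]
    have hQW' := @hQW v
    simp only [mem_union, mem_sdiff, this]
    tauto
end assembly
end PMH

namespace PMH
open Finset
open scoped Classical

section fin
variable {V : Type} [Fintype V] [DecidableEq V]

lemma PM.parity {H : Finset (Finset V)} {A : Finset V} {k c : ℕ} (hH : ∀ e ∈ H, e.card = k)
    (hc : ∀ e ∈ H, (e ∩ A).card % 2 = c) {S : Finset V} (h : PM H S) :
    ∃ m, S.card = k * m ∧ (S ∩ A).card % 2 = (c * m) % 2 := by
  obtain ⟨M, h1, h2, rfl⟩ := h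
  refine ⟨M.card, ?_, ?_⟩
  · rw [card_biUnion fun a ha b hb hab => h2 ha hb hab]
    have := sum_congr rfl (fun e he => hH e (h1 he))
    simp only [id]
    rw [this]
    simp [mul_comm]
  · rw [biUnion_inter, card_biUnion fun a ha b hb hab =>
      disjoint_of_subset_left inter_subset_left (disjoint_of_subset_right inter_subset_left (h2 ha hb hab)),
      sum_nat_mod]
    have := sum_congr rfl (fun e he => hc e (h1 he))
    simp only [id]
    rw [this]
    simp [mul_comm]

lemma card_inter_union {S T A : Finset V} (h : Disjoint S T) :
    ((S ∪ T) ∩ A).card = (S ∩ A).card + (T ∩ A).card := by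
  rw [union_inter_distrib_right, card_union_of_disjoint]
  exact disjoint_of_subset_left inter_subset_left (disjoint_of_subset_right inter_subset_left h)

lemma zlemma {H : Finset (Finset V)} {A : Finset V} {k c : ℕ} (hk : 1 ≤ k) (hH : ∀ e ∈ H, e.card = k)
    (hkn : k ∣ Fintype.card V) (hc : c < 2) (hA : (A = ∅ ∧ c = 0) ∨ (A.Nonempty ∧ Aᶜ.Nonempty))
    (h3 : ∀ A : Finset V, A.Nonempty → Aᶜ.Nonempty → ∀ c < 2,
      A.card % 2 ≠ (c * (Fintype.card V / k)) % 2 → ∃ e ∈ H, (e ∩ A).card % 2 ≠ c)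
    (hex : ∀ X : Finset V, X.card ≤ k → ∃ e ∈ H, Disjoint e X ∧ (e ∩ A).card % 2 = c) :
    ∃ Z : Finset V, Z.card ≤ 2 * k ∧ PM H Z ∧ ∀ L : Finset V, Disjoint L Z → PM H (L ∪ Z)ᶜ → k ∣ L.card →
      ∃ W U : Finset V, W ∪ U = L ∪ Z ∧ Disjoint W U ∧ PM H U ∧ (∃ m, W.card = 2 * k * m) ∧ Even (W ∩ A).card := by
  by_cases hf : ∃ f1 ∈ H, (f1 ∩ A).card % 2 ≠ c
  · obtain ⟨f1, hf1, hp1⟩ := hf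
    obtain ⟨f0, hf0, hd, hp0⟩ := hex f1 (hH f1 hf1).le
    have c0 := hH f0 hf0
    have c1 := hH f1 hf1
    refine ⟨f0 ∪ f1, ?_, (PM.edge hf0).union (PM.edge hf1) hd, ?_⟩
    · rw [card_union_of_disjoint hd]; omega
    · rintro L hL - ⟨l, hl⟩
      rw [disjoint_union_right] at hL
      rcases Nat.even_or_odd' l with ⟨j, hj | hj⟩
      · by_cases hp : (L ∩ A).card % 2 = 0
        · exact ⟨L, f0 ∪ f1, rfl, disjoint_union_right.2 hL, (PM.edge hf0).union (PM.edge hf1) hd,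
            ⟨j, by rw [hl, hj]; ring⟩, Nat.even_iff.2 hp⟩
        · refine ⟨L ∪ (f0 ∪ f1), ∅, by simp, by simp, PM.empty, ⟨j + 1, ?_⟩, ?_⟩
          · rw [card_union_of_disjoint (disjoint_union_right.2 hL), card_union_of_disjoint hd, hl, hj, c0, c1]; ring
          · rw [card_inter_union (disjoint_union_right.2 hL), card_inter_union hd, Nat.even_iff]; omega
      · by_cases hp : (L ∩ A).card % 2 = c
        · refine ⟨L ∪ f0, f1, by rw [union_assoc], ?_, PM.edge hf1, ⟨j + 1, ?_⟩, ?_⟩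
          · exact disjoint_union_left.2 ⟨hL.2, hd⟩
          · rw [card_union_of_disjoint hL.1, hl, hj, c0]; ring
          · rw [card_inter_union hL.1, Nat.even_iff]; omega
        · refine ⟨L ∪ f1, f0, by rw [union_assoc, union_comm f1], ?_, PM.edge hf0, ⟨j + 1, ?_⟩, ?_⟩
          · exact disjoint_union_left.2 ⟨hL.1, hd.symm⟩
          · rw [card_union_of_disjoint hL.2, hl, hj, c1]; ring
          · rw [card_inter_union hL.2, Nat.even_iff]; omega
  · push Not at hf
    obtain ⟨f0, hf0, -, hp0⟩ := hex ∅ (by simp)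
    have c0 := hH f0 hf0
    refine ⟨f0, by omega, PM.edge hf0, ?_⟩
    rintro L hL hPM ⟨l, hl⟩
    obtain ⟨N, hN⟩ := hkn
    have hAp : A.card % 2 = (c * N) % 2 := by
      rcases hA with ⟨rfl, rfl⟩ | ⟨h1, h2⟩
      · simp
      · by_contra hne
        obtain ⟨e, he, hep⟩ := h3 A h1 h2 c hc (by rwa [hN, Nat.mul_div_cancel_left _ (by omega)])
        exact hep (hf e he)
    obtain ⟨m, hm1, hm2⟩ := hPM.parity hH hf
    have hcard : (L ∪ f0).card + ((L ∪ f0)ᶜ).card = Fintype.card V := card_add_card_compl _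
    have hcA : ((L ∪ f0) ∩ A).card + ((L ∪ f0)ᶜ ∩ A).card = A.card := by
      rw [← card_inter_union disjoint_compl_right, union_compl, univ_inter]
    rw [card_union_of_disjoint hL, hl, c0, hm1, hN] at hcard
    rw [card_inter_union hL] at hcA
    have hN' : N = l + 1 + m := by
      apply Nat.eq_of_mul_eq_mul_left hk; rw [← hcard]; ring
    subst hN'
    have hLp : (L ∩ A).card % 2 = (c * l) % 2 := by
      interval_cases c <;> simp only [zero_mul, one_mul] at hAp hm2 ⊢ <;> omega
    rcases Nat.even_or_odd' l with ⟨j, hj | hj⟩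
    · refine ⟨L, f0, rfl, hL, PM.edge hf0, ⟨j, by rw [hl, hj]; ring⟩, Nat.even_iff.2 ?_⟩
      rw [hLp, hj]; interval_cases c <;> omega
    · refine ⟨L ∪ f0, ∅, by simp, by simp, PM.empty, ⟨j + 1, ?_⟩, ?_⟩
      · rw [card_union_of_disjoint hL, hl, hj, c0]; ring
      · rw [card_inter_union hL, Nat.even_iff, Nat.add_mod, hLp, hp0, hj]; interval_cases c <;> omega
end fin

lemma assemble {V : Type} [Fintype V] [DecidableEq V] {J : Type} [Fintype J] (H : Finset (Finset V)) (A : Finset V) (k : ℕ)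
    (hk : 1 ≤ k) (ξ κ η : ℝ) (hηκ : η ≤ κ / 2)
    (hn4 : 2 * (k:ℝ) ≤ ξ / 2 * Fintype.card V) (hn5 : 2 * (k:ℝ) ≤ κ / 2 * Fintype.card V)
    (hkV : k ∣ Fintype.card V) (hH : ∀ e ∈ H, e.card = k)
    (hapm : ∀ S : Finset V, (1 - ξ) * Fintype.card V ≤ S.card → k ∣ S.card →
      ∃ T ⊆ S, PM H T ∧ ((S \ T).card : ℝ) ≤ η * Fintype.card V)
    (Z : Finset V) (hZc : Z.card ≤ 2 * k) (hZ : PM H Z)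
    (hZL : ∀ L : Finset V, Disjoint L Z → PM H (L ∪ Z)ᶜ → k ∣ L.card →
      ∃ W U : Finset V, W ∪ U = L ∪ Z ∧ Disjoint W U ∧ PM H U ∧ (∃ m, W.card = 2 * k * m) ∧ Even (W ∩ A).card)
    (𝒢 : Finset (J → V)) (hG1 : ∀ g ∈ 𝒢, (Function.Injective g ∧ PM H (univ.image g)) ∧ ∀ i, g i ∉ Z)
    (hG2 : ∀ g ∈ 𝒢, ∀ g' ∈ 𝒢, g ≠ g' → ∀ i j, g i ≠ g' j)
    (hG3 : (Fintype.card J : ℝ) * 𝒢.card ≤ ξ / 2 * Fintype.card V)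
    (hG4 : ∀ Q : Finset V, Q.card = 2 * k → Even (Q ∩ A).card → κ * Fintype.card V ≤ ((𝒢.filter fun g => absorbs H g Q).card : ℝ)) :
    PM H univ := by
  obtain ⟨G, hG⟩ : ∃ G : Finset V, G = 𝒢.biUnion (fun g => univ.image g) := ⟨_, rfl⟩
  have hGPM : PM H G := by
    rw [hG]
    apply PM.biUnion _ _ (fun g hg => (hG1 g hg).1.2)
    intro g hg g' hg' hne
    simp only [Function.onFun]
    rw [disjoint_left]
    intro v hv hv'
    obtain ⟨i, -, rfl⟩ := mem_image.1 hv
    obtain ⟨j, -, hj⟩ := mem_image.1 hv'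
    exact hG2 g hg g' hg' hne i j hj.symm
  have hGcard : (G.card : ℝ) ≤ ξ / 2 * Fintype.card V := by
    refine le_trans ?_ hG3
    have : G.card ≤ 𝒢.card * Fintype.card J := by
      rw [hG]
      exact card_biUnion_le_card_mul _ _ _ (fun g _ => card_image_le.trans (by simp))
    calc (G.card : ℝ) ≤ ((𝒢.card * Fintype.card J : ℕ) : ℝ) := by exact_mod_cast this
      _ = _ := by push_cast; ring
  have hGZ : Disjoint G Z := by
    rw [hG, disjoint_biUnion_left]
    intro g hg
    rw [disjoint_left]
    intro v hv
    obtain ⟨i, -, rfl⟩ := mem_image.1 hv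
    exact (hG1 g hg).2 i
  have hGZPM := hGPM.union hZ hGZ
  obtain ⟨S, hS⟩ : ∃ S : Finset V, S = (G ∪ Z)ᶜ := ⟨_, rfl⟩
  have hScard : (G ∪ Z).card + S.card = Fintype.card V := by rw [hS]; exact card_add_card_compl _
  have hkS : k ∣ S.card := by
    rw [← Nat.dvd_add_right (hGZPM.dvd hH), hScard]; exact hkV
  have hZ2 : (Z.card : ℝ) ≤ ξ / 2 * Fintype.card V := by
    have a1 : (Z.card : ℝ) ≤ 2 * k := by exact_mod_cast hZc
    linarith
  obtain ⟨T, hTS, hT, hTL⟩ := hapm S (by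
    have : ((G ∪ Z).card : ℝ) ≤ G.card + Z.card := by exact_mod_cast card_union_le G Z
    have h' : ((G ∪ Z).card : ℝ) + S.card = Fintype.card V := by exact_mod_cast hScard
    linarith) hkS
  obtain ⟨L, hL⟩ : ∃ L : Finset V, L = S \ T := ⟨_, rfl⟩
  have hTG : Disjoint T (G ∪ Z) := by
    refine disjoint_of_subset_left hTS ?_
    rw [hS]; exact disjoint_compl_left
  have hLG : Disjoint L (G ∪ Z) := by
    rw [hL]
    refine disjoint_of_subset_left sdiff_subset ?_
    rw [hS]; exact disjoint_compl_left
  have hLT : Disjoint L T := by rw [hL]; exact sdiff_disjoint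
  have hkL : k ∣ L.card := by
    have : L.card + T.card = S.card := by rw [hL]; exact card_sdiff_add_card_eq_card hTS
    rw [← Nat.dvd_add_left (hT.dvd hH), this]; exact hkS
  have hcov : ∀ v, v ∈ G ∨ v ∈ Z ∨ v ∈ T ∨ v ∈ L := by
    intro v
    by_cases a : v ∈ G ∪ Z
    · rcases mem_union.1 a with a | a <;> simp [a]
    · have : v ∈ S := by rw [hS]; simpa using a
      by_cases b : v ∈ T
      · simp [b]
      · right; right; right; rw [hL]; exact mem_sdiff.2 ⟨this, b⟩
  rw [disjoint_union_right] at hTG hLG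
  obtain ⟨W, U, hWU, hdWU, hU, ⟨m, hm⟩, hWe⟩ := hZL L hLG.2 (by
    have : (L ∪ Z)ᶜ = G ∪ T := by
      ext v
      have := hcov v
      have x1 : v ∈ L → v ∉ G := fun h => disjoint_left.1 hLG.1 h
      have x2 : v ∈ L → v ∉ T := fun h => disjoint_left.1 hLT h
      have x3 : v ∈ G → v ∉ Z := fun h => disjoint_left.1 hGZ h
      have x4 : v ∈ T → v ∉ Z := fun h => disjoint_left.1 hTG.2 h
      simp only [mem_compl, mem_union]
      tauto
    rw [this]
    exact hGPM.union hT hTG.1.symm) hkL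
  have hWsub : W ⊆ L ∪ Z := by rw [← hWU]; exact subset_union_left
  have hUsub : U ⊆ L ∪ Z := by rw [← hWU]; exact subset_union_right
  have hGLZ : Disjoint G (L ∪ Z) := disjoint_union_right.2 ⟨hLG.1.symm, hGZ⟩
  have hm' : (m : ℝ) ≤ κ * Fintype.card V := by
    have a0 : W.card ≤ L.card + 2 * k := (card_le_card hWsub).trans ((card_union_le _ _).trans (by omega))
    have a1 : m ≤ W.card := by rw [hm]; exact Nat.le_mul_of_pos_left _ (by omega)
    have a2 : (m : ℝ) ≤ L.card + 2 * k := by exact_mod_cast a1.trans a0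
    rw [← hL] at hTL
    have a3 : η * (Fintype.card V : ℝ) ≤ κ / 2 * Fintype.card V := by gcongr
    linarith
  have hfinal := absorb_all (H := H) (A := A) (k := k) m 𝒢 W hm hWe (fun g hg => (hG1 g hg).1.2) hG2
    (by
      intro g hg i hi
      refine disjoint_left.1 hGLZ ?_ (hWsub hi)
      rw [hG]
      exact mem_biUnion.2 ⟨g, hg, mem_image_of_mem _ (mem_univ _)⟩)
    (by
      intro Q hQ hQe
      have := hG4 Q hQ hQe
      exact_mod_cast hm'.trans this)
  rw [← hG] at hfinal
  have hGW_U : Disjoint (G ∪ W) U := disjoint_union_left.2 ⟨disjoint_of_subset_right hUsub hGLZ, hdWU⟩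
  have h5 := hfinal.union hU hGW_U
  have hTd : Disjoint (G ∪ W ∪ U) T := by
    rw [union_assoc, hWU, disjoint_union_left, disjoint_union_left]
    exact ⟨hTG.1.symm, hLT, hTG.2.symm⟩
  have h6 := h5.union hT hTd
  have : G ∪ W ∪ U ∪ T = univ := by
    rw [union_assoc G, hWU, eq_univ_iff_forall]
    intro v
    have := hcov v
    simp only [mem_union]
    tauto
  rwa [this] at h6


lemma hex_lem {V : Type} [Fintype V] [DecidableEq V] [Nonempty V] (H : Finset (Finset V)) (A : Finset V) (q k c : ℕ) (hkq : k = q + 1)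
    (hnpos : (0:ℝ) < Fintype.card V) (h16 : (16 * k ^ 2 : ℝ) ≤ Fintype.card V)
    (hedge : 3/8 ≤ pr (fun e : Fin (q+1) → V => univ.image e ∈ H))
    (hwrong : pr (fun e : Fin (q+1) → V => univ.image e ∈ H ∧ (univ.image e ∩ A).card % 2 ≠ c) ≤ 1/4) :
    ∀ X : Finset V, X.card ≤ k → ∃ e ∈ H, Disjoint e X ∧ (e ∩ A).card % 2 = c := by
  intro X hX
  have e1 := pr_and_not (fun e : Fin (q+1) → V => univ.image e ∈ H) (fun e => (univ.image e ∩ A).card % 2 ≠ c)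
  have e2 := pr_and_not (fun e : Fin (q+1) → V => univ.image e ∈ H ∧ ¬ (univ.image e ∩ A).card % 2 ≠ c) (fun e => ∃ i, e i ∈ X)
  have e3 : pr (fun e : Fin (q+1) → V => (univ.image e ∈ H ∧ ¬ (univ.image e ∩ A).card % 2 ≠ c) ∧ ∃ i, e i ∈ X) ≤
      (Fintype.card (Fin (q+1)) : ℝ) * X.card / Fintype.card V := (pr_mono fun e h => h.2).trans (pr_meets_le X)
  have e4 : (Fintype.card (Fin (q+1)) : ℝ) * X.card / Fintype.card V ≤ 1/16 := by
    rw [div_le_iff₀ hnpos, Fintype.card_fin, ← hkq]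
    have : (X.card : ℝ) ≤ k := by exact_mod_cast hX
    have : (k : ℝ) * X.card ≤ k * k := by gcongr
    nlinarith
  obtain ⟨e, ⟨he, hp⟩, hm⟩ := exists_of_pr_pos (P := fun e : Fin (q+1) → V => (univ.image e ∈ H ∧ ¬ (univ.image e ∩ A).card % 2 ≠ c) ∧ ¬ ∃ i, e i ∈ X)
    (by linarith)
  refine ⟨_, he, ?_, not_not.1 hp⟩
  rw [disjoint_left]
  intro v hv
  obtain ⟨i, -, rfl⟩ := mem_image.1 hv
  exact fun h => hm ⟨i, h⟩

lemma pr_inst {Ω : Type} (i1 i2 : Fintype Ω) (P : Ω → Prop) : @pr Ω i1 P = @pr Ω i2 P := by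
  rw [Subsingleton.elim i1 i2]

theorem density_main (q d r : ℕ) (hq : 2 ≤ q) (hr : 2 ≤ r) (hd : 1 ≤ d) (hkdr : d + r = q + 1) (hkr : (q + 1) + 1 ≤ 2 * r)
    (ε : ℝ) (hε : 0 < ε) : ∃ γ > (0:ℝ), ∃ n0 : ℕ, ∀ (V : Type) [Fintype V] [DecidableEq V],
    n0 ≤ Fintype.card V → (q + 1) ∣ Fintype.card V → ∀ H : Finset (Finset V), (∀ e ∈ H, e.card = q + 1) →
    (∀ v, 1/2 - γ ≤ pr (fun z : Fin q → V => Lk H v z)) →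
    (∀ y : Fin d → V, Function.Injective y →
      gc ((q + 1 : ℕ) : ℝ) r r + ε ≤ pr (fun z : Fin r → V => univ.image (Sum.elim y z) ∈ H)) →
    (∀ A : Finset V, A.Nonempty → Aᶜ.Nonempty → ∀ c < 2,
      A.card % 2 ≠ (c * (Fintype.card V / (q + 1))) % 2 → ∃ e ∈ H, (e ∩ A).card % 2 ≠ c) →
    PM H univ := by
  obtain ⟨γ0, hγ0, β0, hβ0, n1, hn1⟩ := absorb_struct q hq (1/4) (by norm_num)
  obtain ⟨k, hkq⟩ : ∃ k, k = q + 1 := ⟨_, rfl⟩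
  have hrR : (2:ℝ) ≤ r := by exact_mod_cast hr
  obtain ⟨ξ, hξ⟩ : ∃ ξ : ℝ, ξ = min (1/2) (ε / (2 * r)) := ⟨_, rfl⟩
  have hξ0 : 0 < ξ := by rw [hξ]; exact lt_min (by norm_num) (by positivity)
  have hJ : Nonempty (JJ q) := ⟨Sum.inl (Sum.inl (0, 0))⟩
  obtain ⟨κ, hκ, n2, hn2⟩ := family (JJ q) (2 * k) (2 * k) (min β0 1) (ξ / 2) (lt_min hβ0 one_pos) (min_le_right _ _)
    (by positivity)
  obtain ⟨n3, hn3⟩ := apm_on (q+1) d r (by omega) hr hd hkdr hkr ε (min (κ/2) (1/2)) hε (lt_min (by positivity) (by norm_num))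
    (lt_of_le_of_lt (min_le_right _ _) (by norm_num))
  obtain ⟨n4, hn4⟩ := exists_nat_ge (2 * k / (ξ / 2))
  obtain ⟨n5, hn5⟩ := exists_nat_ge (2 * k / (κ / 2))
  refine ⟨min γ0 (1/8), lt_min hγ0 (by norm_num), n1 + n2 + n3 + n4 + n5 + 16 * k ^ 2 + 1, ?_⟩
  intro V _ _ hV hkV H hH h1 h2 h3
  rw [← hkq] at hkV hH h2 h3 hn3
  obtain ⟨A, c, hc, hA, hwrong, habs⟩ := hn1 V (by omega) H (by rw [← hkq]; exact hH)
    (fun v => le_trans (by linarith [min_le_left γ0 (1/8)]) (h1 v))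
  have hne : Nonempty V := Fintype.card_pos_iff.1 (by omega)
  have hnpos : (0:ℝ) < Fintype.card V := by exact_mod_cast Fintype.card_pos
  have hedge : 3/8 ≤ pr (fun e : Fin (q+1) → V => univ.image e ∈ H) := by
    rw [← pr_cons (fun e : Fin (q+1) → V => univ.image e ∈ H)]
    rw [pr_prod (fun v (z : Fin q → V) => univ.image (Fin.cons v z : Fin (q+1) → V) ∈ H)]
    rw [← av_const (Ω := V) (3/8)]
    apply av_mono
    intro v
    refine le_trans ?_ ((h1 v).trans (le_of_eq (pr_congr fun z => ?_)))
    · linarith [min_le_right γ0 (1/8)]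
    · rw [image_cons]; rfl
  have hex := hex_lem H A q k c hkq hnpos (by exact_mod_cast (by omega : 16 * k ^ 2 ≤ Fintype.card V)) hedge hwrong
  obtain ⟨Z, hZc, hZ, hZL⟩ := zlemma (by omega) hH hkV hc hA h3 hex
  obtain ⟨𝒢, hG1, hG2, hG3, hG4⟩ := hn2 V (by omega) (fun g Q => absorbs H g Q) (fun g => Function.Injective g ∧ PM H (univ.image g))
    (fun g Q h => ⟨h.1, h.2.2.1⟩) (univ.filter fun Q => Q.card = 2 * k ∧ Even (Q ∩ A).card)
    (fun Q hQ => (mem_filter.1 hQ).2.1)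
    (fun Q hQ => (min_le_left _ _).trans ((habs Q (by rw [← hkq]; exact (mem_filter.1 hQ).2.1) (mem_filter.1 hQ).2.2).trans_eq
      (pr_inst _ _ _))) Z hZc
  have hn4' : 2 * (k:ℝ) ≤ ξ / 2 * Fintype.card V := by
    rw [div_le_iff₀ (by positivity)] at hn4
    have a2 : (n4 : ℝ) ≤ Fintype.card V := by exact_mod_cast (by omega : n4 ≤ Fintype.card V)
    nlinarith
  have hn5' : 2 * (k:ℝ) ≤ κ / 2 * Fintype.card V := by
    rw [div_le_iff₀ (by positivity)] at hn5
    have a4 : (n5 : ℝ) ≤ Fintype.card V := by exact_mod_cast (by omega : n5 ≤ Fintype.card V)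
    nlinarith
  exact assemble H A k (by omega) ξ κ _ (min_le_left _ _) hn4' hn5' hkV hH
    (by rw [hξ]; exact hn3 V (by omega) H hH h2) Z hZc hZ hZL 𝒢 hG1 hG2 hG3
    (fun Q hQ hQe => hG4 Q (by simp [hQ, hQe]))

end PMH

namespace PMH
open Finset
open scoped Classical

section cnt
variable {V : Type} [Fintype V] [DecidableEq V]

lemma image_elim {D R : Type} [Fintype D] [Fintype R] (y : D → V) (z : R → V) :
    univ.image (Sum.elim y z) = univ.image y ∪ univ.image z := by
  ext v; simp

lemma card_image_eq (r : ℕ) (T : Finset V) (hT : T.card = r) :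
    (univ.filter fun z : Fin r → V => univ.image z = T).card = r.factorial := by
  have h1 : Fintype.card (Fin r ≃ T) = r.factorial := by
    have e : Fin r ≃ T := Fintype.equivOfCardEq (by simp [hT])
    rw [Fintype.card_equiv e, Fintype.card_fin]
  rw [← h1, ← card_univ]
  symm
  refine card_bij (fun σ _ i => (σ i : V)) ?_ ?_ ?_
  · intro σ _
    rw [mem_filter]
    refine ⟨mem_univ _, ?_⟩
    ext v
    simp only [mem_image, mem_univ, true_and]
    constructor
    · rintro ⟨i, rfl⟩; exact (σ i).2
    · intro hv; exact ⟨σ.symm ⟨v, hv⟩, by simp⟩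
  · intro σ _ τ _ h
    ext i
    exact congrFun h i
  · intro z hz
    have hz' : univ.image z = T := (mem_filter.1 hz).2
    have hm : ∀ i, z i ∈ T := fun i => by rw [← hz']; exact mem_image_of_mem _ (mem_univ _)
    have hb : Function.Bijective (fun i => (⟨z i, hm i⟩ : T)) := by
      rw [Fintype.bijective_iff_surjective_and_card]
      refine ⟨?_, by simp [hT]⟩
      rintro ⟨v, hv⟩
      rw [← hz'] at hv
      obtain ⟨i, -, hi⟩ := mem_image.1 hv
      exact ⟨i, Subtype.ext hi⟩
    exact ⟨Equiv.ofBijective _ hb, mem_univ _, rfl⟩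

lemma card_tuple (d r : ℕ) (H : Finset (Finset V)) (hH : ∀ e ∈ H, e.card = d + r) (S : Finset V) (hS : S.card = d) :
    (univ.filter fun z : Fin r → V => S ∪ univ.image z ∈ H).card = (H.filter fun e => S ⊆ e).card * r.factorial := by
  rw [card_eq_sum_card_fiberwise (f := fun z : Fin r → V => S ∪ univ.image z) (t := H.filter fun e => S ⊆ e)]
  · rw [← smul_eq_mul, ← sum_const]
    apply sum_congr rfl
    intro e he
    rw [mem_filter] at he
    rw [← card_image_eq r (e \ S) (by rw [card_sdiff_of_subset he.2, hH e he.1, hS]; omega)]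
    congr 1
    ext z
    simp only [mem_filter, mem_univ, true_and]
    constructor
    · rintro ⟨h1, h2⟩
      symm
      apply eq_of_subset_of_card_le
      · rw [← h2]; intro v hv; simp only [mem_sdiff, mem_union] at hv; tauto
      · rw [card_sdiff_of_subset he.2, hH e he.1, hS]
        exact card_image_le.trans (by simp)
    · intro h
      rw [h, union_sdiff_of_subset he.2]
      exact ⟨he.1, rfl⟩
  · intro z hz
    simp only [coe_filter, Set.mem_setOf_eq, mem_univ, true_and] at hz ⊢
    exact ⟨hz, subset_union_left⟩

lemma pr_tuple (d r : ℕ) (H : Finset (Finset V)) (hH : ∀ e ∈ H, e.card = d + r) (S : Finset V) (hS : S.card = d) :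
    pr (fun z : Fin r → V => S ∪ univ.image z ∈ H) =
      ((H.filter fun e => S ⊆ e).card : ℝ) * r.factorial / (Fintype.card V : ℝ) ^ r := by
  rw [pr_eq, card_tuple d r H hH S hS]
  simp

/-- parity split -/
lemma pr_parity [Nonempty V] (A : Finset V) (r : ℕ) (hr : 1 ≤ r) (s : ℕ)
    (hA : 2 * A.card ≤ Fintype.card V + 2 ∧ Fintype.card V ≤ 2 * A.card + 2) :
    1/2 - 1 / Fintype.card V ≤ pr (fun z : Fin r → V => Even (s + (univ.filter fun i => z i ∈ A).card)) := by
  have hn : (0:ℝ) < Fintype.card V := by exact_mod_cast Fintype.card_pos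
  have h1 : av (fun z : Fin r → V => ∏ i, (if z i ∈ A then (-1:ℝ) else 1)) =
      (((Fintype.card V : ℝ) - 2 * A.card) / Fintype.card V) ^ r := by
    rw [av_pi_prod (fun _ : Fin r => fun v => (if v ∈ A then (-1:ℝ) else 1))]
    simp only [prod_const, card_univ, Fintype.card_fin]
    congr 1
    unfold av
    congr 1
    have : ∀ v, (if v ∈ A then (-1:ℝ) else 1) = 1 - 2 * (if v ∈ A then 1 else 0) := by
      intro v; split_ifs <;> norm_num
    simp only [this]
    rw [sum_sub_distrib, ← mul_sum]
    simp
  have h2 : pr (fun z : Fin r → V => Even (s + (univ.filter fun i => z i ∈ A).card)) =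
      1/2 + (-1)^s / 2 * (((Fintype.card V : ℝ) - 2 * A.card) / Fintype.card V) ^ r := by
    rw [← h1, ← av_mul_left, ← av_const (Ω := Fin r → V) (1/2), ← av_add]
    unfold pr
    congr 1
    ext z
    rw [prod_ite]
    simp only [prod_const, one_pow, mul_one]
    have h3 : (-1:ℝ)^s / 2 * (-1) ^ (univ.filter fun i => z i ∈ A).card = (-1)^(s + (univ.filter fun i => z i ∈ A).card) / 2 := by
      rw [pow_add]; ring
    rw [h3]
    split_ifs with he
    · rw [he.neg_one_pow]; norm_num
    · rw [(Nat.not_even_iff_odd.1 he).neg_one_pow]; norm_num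
  rw [h2]
  obtain ⟨t, ht⟩ : ∃ t, t = ((Fintype.card V : ℝ) - 2 * A.card) / Fintype.card V := ⟨_, rfl⟩
  rw [← ht]
  have ha1 : 2 * (A.card : ℝ) ≤ Fintype.card V + 2 := by exact_mod_cast hA.1
  have ha2 : (Fintype.card V : ℝ) ≤ 2 * A.card + 2 := by exact_mod_cast hA.2
  have ha3 : (A.card : ℝ) ≤ Fintype.card V := by exact_mod_cast card_le_univ A
  have ht1 : |t| ≤ 2 / Fintype.card V := by
    rw [ht, abs_div, abs_of_pos hn]
    gcongr
    rw [abs_le]; constructor <;> linarith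
  have ht2 : |t| ≤ 1 := by
    rw [ht, abs_div, abs_of_pos hn, div_le_one hn, abs_le]
    constructor <;> linarith [(by positivity : (0:ℝ) ≤ A.card)]
  have ht3 : |(-1:ℝ)^s / 2 * t ^ r| ≤ 1 / Fintype.card V := by
    rw [abs_mul, abs_div, abs_pow, abs_pow, abs_neg, abs_one, one_pow]
    have : |t| ^ r ≤ |t| := pow_le_of_le_one (abs_nonneg _) ht2 (by omega)
    have h5 : 2 / (Fintype.card V : ℝ) = 2 * (1 / Fintype.card V) := by ring
    rw [abs_of_pos (by norm_num : (0:ℝ) < 2)]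
    linarith
  linarith [(abs_le.1 ht3).1]

lemma even_class_density [Nonempty V] (A : Finset V) (d r : ℕ) (hr : 1 ≤ r)
    (hA : 2 * A.card ≤ Fintype.card V + 2 ∧ Fintype.card V ≤ 2 * A.card + 2) (S : Finset V) (hS : S.card = d) :
    1/2 - (1 + (r:ℝ)^2 + r * d) / Fintype.card V ≤ pr (fun z : Fin r → V =>
      S ∪ univ.image z ∈ ((univ.powersetCard (d + r)).filter fun e : Finset V => Even (e ∩ A).card)) := by
  have h1 := pr_parity (V := V) A r hr (S ∩ A).card hA
  have h2 := pr_not_inj_le (V := V) (κ := Fin r)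
  have h3 := pr_meets_le (V := V) (κ := Fin r) S
  rw [Fintype.card_fin] at h2 h3
  rw [hS] at h3
  have h4 : pr (fun z : Fin r → V => Even ((S ∩ A).card + (univ.filter fun i => z i ∈ A).card)) ≤
      pr (fun z : Fin r → V => (S ∪ univ.image z ∈ ((univ.powersetCard (d + r)).filter fun e : Finset V => Even (e ∩ A).card)) ∨
        ((¬ Function.Injective z) ∨ ∃ i, z i ∈ S)) := by
    apply pr_mono
    intro z hz
    by_contra hcon
    push Not at hcon
    obtain ⟨c1, c2, c3⟩ := hcon
    apply c1
    have hdj : Disjoint S (univ.image z) := by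
      rw [disjoint_right]
      intro v hv
      obtain ⟨i, -, rfl⟩ := mem_image.1 hv
      exact c3 i
    rw [mem_filter, mem_powersetCard]
    refine ⟨⟨subset_univ _, ?_⟩, ?_⟩
    · rw [card_union_of_disjoint hdj, hS, card_image_of_injective _ c2]; simp
    · rw [card_inter_union hdj]
      have : univ.image z ∩ A = (univ.filter fun i => z i ∈ A).image z := by
        ext v; simp only [mem_inter, mem_image, mem_univ, true_and, mem_filter]
        constructor
        · rintro ⟨⟨i, rfl⟩, h⟩; exact ⟨i, h, rfl⟩
        · rintro ⟨i, h, rfl⟩; exact ⟨⟨i, rfl⟩, h⟩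
      rw [this, card_image_of_injective _ c2]
      exact hz
  have h5 := h4.trans ((pr_or_le _ _).trans (add_le_add le_rfl (pr_or_le _ _)))
  have h6 : (1 + (r:ℝ)^2 + r * d) / Fintype.card V = 1 / Fintype.card V + (r:ℝ)^2 / Fintype.card V + r * d / Fintype.card V := by
    ring
  linarith

lemma link_density [Nonempty V] (q d r : ℕ) (hd : 1 ≤ d) (hq : d + r = q + 1) (H : Finset (Finset V)) (p : ℝ) (hp : p ≤ 1)
    (h : ∀ S : Finset V, S.card = d → p ≤ pr (fun z : Fin r → V => S ∪ univ.image z ∈ H)) (v : V) :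
    p - (d:ℝ)^2 / Fintype.card V ≤ pr (fun z : Fin q → V => Lk H v z) := by
  obtain ⟨d', rfl⟩ : ∃ d', d = d' + 1 := ⟨d - 1, by omega⟩
  have e : Fin q ≃ Fin d' ⊕ Fin r := Fintype.equivOfCardEq (by simp; omega)
  have h1 := pr_comp_inj (V := V) e e.injective (fun z : Fin q → V => Lk H v z)
  rw [← h1, ← pr_sumElim]
  have h2 : ∀ a : Fin d' → V, p - (if ((¬ Function.Injective a) ∨ ∃ i, a i ∈ ({v} : Finset V)) then (1:ℝ) else 0) ≤
      pr (fun b : Fin r → V => Lk H v (fun i => Sum.elim a b (e i))) := by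
    intro a
    split_ifs with ha
    · linarith [pr_nonneg (fun b : Fin r → V => Lk H v (fun i => Sum.elim a b (e i)))]
    · push Not at ha
      have hv : v ∉ univ.image a := by
        intro hv
        obtain ⟨i, -, hi⟩ := mem_image.1 hv
        exact ha.2 i (by simp [hi])
      have h3 := h (insert v (univ.image a)) (by rw [card_insert_of_notMem hv, card_image_of_injective _ ha.1]; simp)
      rw [sub_zero]
      refine h3.trans (le_of_eq (pr_congr fun b => ?_))
      unfold Lk
      have : univ.image (fun i => Sum.elim a b (e i)) = univ.image a ∪ univ.image b := by
        rw [← image_elim]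
        ext w
        simp only [mem_image, mem_univ, true_and]
        constructor
        · rintro ⟨i, hi⟩; exact ⟨e i, hi⟩
        · rintro ⟨x, hx⟩; exact ⟨e.symm x, by simpa using hx⟩
      rw [this, insert_union]
  have h4 := av_mono h2
  rw [av_sub, av_const] at h4
  refine le_trans ?_ h4
  have h5 := pr_or_le (fun a : Fin d' → V => ¬ Function.Injective a) (fun a => ∃ i, a i ∈ ({v} : Finset V))
  have h6 := pr_not_inj_le (V := V) (κ := Fin d')
  have h7 := pr_meets_le (V := V) (κ := Fin d') {v}
  rw [Fintype.card_fin] at h6 h7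
  have h8 : (d' : ℝ)^2 / Fintype.card V + d' * (({v} : Finset V).card : ℝ) / Fintype.card V ≤ ((d' + 1 : ℕ) : ℝ)^2 / Fintype.card V := by
    rw [← add_div]
    gcongr
    push_cast [card_singleton]
    nlinarith [(by positivity : (0:ℝ) ≤ d')]
  have h9 : av (fun a : Fin d' → V => if ((¬ Function.Injective a) ∨ ∃ i, a i ∈ ({v} : Finset V)) then (1:ℝ) else 0) =
    pr (fun a : Fin d' → V => (¬ Function.Injective a) ∨ ∃ i, a i ∈ ({v} : Finset V)) := by
    unfold pr; congr 1; ext a; congr 1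
  rw [h9]
  linarith

lemma choose_ratio (n d r : ℕ) (hn : d + r ≤ n) (hn0 : 1 ≤ n) :
    1 - (r:ℝ) * (d + r) / n ≤ ((n - d).choose r : ℝ) * r.factorial / (n:ℝ)^r ∧
    ((n - d).choose r : ℝ) * r.factorial / (n:ℝ)^r ≤ 1 := by
  have hnR : (0:ℝ) < n := by exact_mod_cast hn0
  have h0 : ((n - d).choose r : ℝ) * r.factorial = ((n - d).descFactorial r : ℕ) := by
    rw [Nat.descFactorial_eq_factorial_mul_choose]; push_cast; ring
  rw [h0]
  constructor
  · have h1 : ((n - (d + r)) ^ r : ℕ) ≤ (n - d).descFactorial r :=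
      le_trans (Nat.pow_le_pow_left (by omega) r) (Nat.pow_sub_le_descFactorial (n - d) r)
    have h2 : ((n:ℝ) - (d + r)) ^ r ≤ ((n - d).descFactorial r : ℕ) := by
      have : ((n - (d + r) : ℕ) : ℝ) = (n:ℝ) - (d + r) := by push_cast [Nat.cast_sub hn]; ring
      rw [← this]; exact_mod_cast h1
    rw [le_div_iff₀ (by positivity)]
    refine le_trans ?_ h2
    have hle : ((d:ℝ) + r) ≤ n := by exact_mod_cast hn
    have h3 := one_add_mul_le_pow (a := -(((d:ℝ) + r) / n)) (by
      have : ((d:ℝ) + r) / n ≤ 1 := by rw [div_le_one hnR]; exact hle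
      linarith) r
    have h4 : ((n:ℝ) - (d + r)) ^ r = (1 + -(((d:ℝ) + r) / n)) ^ r * (n:ℝ)^r := by
      rw [← mul_pow]; congr 1; field_simp; ring
    rw [h4]
    gcongr
    refine le_trans (le_of_eq ?_) h3
    ring
  · rw [div_le_one (by positivity)]
    exact_mod_cast (Nat.descFactorial_le_pow _ _).trans (Nat.pow_le_pow_left (Nat.sub_le _ _) r)

end cnt

end PMH

namespace PMH
open Finset
open scoped Classical

lemma minDeg_attained {n d : ℕ} (hdn : d ≤ n) (H : Finset (Finset (Fin n))) :
    ∃ S : Finset (Fin n), S.card = d ∧ (H.filter fun e => S ⊆ e).card = minDeg H d := by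
  have : minDeg H d ∈ { m | ∃ S : Finset (Fin n), S.card = d ∧ (H.filter fun e => S ⊆ e).card = m } := by
    apply Nat.sInf_mem
    obtain ⟨S, -, hS⟩ := exists_subset_card_eq (show d ≤ (univ : Finset (Fin n)).card by simpa using hdn)
    exact ⟨_, S, hS, rfl⟩
  exact this

lemma minDeg_le_deltaExt {n k d : ℕ} (hdn : d ≤ n) (H : Finset (Finset (Fin n))) (hH : H ∈ Hext n k) :
    minDeg H d ≤ deltaExt n k d := by
  apply le_csSup
  · refine ⟨Fintype.card (Finset (Fin n)), ?_⟩
    rintro m ⟨H', -, rfl⟩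
    obtain ⟨S, -, hS⟩ := minDeg_attained hdn H'
    rw [← hS]
    exact card_le_univ _
  · exact ⟨H, hH, rfl⟩

lemma exists_ext_degree {n k d : ℕ} (hdn : d ≤ n) (H0 : Finset (Finset (Fin n))) (hH0 : H0 ∈ Hext n k) :
    ∃ S : Finset (Fin n), S.card = d ∧ (H0.filter fun e => S ⊆ e).card ≤ deltaExt n k d := by
  obtain ⟨S, hS, h⟩ := minDeg_attained hdn H0
  exact ⟨S, hS, h.le.trans (minDeg_le_deltaExt hdn H0 hH0)⟩

lemma not_sub_ext {n k d : ℕ} (hdn : d ≤ n) (H H0 : Finset (Finset (Fin n))) (hH0 : H0 ∈ Hext n k)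
    (hdeg : ∀ S : Finset (Fin n), S.card = d → deltaExt n k d + 1 ≤ (H.filter fun e => S ⊆ e).card) : ¬ H ⊆ H0 := by
  intro h
  obtain ⟨S, hS, h1⟩ := exists_ext_degree hdn H0 hH0
  have h2 := hdeg S hS
  have h3 : (H.filter fun e => S ⊆ e).card ≤ (H0.filter fun e => S ⊆ e).card := card_le_card (filter_subset_filter _ h)
  omega

lemma final_main (k d : ℕ) (hk : 3 ≤ k) (hd : 1 ≤ d) (hdk : 2 * d < k)
    (ε : ℝ) (hε : 0 < ε) :
    ∃ n₀ : ℕ, ∀ n : ℕ, n₀ ≤ n → k ∣ n →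
      ∀ H : Finset (Finset (Fin n)), H ⊆ Finset.univ.powersetCard k →
        (∀ S : Finset (Fin n), S.card = d → deltaExt n k d + 1 ≤ (H.filter fun e => S ⊆ e).card) →
        (∀ S : Finset (Fin n), S.card = d →
          (gc k ((k - d : ℕ) : ℝ) (k - d) + ε) * ((n - d).choose (k - d) : ℝ) ≤ ((H.filter fun e => S ⊆ e).card : ℝ)) →
        PM H univ := by
  obtain ⟨q, rfl⟩ : ∃ q, k = q + 1 := ⟨k - 1, by omega⟩
  obtain ⟨r, hr⟩ : ∃ r, r = q + 1 - d := ⟨_, rfl⟩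
  rw [← hr]
  have hdr : d + r = q + 1 := by omega
  obtain ⟨g, hg⟩ : ∃ g, g = gc ((q + 1 : ℕ) : ℝ) r r := ⟨_, rfl⟩
  rw [← hg]
  obtain ⟨γ, hγ, n1, hn1⟩ := density_main q d r (by omega) (by omega) hd hdr (by omega) (ε / 2) (by positivity)
  obtain ⟨n2, hn2⟩ := exists_nat_ge ((1 + (r:ℝ)^2 + r * d + (d:ℝ)^2) / γ)
  obtain ⟨n3, hn3⟩ := exists_nat_ge (|g + ε| * (r * (d + r)) / (ε / 2))
  refine ⟨n1 + n2 + n3 + (q + 1) + 4, ?_⟩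
  intro n hn hkn H hHs hdeg1 hdeg2
  have hnpos : (0:ℝ) < n := by exact_mod_cast (by omega : 0 < n)
  have hne : Nonempty (Fin n) := ⟨⟨0, by omega⟩⟩
  have hH : ∀ e ∈ H, e.card = q + 1 := fun e he => (mem_powersetCard.1 (hHs he)).2
  have hH' : ∀ e ∈ H, e.card = d + r := by rw [hdr]; exact hH
  refine hn1 (Fin n) (by simp; omega) (by simpa using hkn) H hH ?_ ?_ ?_
  · intro v
    -- half density
    obtain ⟨a, ha, ha1, ha2⟩ : ∃ a, a % 2 = 1 ∧ 2 * a ≤ n + 2 ∧ n ≤ 2 * a + 2 := by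
      rcases Nat.mod_two_eq_zero_or_one (n / 2) with h | h
      · exact ⟨n / 2 + 1, by omega, by omega, by omega⟩
      · exact ⟨n / 2, by omega, by omega, by omega⟩
    obtain ⟨A, -, hA⟩ := exists_subset_card_eq (show a ≤ (univ : Finset (Fin n)).card by simp; omega)
    have hAne : A.Nonempty := card_pos.1 (by omega)
    have hAc : Aᶜ.Nonempty := card_pos.1 (by rw [card_compl, Fintype.card_fin]; omega)
    obtain ⟨S0, hS0, hS0d⟩ := exists_ext_degree (n := n) (k := q + 1) (d := d) (by omega)
      ((univ.powersetCard (q + 1)).filter fun e => Even (e ∩ A).card)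
      ⟨A, hAne, hAc, Or.inl ⟨Nat.odd_iff.2 (by omega), rfl⟩⟩
    have h1 := even_class_density A d r (by omega) (by rw [Fintype.card_fin, hA]; exact ⟨ha1, ha2⟩) S0 hS0
    rw [hdr, pr_tuple d r _ (by rw [hdr]; intro e he; exact (mem_powersetCard.1 (mem_filter.1 he).1).2) S0 hS0] at h1
    have h2 : ∀ S : Finset (Fin n), S.card = d → 1/2 - (1 + (r:ℝ)^2 + r * d) / Fintype.card (Fin n) ≤
        pr (fun z : Fin r → Fin n => S ∪ univ.image z ∈ H) := by
      intro S hS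
      refine h1.trans ?_
      rw [pr_tuple d r H hH' S hS]
      have h3 := hS0d.trans ((Nat.le_succ _).trans (hdeg1 S hS))
      exact div_le_div_of_nonneg_right (mul_le_mul_of_nonneg_right (by exact_mod_cast h3) (by positivity)) (by positivity)
    have h4 := link_density q d r hd hdr H _ (by
      have : 0 ≤ (1 + (r:ℝ)^2 + r * d) / Fintype.card (Fin n) := by positivity
      linarith) h2 v
    refine le_trans ?_ h4
    rw [Fintype.card_fin]
    have h5 : (1 + (r:ℝ)^2 + r * d + (d:ℝ)^2) / n ≤ γ := by
      rw [div_le_iff₀ hγ] at hn2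
      rw [div_le_iff₀ hnpos]
      have : (n2 : ℝ) ≤ n := by exact_mod_cast (by omega : n2 ≤ n)
      nlinarith
    have h6 : (1 + (r:ℝ)^2 + r * d + (d:ℝ)^2) / n = (1 + (r:ℝ)^2 + r * d) / n + (d:ℝ)^2 / n := by ring
    linarith
  · intro y hy
    have hS : (univ.image y).card = d := by rw [card_image_of_injective _ hy]; simp
    have h1 := hdeg2 _ hS
    have h2 : pr (fun z : Fin r → Fin n => univ.image (Sum.elim y z) ∈ H) =
        pr (fun z : Fin r → Fin n => univ.image y ∪ univ.image z ∈ H) := by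
      apply pr_congr; intro z; rw [image_elim]
    rw [h2, pr_tuple d r H hH' _ hS, Fintype.card_fin, ← hg]
    obtain ⟨b1, b2⟩ := choose_ratio n d r (by omega) (by omega)
    obtain ⟨x, hx⟩ : ∃ x, x = ((n - d).choose r : ℝ) * r.factorial / (n:ℝ)^r := ⟨_, rfl⟩
    rw [← hx] at b1 b2
    have h3 : (g + ε) * x ≤ ((H.filter fun e => univ.image y ⊆ e).card : ℝ) * r.factorial / (n:ℝ)^r := by
      rw [hx]
      calc (g + ε) * (((n - d).choose r : ℝ) * r.factorial / (n:ℝ)^r)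
          = ((g + ε) * ((n - d).choose r : ℝ)) * r.factorial / (n:ℝ)^r := by ring
        _ ≤ _ := by gcongr
    refine le_trans ?_ h3
    have h4 : |g + ε| * ((r:ℝ) * (d + r) / n) ≤ ε / 2 := by
      rw [div_le_iff₀ (by positivity)] at hn3
      rw [← mul_div_assoc, div_le_iff₀ hnpos]
      have : (n3 : ℝ) ≤ n := by exact_mod_cast (by omega : n3 ≤ n)
      nlinarith
    have h5 : (g + ε) * (1 - x) ≤ |g + ε| * (1 - x) :=
      mul_le_mul_of_nonneg_right (le_abs_self _) (by linarith)
    have h6 : |g + ε| * (1 - x) ≤ |g + ε| * ((r:ℝ) * (d + r) / n) := by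
      gcongr; linarith
    linarith
  · intro A hA hAc c hc hpar
    rw [Fintype.card_fin] at hpar
    by_contra hcon
    push Not at hcon
    interval_cases c
    · refine not_sub_ext (n := n) (k := q + 1) (by omega) H ((univ.powersetCard (q + 1)).filter fun e => Even (e ∩ A).card)
        ⟨A, hA, hAc, Or.inl ⟨Nat.odd_iff.2 (by omega), rfl⟩⟩ hdeg1 ?_
      intro e he
      exact mem_filter.2 ⟨hHs he, Nat.even_iff.2 (hcon e he)⟩
    · refine not_sub_ext (n := n) (k := q + 1) (by omega) H ((univ.powersetCard (q + 1)).filter fun e => Odd (e ∩ A).card)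
        ⟨A, hA, hAc, Or.inr ⟨?_, rfl⟩⟩ hdeg1 ?_
      · rw [Int.odd_iff]
        generalize n / (q + 1) = N at *
        omega
      intro e he
      exact mem_filter.2 ⟨hHs he, Nat.odd_iff.2 (hcon e he)⟩

end PMH

theorem stmt_2 (k d : ℕ) (hk : 3 ≤ k) (hd : 1 ≤ d) (hdk : 2 * d < k)
    (ε : ℝ) (hε : 0 < ε) :
    ∃ n₀ : ℕ, ∀ n : ℕ, n₀ ≤ n → k ∣ n →
      ∀ H : Finset (Finset (Fin n)), H ⊆ Finset.univ.powersetCard k →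
        (∀ S : Finset (Fin n), S.card = d →
          max ((deltaExt n k d : ℝ) + 1)
              (((1 : ℝ) - (1 - ((k : ℝ) - d) * ((k : ℝ) - 2 * d - 1) / ((k : ℝ) - 1) ^ 2) *
                  (1 - 1 / (k : ℝ)) ^ (k - d) + ε) * ((n - d).choose (k - d) : ℝ)) ≤
            ((H.filter fun e => S ⊆ e).card : ℝ)) →
        HasPerfectMatching H := by
  obtain ⟨n₀, h⟩ := PMH.final_main k d hk hd hdk ε hε
  refine ⟨n₀, fun n hn hkn H hH hdeg => ?_⟩
  refine h n hn hkn H hH (fun S hS => ?_) (fun S hS => ?_)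
  · exact_mod_cast (le_max_left _ _).trans (hdeg S hS)
  · refine le_trans (le_of_eq ?_) ((le_max_right _ _).trans (hdeg S hS))
    have : ((k - d : ℕ) : ℝ) = (k:ℝ) - d := by rw [Nat.cast_sub (by omega)]
    unfold PMH.gc
    rw [this]
    congr 5
    ring
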